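/- There exists δ > 0 such that for every ε ∈ C²(ℝ²) with ∫_{ℝ²} (ε² + |∇ε|² + |∇⁽²⁾ε|²)/U < ∞ (where |∇⁽²⁾ε|² is the sum of squares of all second-order partial derivatives) satisfying the orthogonality conditions ⟨ε, ΛU⟩ = ⟨ε, ∂_{y₁}U⟩ = ⟨ε, ∂_{y₂}U⟩ = 0, one has ∫_{ℝ²} |L₀ε|²/U ≥ δ ( ∫_{ℝ²} (1+|y|)⁴ |Δε|² + ∫_{ℝ²} (1+|y|)² |∇ε|² + ∫_{ℝ²} ε² + ∫_{ℝ²} |∇Ψ_ε|²/(1+|y|)⁴ ), where L₀ε = ∇·(U ∇(ε/U − Ψ_ε)). -/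

import Mathlib

open MeasureTheory
open scoped RealInnerProductSpace

noncomputable section

abbrev E2 : Type := EuclideanSpace ℝ (Fin 2)

/-- The stationary state `U(y) = 8 / (1 + |y|²)²`. -/
def U2 (y : E2) : ℝ := 8 / (1 + ‖y‖ ^ 2) ^ 2

/-- The 2D Poisson field `Ψ_g(x) = −(1/2π) ∫ log|x−y| g(y) dy`. -/
def Psi (g : E2 → ℝ) (x : E2) : ℝ :=
  -(1 / (2 * Real.pi)) * ∫ y : E2, Real.log ‖x - y‖ * g y

/-- The scaling operator `Λf(y) = 2 f(y) + y·∇f(y)`. -/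
def Lam (f : E2 → ℝ) (y : E2) : ℝ := 2 * f y + ⟪y, gradient f y⟫

/-- Partial derivative in the `i`-th coordinate direction. -/
def pd (i : Fin 2) (f : E2 → ℝ) (y : E2) : ℝ := fderiv ℝ f y (EuclideanSpace.single i 1)

/-- The rescaled stationary state `U_ν(y) = ν⁻² U(y/ν)`. -/
def Unu (ν : ℝ) (y : E2) : ℝ := (1 / ν ^ 2) * U2 ((1 / ν) • y)

/-- Divergence of a vector field on `ℝ²`. -/
def div2 (V : E2 → E2) (y : E2) : ℝ :=
  ∑ i : Fin 2, fderiv ℝ (fun z => V z i) y (EuclideanSpace.single i 1)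

/-- Laplacian on `ℝ²` (sum of pure second partials). -/
def lap2 (f : E2 → ℝ) (y : E2) : ℝ :=
  ∑ i : Fin 2, pd i (pd i f) y

/-- The operator `L₀ ε = ∇·(U ∇(ε/U − Ψ_ε))`. -/
def L0 (ε : E2 → ℝ) (y : E2) : ℝ :=
  div2 (fun z => U2 z • gradient (fun w => ε w / U2 w - Psi ε w) z) y


def ee (i : Fin 2) : E2 := EuclideanSpace.single i 1
def rho (y : E2) : ℝ := 1 + (y 0)^2 + (y 1)^2
def kap (y : E2) : ℝ := (rho y)⁻¹

lemma rho_eq (y : E2) : rho y = 1 + ‖y‖^2 := by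
  rw [EuclideanSpace.norm_sq_eq]; simp [rho, Fin.sum_univ_two]; ring
lemma rho_one (y : E2) : 1 ≤ rho y := by unfold rho; nlinarith [sq_nonneg (y 0), sq_nonneg (y 1)]
lemma rho_pos (y : E2) : 0 < rho y := lt_of_lt_of_le one_pos (rho_one y)
lemma kap_pos (y : E2) : 0 < kap y := inv_pos.2 (rho_pos y)
lemma kap_le (y : E2) : kap y ≤ 1 := inv_le_one_of_one_le₀ (rho_one y)
@[fun_prop] lemma cont_coord (i : Fin 2) : Continuous (fun y : E2 => y i) := by fun_prop
@[fun_prop] lemma cont_rho : Continuous rho := by unfold rho; fun_prop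
@[fun_prop] lemma cont_kap : Continuous kap := by
  unfold kap; exact cont_rho.inv₀ (fun y => (rho_pos y).ne')
lemma cont_rho_zpow (k : ℤ) : Continuous (fun y => rho y ^ k) :=
  cont_rho.zpow₀ k (fun y => Or.inl (rho_pos y).ne')

def HD (i : Fin 2) (f f' : E2 → ℝ) : Prop := ∀ y, HasLineDerivAt ℝ f (f' y) y (ee i)

namespace HD
variable {i : Fin 2} {f f' g g' : E2 → ℝ}
lemma add (hf : HD i f f') (hg : HD i g g') : HD i (fun y => f y + g y) (fun y => f' y + g' y) := by
  intro y; have := HasDerivAt.add (hf y) (hg y); exact this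
lemma sub (hf : HD i f f') (hg : HD i g g') : HD i (fun y => f y - g y) (fun y => f' y - g' y) := by
  intro y; have := HasDerivAt.sub (hf y) (hg y); exact this
lemma mul (hf : HD i f f') (hg : HD i g g') :
    HD i (fun y => f y * g y) (fun y => f' y * g y + f y * g' y) := by
  intro y; have := HasDerivAt.fun_mul (hf y) (hg y); simpa [HasLineDerivAt] using this
lemma const (c : ℝ) : HD i (fun _ => c) (fun _ => 0) := by
  intro y; exact hasDerivAt_const _ _
lemma cmul (c : ℝ) (hf : HD i f f') : HD i (fun y => c * f y) (fun y => c * f' y) := by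
  intro y; have := HasDerivAt.const_mul c (hf y); exact this
lemma coord (j : Fin 2) : HD i (fun y => y j) (fun _ => ee i j) := by
  intro y
  have h := ((hasDerivAt_id (0:ℝ)).mul_const (ee i j)).const_add (y j)
  simpa [HasLineDerivAt] using h
lemma inv (hf : HD i f f') (h0 : ∀ y, f y ≠ 0) : HD i (fun y => (f y)⁻¹) (fun y => - f' y / (f y)^2) := by
  intro y
  have := HasDerivAt.fun_inv (hf y) (by simpa using h0 y)
  simpa [HasLineDerivAt] using this
lemma congr' (hf : HD i f f') (h : ∀ y, f' y = g' y) : HD i f g' := by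
  intro y; rw [← h]; exact hf y
lemma of_contDiff (hf : Differentiable ℝ f) : HD i f (pd i f) := by
  intro y; exact ((hf y).hasFDerivAt.hasLineDerivAt (ee i))
lemma unique (hf : HD i f f') (hg : HD i f g') : f' = g' := by
  funext y; exact HasDerivAt.unique (hf y) (hg y)
lemma hasDerivAt (hf : HD i f f') (y : E2) (t : ℝ) :
    HasDerivAt (fun s : ℝ => f (y + s • ee i)) (f' (y + t • ee i)) t := by
  have h := hf (y + t • ee i)
  unfold HasLineDerivAt at h
  have h2 : HasDerivAt (fun s : ℝ => s - t) 1 t := by simpa using (hasDerivAt_id t).sub_const t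
  have h0 : HasDerivAt (fun s : ℝ => f (y + t • ee i + s • ee i)) (f' (y + t • ee i)) ((fun s : ℝ => s - t) t) := by simpa using h
  have h3 := HasDerivAt.comp (h := fun s : ℝ => s - t) t h0 h2
  simp only [mul_one] at h3
  refine h3.congr_of_eventuallyEq (Filter.Eventually.of_forall fun s => ?_)
  simp only [Function.comp]
  congr 1
  rw [add_assoc, ← add_smul]; congr 2; ring
end HD

lemma ee_00 : ee 0 0 = 1 := by simp [ee]
lemma ee_01 : ee 0 1 = 0 := by simp [ee]
lemma ee_10 : ee 1 0 = 0 := by simp [ee]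
lemma ee_11 : ee 1 1 = 1 := by simp [ee]

lemma HD_rho (i : Fin 2) : HD i rho (fun y => 2 * y i) := by
  have := ((HD.const (i := i) 1).add ((HD.coord 0).mul (HD.coord 0))).add ((HD.coord (i := i) 1).mul (HD.coord 1))
  have h2 : rho = fun y : E2 => (1 + y 0 * y 0) + y 1 * y 1 := by funext y; unfold rho; ring
  rw [h2]
  refine this.congr' ?_
  intro y
  fin_cases i <;> simp [ee_00, ee_01, ee_10, ee_11] <;> ring
lemma HD_kap (i : Fin 2) : HD i kap (fun y => -2 * y i * kap y ^ 2) := by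
  have := (HD_rho i).inv (fun y => (rho_pos y).ne')
  refine HD.congr' this fun y => ?_
  unfold kap; have := rho_pos y; field_simp

/-- zero integral -/
def ZI (f : E2 → ℝ) : Prop := Integrable f ∧ ∫ y, f y = 0
namespace ZI
variable {f g : E2 → ℝ}
lemma add (hf : ZI f) (hg : ZI g) : ZI (fun y => f y + g y) :=
  ⟨hf.1.add hg.1, by rw [integral_add hf.1 hg.1, hf.2, hg.2, add_zero]⟩
lemma sub (hf : ZI f) (hg : ZI g) : ZI (fun y => f y - g y) :=
  ⟨hf.1.sub hg.1, by rw [integral_sub hf.1 hg.1, hf.2, hg.2, sub_zero]⟩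
lemma cmul (c : ℝ) (hf : ZI f) : ZI (fun y => c * f y) :=
  ⟨hf.1.const_mul c, by rw [integral_const_mul, hf.2, mul_zero]⟩
lemma congr (hf : ZI f) (h : ∀ y, f y = g y) : ZI g := by
  have : f = g := funext h
  rwa [← this]
end ZI

lemma ibp {i : Fin 2} {h h' : E2 → ℝ} (hd : HD i h h') (hi : Integrable h) (hi' : Integrable h') : ZI h' := by
  refine ⟨hi', ?_⟩
  have key := integral_bilinear_hasLineDerivAt_right_eq_neg_left_of_integrable (μ := volume)
    (f := fun _ : E2 => (1:ℝ)) (f' := fun _ => 0) (g := h) (g' := h') (v := ee i)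
    (B := ContinuousLinearMap.mul ℝ ℝ) (by simp) (by simpa using hi') (by simpa using hi)
    (fun x _ => hasDerivAt_const _ _) (fun x _ => hd x)
  simpa using key

/-- weighted spaces -/
def M (k : ℤ) (f : E2 → ℝ) : Prop := Continuous f ∧ Integrable (fun y => rho y ^ k * f y ^ 2)
def Cf (n : ℤ) (c : E2 → ℝ) : Prop := Continuous c ∧ ∃ C : ℝ, ∀ y, c y ^ 2 ≤ C * rho y ^ n

lemma integrable_of_le {f g : E2 → ℝ} (hf : Continuous f) (hg : Integrable g) (h : ∀ y, |f y| ≤ g y) :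
    Integrable f := hg.mono' hf.aestronglyMeasurable (Filter.Eventually.of_forall h)

namespace M
variable {k l : ℤ} {f g c : E2 → ℝ}
lemma cont (hf : M k f) : Continuous f := hf.1
lemma of_le (hf : M k f) (hg : Continuous g) (C : ℝ) (h : ∀ y, rho y ^ l * g y ^ 2 ≤ C * (rho y ^ k * f y ^ 2)) : M l g := by
  refine ⟨hg, integrable_of_le ((cont_rho_zpow l).mul (hg.pow 2)) (hf.2.const_mul C) fun y => ?_⟩
  rw [abs_of_nonneg (mul_nonneg (zpow_nonneg (rho_pos y).le _) (sq_nonneg _))]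
  exact h y
lemma mono (hf : M k f) (h : l ≤ k) : M l f :=
  hf.of_le hf.1 1 fun y => by
    rw [one_mul]
    exact mul_le_mul_of_nonneg_right (zpow_le_zpow_right₀ (rho_one y) h) (sq_nonneg _)
lemma add (hf : M k f) (hg : M k g) : M k (fun y => f y + g y) := by
  refine ⟨hf.1.add hg.1, integrable_of_le ((cont_rho_zpow k).mul ((hf.1.add hg.1).pow 2)) ((hf.2.add hg.2).const_mul 2) fun y => ?_⟩
  have hp : 0 ≤ rho y ^ k := zpow_nonneg (rho_pos y).le _
  rw [abs_of_nonneg (mul_nonneg hp (sq_nonneg _))]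
  simp only [Pi.add_apply]
  nlinarith [mul_nonneg hp (sq_nonneg (f y - g y))]
lemma cmul (c : ℝ) (hf : M k f) : M k (fun y => c * f y) :=
  hf.of_le (continuous_const.mul hf.1) (c^2) fun y => by apply le_of_eq; ring
end M
namespace M
variable {k l : ℤ} {f g c : E2 → ℝ}
lemma sub (hf : M k f) (hg : M k g) : M k (fun y => f y - g y) := by
  have := hf.add (hg.cmul (-1)); simpa [sub_eq_add_neg] using this
lemma neg (hf : M k f) : M k (fun y => - f y) := by
  have := (hf.cmul (-1)); simpa using this
lemma congr (hf : M k f) (h : ∀ y, f y = g y) : M k g := by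
  have : f = g := funext h
  rwa [← this]
lemma coef {n : ℤ} (hc : Cf n c) (hf : M k f) : M (k - n) (fun y => c y * f y) := by
  obtain ⟨h1, C, h2⟩ := hc
  refine hf.of_le (h1.mul hf.1) C fun y => ?_
  have hp : 0 ≤ rho y ^ (k-n) := zpow_nonneg (rho_pos y).le _
  have e : rho y ^ k = rho y ^ (k-n) * rho y ^ n := by rw [← zpow_add₀ (rho_pos y).ne']; congr 1; ring
  calc rho y ^ (k-n) * (c y * f y)^2 = rho y ^ (k-n) * f y ^2 * (c y ^2) := by ring
    _ ≤ rho y ^ (k-n) * f y ^2 * (C * rho y ^ n) := mul_le_mul_of_nonneg_left (h2 y) (mul_nonneg hp (sq_nonneg _))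
    _ = _ := by rw [e]; ring
lemma int (hf : M k f) (hg : M l g) (h : 0 ≤ k + l) : Integrable (fun y => f y * g y) := by
  refine integrable_of_le (hf.1.mul hg.1) (hf.2.add hg.2) fun y => ?_
  simp only [Pi.add_apply]
  have hp : 0 ≤ rho y ^ k := zpow_nonneg (rho_pos y).le _
  have hq : 0 ≤ rho y ^ l := zpow_nonneg (rho_pos y).le _
  have hpq : 1 ≤ rho y ^ k * rho y ^ l := by
    rw [← zpow_add₀ (rho_pos y).ne']; exact one_le_zpow₀ (rho_one y) h
  have hs : 0 ≤ rho y ^ k * f y ^ 2 + rho y ^ l * g y ^ 2 := by positivity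
  refine abs_le_of_sq_le_sq ?_ hs
  nlinarith [mul_nonneg (sub_nonneg.2 hpq) (mul_nonneg (sq_nonneg (f y)) (sq_nonneg (g y))), sq_nonneg (rho y ^ k * f y ^ 2 - rho y ^ l * g y ^ 2), mul_nonneg (mul_nonneg hp (sq_nonneg (f y))) (mul_nonneg hq (sq_nonneg (g y)))]
lemma int_sq (hf : M k f) (h : 0 ≤ k) : Integrable (fun y => f y ^ 2) := by
  have := hf.int hf (by omega); simpa [sq] using this
end M

namespace Cf
variable {n m : ℤ} {c d : E2 → ℝ}
lemma mono (h : Cf n c) (hn : n ≤ m) : Cf m c := by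
  obtain ⟨h1, C, h2⟩ := h
  refine ⟨h1, |C|, fun y => (h2 y).trans ?_⟩
  exact mul_le_mul (le_abs_self C) (zpow_le_zpow_right₀ (rho_one y) hn) (zpow_nonneg (rho_pos y).le _) (abs_nonneg _)
lemma mul (h : Cf n c) (h' : Cf m d) : Cf (n+m) (fun y => c y * d y) := by
  obtain ⟨h1, C, h2⟩ := h
  obtain ⟨h1', C', h2'⟩ := h'
  refine ⟨h1.mul h1', C * C', fun y => ?_⟩
  rw [mul_pow, zpow_add₀ (rho_pos y).ne']
  calc _ ≤ (C * rho y ^ n) * (C' * rho y ^ m) := mul_le_mul (h2 y) (h2' y) (sq_nonneg _) ((sq_nonneg _).trans (h2 y))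
    _ = _ := by ring
lemma add (h : Cf n c) (h' : Cf n d) : Cf n (fun y => c y + d y) := by
  obtain ⟨h1, C, h2⟩ := h
  obtain ⟨h1', C', h2'⟩ := h'
  refine ⟨h1.add h1', 2 * (C + C'), fun y => ?_⟩
  nlinarith [h2 y, h2' y, sq_nonneg (c y - d y)]
lemma const (a : ℝ) : Cf 0 (fun _ => a) := ⟨continuous_const, a^2, fun y => by simp⟩
lemma coord (i : Fin 2) : Cf 1 (fun y => y i) := ⟨cont_coord i, 1, fun y => by
  simp only [zpow_one, one_mul]; unfold rho; fin_cases i <;> simp <;> nlinarith [sq_nonneg (y 0), sq_nonneg (y 1)]⟩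
lemma rho : Cf 2 rho := ⟨cont_rho, 1, fun y => by simp only [one_mul]; norm_cast⟩
lemma kap : Cf (-2) kap := ⟨cont_kap, 1, fun y => by unfold _root_.kap; simp only [one_mul, inv_pow, zpow_neg]; norm_cast⟩
lemma cmul (a : ℝ) (h : Cf n c) : Cf n (fun y => a * c y) := by
  have := (const a).mul h; simpa using this
lemma congr (hf : Cf n c) (h : ∀ y, c y = d y) : Cf n d := by
  have : c = d := funext h
  rwa [← this]
end Cf

/-- differentiable coefficient -/
structure Cd (n : ℤ) (c c1 c2 : E2 → ℝ) : Prop where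
  d1 : HD 0 c c1
  d2 : HD 1 c c2
  m : Cf n c
  m1 : Cf n c1
  m2 : Cf n c2
structure DD (k : ℤ) (f f1 f2 : E2 → ℝ) : Prop where
  d1 : HD 0 f f1
  d2 : HD 1 f f2
  m : M k f
  m1 : M k f1
  m2 : M k f2

namespace Cd
variable {n m : ℤ} {c c1 c2 d d1 d2 : E2 → ℝ}
lemma mul (h : Cd n c c1 c2) (h' : Cd m d d1 d2) : Cd (n+m) (fun y => c y * d y)
    (fun y => c1 y * d y + c y * d1 y) (fun y => c2 y * d y + c y * d2 y) :=
  ⟨h.d1.mul h'.d1, h.d2.mul h'.d2, h.m.mul h'.m, (h.m1.mul h'.m).add (h.m.mul h'.m1), (h.m2.mul h'.m).add (h.m.mul h'.m2)⟩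
lemma add (h : Cd n c c1 c2) (h' : Cd n d d1 d2) : Cd n (fun y => c y + d y)
    (fun y => c1 y + d1 y) (fun y => c2 y + d2 y) :=
  ⟨h.d1.add h'.d1, h.d2.add h'.d2, h.m.add h'.m, (h.m1.add h'.m1), (h.m2.add h'.m2)⟩
lemma mono (h : Cd n c c1 c2) (hn : n ≤ m) : Cd m c c1 c2 :=
  ⟨h.d1, h.d2, h.m.mono hn, h.m1.mono hn, h.m2.mono hn⟩
lemma const (a : ℝ) : Cd 0 (fun _ => a) (fun _ => 0) (fun _ => 0) :=
  ⟨HD.const a, HD.const a, Cf.const _, Cf.const _, Cf.const _⟩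
lemma y0 : Cd 1 (fun y => y 0) (fun _ => 1) (fun _ => 0) :=
  ⟨(HD.coord 0).congr' fun y => ee_00, (HD.coord 0).congr' fun y => ee_10, Cf.coord 0, (Cf.const _).mono (by norm_num), (Cf.const _).mono (by norm_num)⟩
lemma y1 : Cd 1 (fun y => y 1) (fun _ => 0) (fun _ => 1) :=
  ⟨(HD.coord 1).congr' fun y => ee_01, (HD.coord 1).congr' fun y => ee_11, Cf.coord 1, (Cf.const _).mono (by norm_num), (Cf.const _).mono (by norm_num)⟩
lemma cmul (a : ℝ) (h : Cd n c c1 c2) : Cd n (fun y => a * c y) (fun y => a * c1 y) (fun y => a * c2 y) :=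
  ⟨h.d1.cmul a, h.d2.cmul a, h.m.cmul a, h.m1.cmul a, h.m2.cmul a⟩
lemma kap : Cd (-2) kap (fun y => -2 * y 0 * kap y ^ 2) (fun y => -2 * y 1 * kap y ^ 2) :=
  ⟨HD_kap 0, HD_kap 1, Cf.kap,
   (((((Cf.coord 0).cmul (-2)).mul (Cf.kap.mul Cf.kap))).mono (by norm_num)).congr fun y => by ring,
   (((((Cf.coord 1).cmul (-2)).mul (Cf.kap.mul Cf.kap))).mono (by norm_num)).congr fun y => by ring⟩
lemma rho : Cd 2 rho (fun y => 2 * y 0) (fun y => 2 * y 1) :=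
  ⟨HD_rho 0, HD_rho 1, Cf.rho, ((Cf.coord 0).cmul 2).mono (by norm_num), ((Cf.coord 1).cmul 2).mono (by norm_num)⟩
lemma congr' (h : Cd n c c1 c2) (h1 : ∀ y, c1 y = d1 y) (h2 : ∀ y, c2 y = d2 y) : Cd n c d1 d2 := by
  have e1 : c1 = d1 := funext h1
  have e2 : c2 = d2 := funext h2
  rwa [← e1, ← e2]
lemma congr (h : Cd n c c1 c2) (h0 : ∀ y, c y = d y) (h1 : ∀ y, c1 y = d1 y) (h2 : ∀ y, c2 y = d2 y) : Cd n d d1 d2 := by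
  have e0 : c = d := funext h0
  rw [← e0]; exact h.congr' h1 h2
end Cd

namespace DD
variable {n k l : ℤ} {c c1 c2 f f1 f2 g g1 g2 : E2 → ℝ}
lemma add (h : DD k f f1 f2) (h' : DD k g g1 g2) : DD k (fun y => f y + g y)
    (fun y => f1 y + g1 y) (fun y => f2 y + g2 y) :=
  ⟨h.d1.add h'.d1, h.d2.add h'.d2, h.m.add h'.m, (h.m1.add h'.m1), (h.m2.add h'.m2)⟩
lemma sub (h : DD k f f1 f2) (h' : DD k g g1 g2) : DD k (fun y => f y - g y)
    (fun y => f1 y - g1 y) (fun y => f2 y - g2 y) :=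
  ⟨h.d1.sub h'.d1, h.d2.sub h'.d2, h.m.sub h'.m, (h.m1.sub h'.m1), (h.m2.sub h'.m2)⟩
lemma coef (h : Cd n c c1 c2) (h' : DD k g g1 g2) : DD (k - n) (fun y => c y * g y)
    (fun y => c1 y * g y + c y * g1 y) (fun y => c2 y * g y + c y * g2 y) :=
  ⟨h.d1.mul h'.d1, h.d2.mul h'.d2, h'.m.coef h.m, (h'.m.coef h.m1).add (h'.m1.coef h.m), (h'.m.coef h.m2).add (h'.m2.coef h.m)⟩
lemma cmul (a : ℝ) (h : DD k f f1 f2) : DD k (fun y => a * f y) (fun y => a * f1 y) (fun y => a * f2 y) :=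
  ⟨h.d1.cmul a, h.d2.cmul a, h.m.cmul a, h.m1.cmul a, h.m2.cmul a⟩
lemma mono (h : DD k f f1 f2) (hn : l ≤ k) : DD l f f1 f2 :=
  ⟨h.d1, h.d2, h.m.mono hn, h.m1.mono hn, h.m2.mono hn⟩
lemma congr (h : DD k f f1 f2) (h0 : ∀ y, f y = g y) (h1 : ∀ y, f1 y = g1 y) (h2 : ∀ y, f2 y = g2 y) : DD k g g1 g2 := by
  have e0 : f = g := funext h0
  have e1 : f1 = g1 := funext h1
  have e2 : f2 = g2 := funext h2
  rwa [← e0, ← e1, ← e2]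
lemma Z1 (h : DD k f f1 f2) (h' : DD l g g1 g2) (hk : 0 ≤ k + l) : ZI (fun y => f1 y * g y + f y * g1 y) :=
  ibp (h.d1.mul h'.d1) (h.m.int h'.m hk) ((h.m1.int h'.m hk).add (h.m.int h'.m1 hk))
lemma Z2 (h : DD k f f1 f2) (h' : DD l g g1 g2) (hk : 0 ≤ k + l) : ZI (fun y => f2 y * g y + f y * g2 y) :=
  ibp (h.d2.mul h'.d2) (h.m.int h'.m hk) ((h.m2.int h'.m hk).add (h.m.int h'.m2 hk))
end DD

def mk2 (p : ℝ × ℝ) : E2 := p.1 • ee 0 + p.2 • ee 1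
lemma mk2_0 (p : ℝ × ℝ) : mk2 p 0 = p.1 := by simp [mk2, ee]
lemma mk2_1 (p : ℝ × ℝ) : mk2 p 1 = p.2 := by simp [mk2, ee]
lemma mk2_eta (y : E2) : mk2 (y 0, y 1) = y := by
  ext i; fin_cases i
  · exact mk2_0 _
  · exact mk2_1 _
@[fun_prop] lemma cont_mk2 : Continuous mk2 := by unfold mk2; fun_prop
lemma mk2_mp : MeasurePreserving mk2 := by
  have h := (PiLp.volume_preserving_toLp (Fin 2)).comp (volume_preserving_finTwoArrow ℝ).symm
  convert! h using 1
  funext p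
  ext i; fin_cases i
  · exact mk2_0 _
  · exact mk2_1 _
lemma mk2_emb : MeasurableEmbedding mk2 := by
  have h := (MeasurableEquiv.toLp 2 (Fin 2 → ℝ)).measurableEmbedding.comp (MeasurableEquiv.finTwoArrow (α := ℝ)).symm.measurableEmbedding
  convert! h using 1
  funext p
  ext i; fin_cases i
  · exact mk2_0 _
  · exact mk2_1 _

lemma HD.hasDerivAt_fst {f f' : E2 → ℝ} (h : HD 0 f f') (s t : ℝ) :
    HasDerivAt (fun u => f (mk2 (u, t))) (f' (mk2 (s, t))) s := by
  have := h.hasDerivAt (t • ee 1) s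
  simpa [mk2, add_comm] using this
lemma HD.hasDerivAt_snd {f f' : E2 → ℝ} (h : HD 1 f f') (s t : ℝ) :
    HasDerivAt (fun u => f (mk2 (s, u))) (f' (mk2 (s, t))) t := by
  have := h.hasDerivAt (s • ee 0) t
  simpa [mk2] using this

lemma HD_diff {f f1 f2 : E2 → ℝ} (h1 : HD 0 f f1) (h2 : HD 1 f f2) (c1 : Continuous f1) (c2 : Continuous f2) :
    Differentiable ℝ f := by
  intro y
  have key := hasStrictFDerivAt_uncurry_coprod (𝕜 := ℝ) (u := (y 0, y 1)) (f := fun s t => f (mk2 (s,t)))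
    (f₁ := fun s t => ContinuousLinearMap.toSpanSingleton ℝ (f1 (mk2 (s,t))))
    (f₂ := fun s t => ContinuousLinearMap.toSpanSingleton ℝ (f2 (mk2 (s,t))))
    (Filter.Eventually.of_forall fun v => (h1.hasDerivAt_fst v.1 v.2).hasFDerivAt)
    (Filter.Eventually.of_forall fun v => (h2.hasDerivAt_snd v.1 v.2).hasFDerivAt)
    (by
      apply Continuous.continuousAt
      have : Continuous fun v : ℝ × ℝ => ContinuousLinearMap.toSpanSingleton ℝ (f1 (mk2 v)) :=
        (ContinuousLinearMap.toSpanSingletonCLE (𝕜 := ℝ) (E := ℝ)).continuous.comp (c1.comp cont_mk2)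
      exact this)
    (by
      apply Continuous.continuousAt
      have : Continuous fun v : ℝ × ℝ => ContinuousLinearMap.toSpanSingleton ℝ (f2 (mk2 v)) :=
        (ContinuousLinearMap.toSpanSingletonCLE (𝕜 := ℝ) (E := ℝ)).continuous.comp (c2.comp cont_mk2)
      exact this)
  have d := key.hasFDerivAt.differentiableAt
  have e : Differentiable ℝ (fun y : E2 => ((y 0, y 1) : ℝ × ℝ)) := by fun_prop
  have := DifferentiableAt.comp (f := fun y : E2 => ((y 0, y 1) : ℝ × ℝ)) y d (e y)
  refine this.congr_of_eventuallyEq (Filter.Eventually.of_forall fun z => ?_)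
  simp [Function.HasUncurry.uncurry, mk2_eta]

lemma pd_eq {i : Fin 2} {f f' : E2 → ℝ} (hd : Differentiable ℝ f) (h : HD i f f') : pd i f = f' :=
  (HD.of_contDiff hd).unique h

lemma grad_coord (f : E2 → ℝ) (y : E2) (i : Fin 2) : gradient f y i = pd i f y := by
  have h : ⟪gradient f y, EuclideanSpace.single i (1:ℝ)⟫ = fderiv ℝ f y (EuclideanSpace.single i 1) := by
    unfold gradient
    exact InnerProductSpace.toDual_symm_apply
  rw [pd, ← h, EuclideanSpace.inner_single_right]; simp

lemma grad_norm (f : E2 → ℝ) (y : E2) : ‖gradient f y‖^2 = (pd 0 f y)^2 + (pd 1 f y)^2 := by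
  rw [EuclideanSpace.norm_sq_eq]; simp [Fin.sum_univ_two, grad_coord]

lemma inner_grad (f : E2 → ℝ) (y : E2) : ⟪y, gradient f y⟫ = y 0 * pd 0 f y + y 1 * pd 1 f y := by
  rw [PiLp.inner_apply]; simp [Fin.sum_univ_two, grad_coord]; ring

lemma M.integrable {k : ℤ} {f : E2 → ℝ} (hf : M k f) (h : 2 ≤ k) : Integrable f := by
  have hi : Integrable (fun y : E2 => (rho y)^(-2:ℤ)) := by
    have h := integrable_rpow_neg_one_add_norm_sq (E := E2) (μ := volume) (r := 4) (by simp; norm_num)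
    refine h.congr (Filter.Eventually.of_forall fun y => ?_)
    simp only [rho_eq]
    rw [← Real.rpow_intCast]; norm_num
  refine integrable_of_le hf.1 ((hf.mono h).2.add hi) fun y => ?_
  simp only [Pi.add_apply]
  have h1 : (rho y)^(2:ℤ) * (rho y)^(-2:ℤ) = 1 := by
    rw [← zpow_add₀ (rho_pos y).ne']; simp
  have hp : 0 < (rho y)^(2:ℤ) := zpow_pos (rho_pos y) _
  have hq : 0 < (rho y)^(-2:ℤ) := zpow_pos (rho_pos y) _
  refine abs_le_of_sq_le_sq ?_ (by positivity)
  nlinarith [sq_nonneg (f y), mul_nonneg hp.le (sq_nonneg (f y)), sq_nonneg ((rho y)^(2:ℤ) * f y^2 - (rho y)^(-2:ℤ)), congrArg (fun z => z * f y^2) h1]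

lemma M_one : M (-2) (fun _ => (1:ℝ)) := by
  refine ⟨continuous_const, ?_⟩
  have h := integrable_rpow_neg_one_add_norm_sq (E := E2) (μ := volume) (r := 4) (by simp; norm_num)
  refine h.congr (Filter.Eventually.of_forall fun y => ?_)
  simp only [rho_eq]
  rw [← Real.rpow_intCast]; norm_num
lemma DD_const (a : ℝ) : DD (-2) (fun _ => a) (fun _ => 0) (fun _ => 0) :=
  ⟨HD.const a, HD.const a, (M_one.cmul a).congr (by simp), (M_one.cmul 0).congr (by simp), (M_one.cmul 0).congr (by simp)⟩

lemma cs_ineq {α : Type*} [MeasurableSpace α] {μ : Measure α} {m A B : α → ℝ} (hm : Integrable m μ) (hA : Integrable A μ)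
    (hB : Integrable B μ) (h0 : ∀ᵐ y ∂μ, 0 ≤ A y) (h1 : ∀ᵐ y ∂μ, 0 ≤ B y) (h : ∀ᵐ y ∂μ, m y ^ 2 ≤ A y * B y) :
    (∫ y, m y ∂μ) ^ 2 ≤ (∫ y, A y ∂μ) * ∫ y, B y ∂μ := by
  have key : ∀ t : ℝ, 0 ≤ (∫ y, A y ∂μ) * (t * t) + (2 * ∫ y, m y ∂μ) * t + ∫ y, B y ∂μ := by
    intro t
    have e : (∫ y, A y ∂μ) * (t * t) + (2 * ∫ y, m y ∂μ) * t + ∫ y, B y ∂μ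
        = ∫ y, ((t * t) * A y + (2 * t) * m y + B y) ∂μ := by
      rw [integral_add (show Integrable (fun y => t * t * A y + 2 * t * m y) μ from (hA.const_mul _).add (hm.const_mul _)) hB, integral_add (hA.const_mul _) (hm.const_mul _), integral_const_mul, integral_const_mul]
      ring
    rw [e]
    apply integral_nonneg_of_ae
    filter_upwards [h0, h1, h] with y a b c
    simp only [Pi.zero_apply]
    rcases a.eq_or_lt with ha | ha
    · rw [← ha] at c ⊢
      have : m y = 0 := by nlinarith [sq_nonneg (m y)]
      rw [this]; linarith
    · have : 0 ≤ A y * (t * t * A y + 2 * t * m y + B y) := by nlinarith [sq_nonneg (A y * t + m y)]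
      exact nonneg_of_mul_nonneg_right this ha
  have := discrim_le_zero key
  unfold discrim at this
  nlinarith

def g0 (u : E2) : ℝ := ‖u‖⁻¹ * (1 + ‖u‖^2)⁻¹
lemma g0_nonneg (u : E2) : 0 ≤ g0 u := by unfold g0; positivity
lemma g0_int : Integrable g0 := by
  unfold g0
  refine (integrable_fun_norm_addHaar (E := E2) volume (f := fun r => r⁻¹ * (1 + r^2)⁻¹)).2 ?_
  have h := (integrable_inv_one_add_sq).integrableOn (s := Set.Ioi (0:ℝ))
  refine h.congr_fun (fun y hy => ?_) measurableSet_Ioi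
  have : (0:ℝ) < y := hy
  simp
  field_simp

/-- kernels -/
def Ker (k : E2 → ℝ) : Prop := ContinuousOn k {0}ᶜ ∧ ∀ u, |k u| ≤ ‖u‖⁻¹
def cv (k h : E2 → ℝ) (x : E2) : ℝ := ∫ y, k (x - y) * h y
def CI (h : E2 → ℝ) : Prop := Continuous h ∧ Integrable h

lemma CI.abs {h : E2 → ℝ} (hh : CI h) : CI (fun y => |h y|) := ⟨hh.1.abs, hh.2.abs⟩
lemma Ker.abs {k : E2 → ℝ} (hk : Ker k) : Ker (fun y => |k y|) :=
  ⟨hk.1.abs, fun u => by rw [abs_abs]; exact hk.2 u⟩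
lemma Ker.inv : Ker (fun u => ‖u‖⁻¹) := by
  refine ⟨continuous_norm.continuousOn.inv₀ (fun u hu => by simpa using hu), fun u => ?_⟩
  rw [abs_of_nonneg (by positivity)]
lemma Ker.meas {k : E2 → ℝ} (hk : Ker k) : Measurable k :=
  measurable_of_continuousOn_compl_singleton 0 hk.1

lemma near_bd (u : E2) : ‖u‖⁻¹ * (1 - min 1 (‖u‖^2)) ≤ 2 * g0 u := by
  unfold g0
  rw [mul_left_comm]
  apply mul_le_mul_of_nonneg_left _ (by positivity)
  have hp : 0 < 1 + ‖u‖^2 := by positivity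
  rw [← div_eq_mul_inv, le_div_iff₀ hp]
  rcases le_total 1 (‖u‖^2) with h | h
  · rw [min_eq_left h]; norm_num
  · rw [min_eq_right h]; nlinarith [sq_nonneg (‖u‖^2)]

lemma near_nonneg (u : E2) : 0 ≤ 1 - min 1 (‖u‖^2) := by
  have := min_le_left 1 (‖u‖^2); linarith

lemma near_zero {u : E2} (h : 1 ≤ ‖u‖) : 1 - min 1 (‖u‖^2) = 0 := by
  rw [min_eq_left (by nlinarith), sub_self]

lemma far_bd {k : E2 → ℝ} (hk : Ker k) (u : E2) : |k u * min 1 (‖u‖^2)| ≤ 1 := by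
  rw [abs_mul, abs_of_nonneg (le_min zero_le_one (sq_nonneg _) : 0 ≤ min 1 (‖u‖^2))]
  have h1 := hk.2 u
  by_cases hu : ‖u‖ = 0
  · rw [hu] at h1 ⊢; simp at h1 ⊢
  have hp : 0 < ‖u‖ := lt_of_le_of_ne (norm_nonneg _) (Ne.symm hu)
  have : min 1 (‖u‖^2) ≤ ‖u‖ := by
    rcases le_total 1 (‖u‖) with h | h
    · exact (min_le_left _ _).trans h
    · exact (min_le_right _ _).trans (by nlinarith)
  calc _ ≤ ‖u‖⁻¹ * ‖u‖ := mul_le_mul h1 this (le_min zero_le_one (sq_nonneg _)) (by positivity)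
    _ = 1 := inv_mul_cancel₀ hu

lemma far_cont {k : E2 → ℝ} (hk : Ker k) : Continuous (fun u => k u * min 1 (‖u‖^2)) := by
  rw [continuous_iff_continuousAt]
  intro u
  by_cases hu : u = 0
  · subst hu
    have : k 0 * min 1 (‖(0:E2)‖^2) = 0 := by simp
    unfold ContinuousAt
    beta_reduce
    rw [this]
    refine squeeze_zero_norm (a := fun u => ‖u‖) (fun u => ?_) (by simpa using (continuous_norm (E := E2)).tendsto 0)
    rw [Real.norm_eq_abs, abs_mul, abs_of_nonneg (le_min zero_le_one (sq_nonneg _) : 0 ≤ min 1 (‖u‖^2))]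
    by_cases h0 : ‖u‖ = 0
    · simp [h0]
    calc _ ≤ ‖u‖⁻¹ * ‖u‖^2 := mul_le_mul (hk.2 u) (min_le_right _ _) (le_min zero_le_one (sq_nonneg _)) (by positivity)
      _ = ‖u‖ := by field_simp
  · exact ((hk.1 u hu).continuousAt (isOpen_compl_singleton.mem_nhds hu)).mul (by fun_prop)

lemma bdd_ball {h : E2 → ℝ} (hh : Continuous h) (x : E2) (r : ℝ) : ∃ C, 0 ≤ C ∧ ∀ y, ‖y - x‖ ≤ r → |h y| ≤ C := by
  obtain ⟨C, hC⟩ := (isCompact_closedBall x r).exists_bound_of_continuousOn hh.continuousOn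
  refine ⟨max C 0, le_max_right _ _, fun y hy => le_trans (hC y ?_) (le_max_left _ _)⟩
  rw [mem_closedBall_iff_norm]; exact hy

lemma cv_split {k : E2 → ℝ} (u : E2) : k u = k u * (1 - min 1 (‖u‖^2)) + k u * min 1 (‖u‖^2) := by ring

lemma near_int {k h : E2 → ℝ} (hk : Ker k) (hh : CI h) (x : E2) :
    Integrable (fun u => k u * (1 - min 1 (‖u‖^2)) * h (x - u)) := by
  obtain ⟨C, hC0, hC⟩ := bdd_ball hh.1 x 1
  refine (g0_int.const_mul (2 * C)).mono' ?_ (Filter.Eventually.of_forall fun u => ?_)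
  · have := hh.1.measurable
    have := hk.meas
    apply Measurable.aestronglyMeasurable
    fun_prop
  · rw [Real.norm_eq_abs, abs_mul, abs_mul, abs_of_nonneg (near_nonneg u)]
    rcases le_total 1 ‖u‖ with h1 | h1
    · rw [near_zero h1]; have := g0_nonneg u; simp; positivity
    · have e1 := hC (x - u) (by simpa using h1)
      have e2 : |k u| * (1 - min 1 (‖u‖^2)) ≤ 2 * g0 u :=
        (mul_le_mul_of_nonneg_right (hk.2 u) (near_nonneg u)).trans (near_bd u)
      calc _ ≤ (2 * g0 u) * C := mul_le_mul e2 e1 (abs_nonneg _) (by have := g0_nonneg u; positivity)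
        _ = _ := by ring

lemma far_int {k h : E2 → ℝ} (hk : Ker k) (hh : CI h) (x : E2) :
    Integrable (fun y => k (x - y) * min 1 (‖x - y‖^2) * h y) := by
  refine hh.2.abs.mono' ?_ (Filter.Eventually.of_forall fun y => ?_)
  · exact (((far_cont hk).comp (continuous_const.sub continuous_id)).mul hh.1).aestronglyMeasurable
  · rw [Real.norm_eq_abs, abs_mul]
    have := far_bd hk (x - y)
    calc _ ≤ 1 * |h y| := mul_le_mul_of_nonneg_right this (abs_nonneg _)
      _ = _ := one_mul _

lemma near_int' {k h : E2 → ℝ} (hk : Ker k) (hh : CI h) (x : E2) :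
    Integrable (fun y => k (x - y) * (1 - min 1 (‖x - y‖^2)) * h y) := by
  have := (near_int hk hh x).comp_sub_left x
  simpa using this

lemma cv_int {k h : E2 → ℝ} (hk : Ker k) (hh : CI h) (x : E2) : Integrable (fun y => k (x - y) * h y) := by
  refine ((near_int' hk hh x).add (far_int hk hh x)).congr (Filter.Eventually.of_forall fun y => ?_)
  simp only [Pi.add_apply]; ring

lemma cv_int' {k h : E2 → ℝ} (hk : Ker k) (hh : CI h) (x : E2) : Integrable (fun u => k u * h (x - u)) := by
  have := (cv_int hk hh x).comp_sub_left x
  simpa using this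

lemma cv_eq (k h : E2 → ℝ) (x : E2) : cv k h x = ∫ u, k u * h (x - u) := by
  have := integral_sub_left_eq_self (fun y => k (x - y) * h y) volume x
  unfold cv; rw [← this]; simp

lemma cv_cont {k h : E2 → ℝ} (hk : Ker k) (hh : CI h) : Continuous (cv k h) := by
  have e : cv k h = fun x => (∫ u, k u * (1 - min 1 (‖u‖^2)) * h (x - u)) + ∫ y, k (x - y) * min 1 (‖x - y‖^2) * h y := by
    funext x
    have := integral_sub_left_eq_self (fun y => k (x - y) * (1 - min 1 (‖x - y‖^2)) * h y) volume x
    simp only [sub_sub_cancel] at this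
    rw [this, ← integral_add (near_int' hk hh x) (far_int hk hh x)]
    unfold cv
    congr 1; funext y; ring
  rw [e]
  apply Continuous.add
  · rw [continuous_iff_continuousAt]
    intro x0
    obtain ⟨C, hC0, hC⟩ := bdd_ball hh.1 x0 2
    refine continuousAt_of_dominated (bound := fun u => 2 * C * g0 u) (Filter.Eventually.of_forall fun x => (near_int hk hh x).1) ?_ (g0_int.const_mul _) (Filter.Eventually.of_forall fun u => ?_)
    · filter_upwards [Metric.ball_mem_nhds x0 one_pos] with x hx
      refine Filter.Eventually.of_forall fun u => ?_
      rw [Real.norm_eq_abs, abs_mul, abs_mul, abs_of_nonneg (near_nonneg u)]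
      rcases le_total 1 ‖u‖ with h1 | h1
      · rw [near_zero h1]; have := g0_nonneg u; simp; positivity
      · have e1 := hC (x - u) (by
          have : ‖x - x0‖ < 1 := by simpa [dist_eq_norm] using hx
          calc ‖x - u - x0‖ = ‖(x - x0) - u‖ := by congr 1; abel
            _ ≤ ‖x - x0‖ + ‖u‖ := norm_sub_le _ _
            _ ≤ 2 := by linarith)
        have e2 : |k u| * (1 - min 1 (‖u‖^2)) ≤ 2 * g0 u :=
          (mul_le_mul_of_nonneg_right (hk.2 u) (near_nonneg u)).trans (near_bd u)
        calc _ ≤ (2 * g0 u) * C := mul_le_mul e2 e1 (abs_nonneg _) (by have := g0_nonneg u; positivity)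
          _ = _ := by ring
    · exact (continuous_const.mul (hh.1.comp (continuous_id.sub continuous_const))).continuousAt
  · refine continuous_of_dominated (bound := fun y => |h y|) (fun x => (far_int hk hh x).1) (fun x => Filter.Eventually.of_forall fun y => ?_) hh.2.abs (Filter.Eventually.of_forall fun y => ?_)
    · rw [Real.norm_eq_abs, abs_mul]
      have := far_bd hk (x - y)
      calc _ ≤ 1 * |h y| := mul_le_mul_of_nonneg_right this (abs_nonneg _)
        _ = _ := one_mul _
    · exact ((far_cont hk).comp (continuous_id.sub continuous_const)).mul continuous_const

lemma HD_of_int {j : Fin 2} {Φ Γ : E2 → ℝ} (hc : Continuous Γ)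
    (h : ∀ x t, Φ (x + t • ee j) - Φ x = ∫ s in (0:ℝ)..t, Γ (x + s • ee j)) : HD j Φ Γ := by
  intro x
  have hc' : Continuous (fun s : ℝ => Γ (x + s • ee j)) := hc.comp (by fun_prop)
  have := (hc'.integral_hasStrictDerivAt 0 0).hasDerivAt.add_const (Φ x)
  have e : (fun t : ℝ => Φ (x + t • ee j)) = fun t => (∫ s in (0:ℝ)..t, Γ (x + s • ee j)) + Φ x := by
    funext t; rw [← h]; ring
  unfold HasLineDerivAt
  rw [e]
  simpa using this

lemma swap_lemma (F : ℝ → E2 → ℝ) (t : ℝ) (hm : Measurable (Function.uncurry F)) (hi : ∀ s, Integrable (F s))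
    (hc : Continuous fun s => ∫ y, |F s y|) :
    ∫ s in (0:ℝ)..t, (∫ y, F s y) = ∫ y, ∫ s in (0:ℝ)..t, F s y := by
  refine intervalIntegral_integral_swap ?_
  rw [integrable_prod_iff hm.aestronglyMeasurable]
  refine ⟨Filter.Eventually.of_forall fun s => hi s, ?_⟩
  have := (hc.intervalIntegrable (μ := volume) 0 t)
  rw [intervalIntegrable_iff] at this
  exact this

lemma cv_HD {k h h' : E2 → ℝ} {j : Fin 2} (hk : Ker k) (hh : CI h) (hh' : CI h') (hd : HD j h h') :
    HD j (cv k h) (cv k h') := by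
  refine HD_of_int (cv_cont hk hh') fun x t => ?_
  have e1 : ∀ s : ℝ, cv k h' (x + s • ee j) = ∫ u, k u * h' (x + s • ee j - u) := fun s => cv_eq _ _ _
  simp_rw [e1]
  rw [swap_lemma (fun s u => k u * h' (x + s • ee j - u)) t]
  · rw [cv_eq, cv_eq, ← integral_sub (cv_int' hk hh _) (cv_int' hk hh _)]
    congr 1; funext u
    rw [intervalIntegral.integral_const_mul]
    have key := intervalIntegral.integral_eq_sub_of_hasDerivAt (a := 0) (b := t) (fun s _ => hd.hasDerivAt (x - u) s)
      ((hh'.1.comp (by fun_prop)).intervalIntegrable _ _)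
    have e2 : ∀ s : ℝ, x + s • ee j - u = x - u + s • ee j := fun s => by abel
    simp_rw [e2]
    rw [key]
    simp; ring
  · have := hk.meas
    have := hh'.1.measurable
    have e3 : Function.uncurry (fun (s:ℝ) (u:E2) => k u * h' (x + s • ee j - u)) = fun p => k p.2 * h' (x + p.1 • ee j - p.2) := rfl
    rw [e3]; fun_prop
  · intro s; exact cv_int' hk hh' _
  · have : Continuous (fun s : ℝ => cv (fun u => |k u|) (fun u => |h' u|) (x + s • ee j)) :=
      (cv_cont hk.abs hh'.abs).comp (by fun_prop)
    refine this.congr fun s => ?_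
    rw [cv_eq]; simp_rw [abs_mul]

/-- Schur -/
lemma schur_pt (x : E2) : Integrable (fun y => ‖x - y‖⁻¹ * (rho y)⁻¹) ∧
    ∫ y, ‖x - y‖⁻¹ * (rho y)⁻¹ ≤ 2 * ∫ u, g0 u := by
  have h1 : Integrable (fun y => g0 (x - y)) := g0_int.comp_sub_left x
  have hb : ∀ᵐ y : E2, ‖x - y‖⁻¹ * (rho y)⁻¹ ≤ g0 (x - y) + g0 y := by
    have : ∀ᵐ y : E2, y ≠ 0 := by
      simp [ae_iff]
    filter_upwards [this] with y hy
    have hy' : 0 < ‖y‖ := norm_pos_iff.2 hy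
    rw [rho_eq]
    rcases le_total (‖x - y‖) (‖y‖) with h | h
    · have : (1 + ‖y‖^2)⁻¹ ≤ (1 + ‖x - y‖^2)⁻¹ := by gcongr
      calc _ ≤ ‖x - y‖⁻¹ * (1 + ‖x - y‖^2)⁻¹ := by gcongr
        _ ≤ _ := le_add_of_nonneg_right (g0_nonneg y)
    · calc _ ≤ ‖y‖⁻¹ * (1 + ‖y‖^2)⁻¹ := by gcongr
        _ ≤ _ := le_add_of_nonneg_left (g0_nonneg _)
  have hi : Integrable (fun y => ‖x - y‖⁻¹ * (rho y)⁻¹) := by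
    refine (h1.add g0_int).mono' ?_ ?_
    · apply Measurable.aestronglyMeasurable
      have := cont_rho.measurable
      fun_prop
    · filter_upwards [hb] with y hy
      rw [Real.norm_eq_abs, abs_of_nonneg (by have := rho_pos y; positivity)]; exact hy
  refine ⟨hi, ?_⟩
  calc _ ≤ ∫ y, (g0 (x - y) + g0 y) := integral_mono_ae hi (h1.add g0_int) hb
    _ = _ := by rw [integral_add h1 g0_int, integral_sub_left_eq_self g0 volume x]; ring

lemma M.CI {h : E2 → ℝ} (hh : M 2 h) : CI h := ⟨hh.1, hh.integrable le_rfl⟩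

lemma cv_M {k h : E2 → ℝ} (hk : Ker k) (hh : M 2 h) : M (-1) (cv k h) := by
  set H : E2 → ℝ := fun y => rho y * h y ^ 2 with hH
  have hHi : Integrable H := by
    refine (hh.mono (l := 1) (by norm_num)).2.congr (Filter.Eventually.of_forall fun y => by simp [H])
  have hHc : Continuous H := by have := hh.1; fun_prop
  have hH0 : ∀ y, 0 ≤ H y := fun y => mul_nonneg (rho_pos y).le (sq_nonneg _)
  set C0 := 2 * ∫ u, g0 u with hC0
  have hprod : Integrable (fun p : E2 × E2 => (‖p.2 - p.1‖⁻¹ * (rho p.1)⁻¹) * H p.2) (volume.prod volume) := by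
    have hmeas : Measurable (fun p : E2 × E2 => (‖p.2 - p.1‖⁻¹ * (rho p.1)⁻¹) * H p.2) := by
      have := cont_rho.measurable
      have := hHc.measurable
      fun_prop
    rw [integrable_prod_iff' hmeas.aestronglyMeasurable]
    refine ⟨Filter.Eventually.of_forall fun y => (schur_pt y).1.mul_const (H y), ?_⟩
    refine (hHi.const_mul C0).mono' ?_ (Filter.Eventually.of_forall fun y => ?_)
    · exact (hmeas.norm.aestronglyMeasurable (μ := volume.prod volume)).prod_swap.integral_prod_right'
    · rw [Real.norm_eq_abs, abs_of_nonneg (integral_nonneg fun _ => norm_nonneg _)]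
      have e : ∀ x, ‖(‖y - x‖⁻¹ * (rho x)⁻¹) * H y‖ = (‖y - x‖⁻¹ * (rho x)⁻¹) * H y := fun x => by
        rw [Real.norm_eq_abs, abs_of_nonneg (mul_nonneg (by have := rho_pos x; positivity) (hH0 y))]
      simp_rw [e]
      rw [integral_mul_const]
      exact mul_le_mul_of_nonneg_right (schur_pt y).2 (hH0 y)
  have hΦ := hprod.integral_prod_left
  refine ⟨cv_cont hk hh.CI, (hΦ.const_mul C0).mono' ?_ (Filter.Eventually.of_forall fun x => ?_)⟩
  · exact ((cont_rho_zpow _).mul ((cv_cont hk hh.CI).pow 2)).aestronglyMeasurable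
  · have hx : 0 < rho x := rho_pos x
    rw [Real.norm_eq_abs, abs_of_nonneg (mul_nonneg (zpow_nonneg hx.le _) (sq_nonneg _))]
    have i2 := (cv_int Ker.inv ⟨hHc, hHi⟩ x)
    have hcs := cs_ineq (cv_int hk hh.CI x) (schur_pt x).1 i2 (Filter.Eventually.of_forall fun y => by have := rho_pos y; positivity)
      (Filter.Eventually.of_forall fun y => mul_nonneg (by positivity) (hH0 y)) (Filter.Eventually.of_forall fun y => by
        have h3 := hk.2 (x - y)
        have h4 : k (x - y)^2 ≤ (‖x - y‖⁻¹)^2 := by rw [← sq_abs]; gcongr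
        have hy := rho_pos y
        calc (k (x-y) * h y)^2 = k (x-y)^2 * h y^2 := by ring
          _ ≤ (‖x - y‖⁻¹)^2 * h y^2 := by gcongr
          _ = ‖x - y‖⁻¹ * (rho y)⁻¹ * (‖x - y‖⁻¹ * H y) := by simp only [H]; field_simp)
    have e : ∫ y, (‖y - x‖⁻¹ * (rho x)⁻¹) * H y = (rho x)⁻¹ * ∫ y, ‖x - y‖⁻¹ * H y := by
      rw [← integral_const_mul]; congr 1; funext y; rw [norm_sub_rev]; ring
    rw [e, zpow_neg_one]
    have h5 : 0 ≤ ∫ y, ‖x - y‖⁻¹ * H y := integral_nonneg fun y => mul_nonneg (by positivity) (hH0 y)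
    calc (rho x)⁻¹ * cv k h x ^2 ≤ (rho x)⁻¹ * (C0 * ∫ y, ‖x - y‖⁻¹ * H y) := by
          apply mul_le_mul_of_nonneg_left _ (by positivity)
          exact hcs.trans (mul_le_mul_of_nonneg_right (schur_pt x).2 h5)
      _ = _ := by ring

def rs (u : E2) : ℝ := (u 0)^2 + (u 1)^2
lemma rs_eq (u : E2) : rs u = ‖u‖^2 := by
  rw [EuclideanSpace.norm_sq_eq]; simp [rs, Fin.sum_univ_two]
@[fun_prop] lemma cont_rs : Continuous rs := by unfold rs; fun_prop
lemma coord_le (u : E2) (i : Fin 2) : |u i| ≤ ‖u‖ := by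
  have := PiLp.norm_apply_le u i; simpa using this
/-- kernel `u_i/(|u|^2+d)` -/
def KD (d : ℝ) (i : Fin 2) (u : E2) : ℝ := u i / (rs u + d)

lemma KD_bd {d : ℝ} (hd : 0 ≤ d) (i : Fin 2) (u : E2) : |KD d i u| ≤ ‖u‖⁻¹ := by
  unfold KD
  by_cases hu : ‖u‖ = 0
  · have : u = 0 := norm_eq_zero.1 hu
    subst this; simp
  have hp : 0 < ‖u‖ := lt_of_le_of_ne (norm_nonneg _) (Ne.symm hu)
  rw [abs_div, rs_eq, abs_of_nonneg (by positivity : 0 ≤ ‖u‖^2 + d), div_le_iff₀ (by positivity)]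
  have := coord_le u i
  calc |u i| ≤ ‖u‖ := this
    _ = ‖u‖⁻¹ * ‖u‖^2 := by field_simp
    _ ≤ _ := by gcongr; linarith
lemma KD_ker {d : ℝ} (hd : 0 ≤ d) (i : Fin 2) : Ker (KD d i) := by
  refine ⟨?_, KD_bd hd i⟩
  unfold KD
  refine ContinuousOn.div (by fun_prop) (by fun_prop) fun u hu => ?_
  have : 0 < ‖u‖ := norm_pos_iff.2 hu
  rw [rs_eq]; positivity

lemma HD_rs (i : Fin 2) : HD i rs (fun y => 2 * y i) := by
  have := (HD_rho i).sub (HD.const 1)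
  have e : rs = fun y => rho y - 1 := by funext y; unfold rs rho; ring
  rw [e]; exact this.congr' fun y => by ring
lemma HD_KD {d : ℝ} (hd : 0 < d) (i j : Fin 2) :
    HD j (KD d i) (fun u => ee j i / (rs u + d) - 2 * u i * u j / (rs u + d)^2) := by
  have hp : ∀ u : E2, 0 < rs u + d := fun u => by rw [rs_eq]; positivity
  have := (HD.coord (i := j) i).mul (((HD_rs j).add (HD.const d)).inv fun u => (hp u).ne')
  refine HD.congr' (f := KD d i) this fun u => ?_
  have := hp u
  field_simp; ring
lemma KDd_bd {d : ℝ} (hd : 0 < d) (i j : Fin 2) (u : E2) :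
    |ee j i / (rs u + d) - 2 * u i * u j / (rs u + d)^2| ≤ 3 / d := by
  have hp : 0 ≤ rs u := by rw [rs_eq]; positivity
  have hq : 0 < rs u + d := by linarith
  have h1 : |ee j i| ≤ 1 := by fin_cases i <;> fin_cases j <;> simp [ee]
  have h2 : |2 * u i * u j| ≤ 2 * (rs u + d) := by
    rw [abs_mul, abs_mul, abs_two]
    have := coord_le u i
    have := coord_le u j
    rw [rs_eq]
    have : |u i| * |u j| ≤ ‖u‖ * ‖u‖ := mul_le_mul (coord_le u i) (coord_le u j) (abs_nonneg _) (norm_nonneg _)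
    nlinarith
  have h3 : |ee j i / (rs u + d)| ≤ 1 / d := by
    rw [abs_div, abs_of_pos hq]; gcongr; linarith
  have h4 : |2 * u i * u j / (rs u + d)^2| ≤ 2 / d := by
    rw [abs_div, abs_of_pos (pow_pos hq 2), div_le_div_iff₀ (by positivity) hd]
    calc _ ≤ (2 * (rs u + d)) * (rs u + d) := mul_le_mul h2 (by linarith) hd.le (by positivity)
      _ = _ := by ring
  calc _ ≤ _ := abs_sub _ _
    _ ≤ 1/d + 2/d := add_le_add h3 h4
    _ = _ := by ring

lemma HD.refl {j : Fin 2} {f f' : E2 → ℝ} (h : HD j f f') (x : E2) : HD j (fun y => f (x - y)) (fun y => - f' (x - y)) := by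
  intro y
  have h1 := h.hasDerivAt (x - y) 0
  have h2 : HasDerivAt (fun s : ℝ => -s) (-1) 0 := (hasDerivAt_id (0:ℝ)).neg
  have h3 : HasDerivAt (fun s : ℝ => f (x - y + s • ee j)) (f' (x - y)) ((fun s : ℝ => -s) 0) := by simpa using h1
  have h4 := HasDerivAt.comp (h := fun s : ℝ => -s) 0 h3 h2
  unfold HasLineDerivAt
  rw [mul_neg_one] at h4
  refine h4.congr_of_eventuallyEq (Filter.Eventually.of_forall fun s => ?_)
  simp only [Function.comp]; congr 1
  rw [neg_smul]; abel

lemma cv_KD_ibp {d : ℝ} (hd : 0 < d) (i j : Fin 2) {h h' : E2 → ℝ} (hh : CI h) (hh' : CI h') (hD : HD j h h') (x : E2) :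
    Integrable (fun y => (ee j i / (rs (x-y) + d) - 2 * (x-y) i * (x-y) j / (rs (x-y) + d)^2) * h y) ∧
    cv (KD d i) h' x = ∫ y, (ee j i / (rs (x-y) + d) - 2 * (x-y) i * (x-y) j / (rs (x-y) + d)^2) * h y := by
  have i1 : Integrable (fun y => (ee j i / (rs (x-y) + d) - 2 * (x-y) i * (x-y) j / (rs (x-y) + d)^2) * h y) := by
    refine (hh.2.abs.const_mul (3/d)).mono' ?_ (Filter.Eventually.of_forall fun y => ?_)
    · apply Measurable.aestronglyMeasurable
      have := hh.1.measurable
      have := cont_rs.measurable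
      fun_prop
    · rw [Real.norm_eq_abs, abs_mul]
      exact mul_le_mul_of_nonneg_right (KDd_bd hd i j _) (abs_nonneg _)
  refine ⟨i1, ?_⟩
  have i2 := cv_int (KD_ker hd.le i) hh' x
  have i3 := cv_int (KD_ker hd.le i) hh x
  have z := ibp (((HD_KD hd i j).refl x).mul hD) i3 (by
    refine (i2.sub i1).congr (Filter.Eventually.of_forall fun y => ?_)
    simp only [Pi.sub_apply]; ring)
  have e := z.2
  have e2 : ∫ y, (-(ee j i / (rs (x-y) + d) - 2 * (x-y) i * (x-y) j / (rs (x-y) + d)^2) * h y + KD d i (x - y) * h' y)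
    = (∫ y, KD d i (x - y) * h' y) - ∫ y, (ee j i / (rs (x-y) + d) - 2 * (x-y) i * (x-y) j / (rs (x-y) + d)^2) * h y := by
    rw [← integral_sub i2 i1]; congr 1; funext y; ring
  rw [e2] at e
  unfold cv; linarith

lemma cv_KD_tendsto (i : Fin 2) {h : E2 → ℝ} (hh : CI h) (x : E2) :
    Filter.Tendsto (fun c : ℝ => cv (KD ((c^2)⁻¹) i) h x) Filter.atTop (nhds (cv (KD 0 i) h x)) := by
  unfold cv
  refine tendsto_integral_filter_of_dominated_convergence (fun y => ‖x - y‖⁻¹ * |h y|) ?_ ?_ (cv_int Ker.inv hh.abs x) ?_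
  · exact Filter.Eventually.of_forall fun c => (cv_int (KD_ker (by positivity) i) hh x).1
  · refine Filter.Eventually.of_forall fun c => Filter.Eventually.of_forall fun y => ?_
    rw [Real.norm_eq_abs, abs_mul]
    exact mul_le_mul_of_nonneg_right (KD_bd (by positivity) i _) (abs_nonneg _)
  · refine Filter.Eventually.of_forall fun y => ?_
    refine Filter.Tendsto.mul_const _ ?_
    have hc : Filter.Tendsto (fun c : ℝ => (c^2)⁻¹) Filter.atTop (nhds 0) :=
      (Filter.tendsto_pow_atTop (by norm_num)).inv_tendsto_atTop
    unfold KD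
    by_cases hu : rs (x - y) = 0
    · have : x - y = 0 := by rw [rs_eq] at hu; exact norm_eq_zero.1 (pow_eq_zero_iff (by norm_num) |>.1 hu)
      rw [this]; simp
    · refine Filter.Tendsto.div tendsto_const_nhds (tendsto_const_nhds.add hc) (by simpa using hu)

lemma cv_curl {h h0 h1 : E2 → ℝ} (hh : CI h) (hh0 : CI h0) (hh1 : CI h1) (d0 : HD 0 h h0) (d1 : HD 1 h h1) :
    cv (KD 0 0) h1 = cv (KD 0 1) h0 := by
  funext x
  refine tendsto_nhds_unique (cv_KD_tendsto 0 hh1 x) ((cv_KD_tendsto 1 hh0 x).congr' ?_)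
  filter_upwards [Filter.eventually_gt_atTop 0] with c hc
  rw [(cv_KD_ibp (by positivity) 1 0 hh hh0 d0 x).2, (cv_KD_ibp (by positivity) 0 1 hh hh1 d1 x).2]
  congr 1; funext y; rw [ee_10, ee_01]; ring

lemma phi_int : ∫ u : E2, Real.pi⁻¹ * ((1 + ‖u‖^2)^2)⁻¹ = 1 := by
  have := integral_fun_norm_addHaar (volume : Measure E2) (fun r => Real.pi⁻¹ * ((1 + r^2)^2)⁻¹)
  rw [this]
  have e : ∫ y in Set.Ioi (0:ℝ), y ^ (Module.finrank ℝ E2 - 1) • (Real.pi⁻¹ * ((1 + y^2)^2)⁻¹) = Real.pi⁻¹ * (1/2) := by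
    have key := integral_Ioi_of_hasDerivAt_of_nonneg' (g := fun y : ℝ => -(Real.pi⁻¹/2) * (1+y^2)⁻¹) (g' := fun y => y * (Real.pi⁻¹ * ((1 + y^2)^2)⁻¹)) (a := 0) (l := 0) (fun y _ => by
      have h1 : HasDerivAt (fun y : ℝ => 1 + y^2) (2*y) y := by simpa using (hasDerivAt_pow 2 y).const_add 1
      have h2 := (h1.fun_inv (by positivity)).const_mul (-(Real.pi⁻¹/2))
      refine h2.congr_deriv ?_
      field_simp) (fun y hy => by have : (0:ℝ) < y := hy; positivity) (by
      have : Filter.Tendsto (fun y : ℝ => (1+y^2)⁻¹) Filter.atTop (nhds 0) :=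
        (Filter.tendsto_atTop_add_const_left _ 1 (Filter.tendsto_pow_atTop (by norm_num))).inv_tendsto_atTop
      simpa using this.const_mul (-(Real.pi⁻¹/2)))
    simp at key ⊢
    rw [key]; ring
  rw [e]
  simp [Measure.real]
  rw [ENNReal.toReal_ofReal Real.pi_pos.le]
  field_simp

lemma cv_div {h h0 h1 : E2 → ℝ} (hh : CI h) (hh0 : CI h0) (hh1 : CI h1) (d0 : HD 0 h h0) (d1 : HD 1 h h1) (x : E2) :
    cv (KD 0 0) h0 x + cv (KD 0 1) h1 x = 2 * Real.pi * h x := by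
  refine tendsto_nhds_unique ((cv_KD_tendsto 0 hh0 x).add (cv_KD_tendsto 1 hh1 x)) ?_
  have key := (tendsto_integral_comp_smul_smul_of_integrable' (μ := (volume : Measure E2)) (φ := fun u => Real.pi⁻¹ * ((1 + ‖u‖^2)^2)⁻¹) (fun u => by positivity) phi_int ?_ hh.2 (hh.1.continuousAt (x := x))).const_mul (2 * Real.pi)
  · refine key.congr' ?_
    filter_upwards [Filter.eventually_gt_atTop 0] with c hc
    have a := cv_KD_ibp (d := (c^2)⁻¹) (by positivity) 0 0 hh hh0 d0 x
    have b := cv_KD_ibp (d := (c^2)⁻¹) (by positivity) 1 1 hh hh1 d1 x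
    rw [a.2, b.2, ← integral_add a.1 b.1, ← integral_const_mul]
    congr 1; funext y
    rw [ee_00, ee_11, norm_smul, mul_pow, ← rs_eq]
    have hp : 0 ≤ rs (x - y) := by rw [rs_eq]; positivity
    have e : (x-y) 0 * (x - y) 0 + (x-y) 1 * (x-y) 1 = rs (x-y) := by unfold rs; ring
    have hpi := Real.pi_pos
    simp only [finrank_euclideanSpace, Fintype.card_fin, smul_eq_mul, Real.norm_eq_abs, sq_abs]
    have hq : 0 < rs (x - y) + (c^2)⁻¹ := by positivity
    have hq2 : 1 + c^2 * rs (x-y) = c^2 * (rs (x - y) + (c^2)⁻¹) := by field_simp; ring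
    have e3 : 1 / (rs (x - y) + (c^2)⁻¹) - 2 * (x-y) 0 * (x-y) 0 / (rs (x - y) + (c^2)⁻¹)^2 + (1 / (rs (x - y) + (c^2)⁻¹) - 2 * (x-y) 1 * (x-y) 1 / (rs (x - y) + (c^2)⁻¹)^2)
      = 2 * (c^2)⁻¹ / (rs (x - y) + (c^2)⁻¹)^2 := by
      generalize (c^2)⁻¹ = d at *
      field_simp
      linear_combination -2 * e
    rw [← add_mul, e3, hq2]
    field_simp
  · have h1 : Filter.Tendsto (fun u : E2 => Real.pi⁻¹ * (1 + ‖u‖^2)⁻¹) (Bornology.cobounded E2) (nhds 0) := by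
      have : Filter.Tendsto (fun y : ℝ => (1+y^2)⁻¹) Filter.atTop (nhds 0) :=
        (Filter.tendsto_atTop_add_const_left _ 1 (Filter.tendsto_pow_atTop (by norm_num))).inv_tendsto_atTop
      simpa using (this.comp tendsto_norm_cobounded_atTop).const_mul (Real.pi⁻¹)
    refine squeeze_zero (fun u => by positivity) (fun u => ?_) h1
    simp only [finrank_euclideanSpace, Fintype.card_fin]
    have hpi := Real.pi_pos
    rw [mul_left_comm]
    apply mul_le_mul_of_nonneg_left _ (by positivity)
    rw [← div_eq_mul_inv, div_le_iff₀ (by positivity)]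
    have hh : (1 + ‖u‖^2)⁻¹ * (1 + ‖u‖^2)^2 = 1 + ‖u‖^2 := by field_simp
    rw [hh]; linarith

lemma log_bd {r : ℝ} (hr : 0 ≤ r) : |Real.log r| ≤ r⁻¹ + 2 * √r := by
  rcases hr.eq_or_lt with h | h
  · rw [← h]; simp
  have h1 : Real.log r ≤ 2 * √r := by
    have e : Real.log r = 2 * Real.log (√r) := by rw [Real.log_sqrt hr]; ring
    have := Real.log_le_sub_one_of_pos (Real.sqrt_pos.2 h)
    rw [e]; linarith
  have h2 : - Real.log r ≤ r⁻¹ := by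
    rw [← Real.log_inv]
    have := Real.log_le_sub_one_of_pos (inv_pos.2 h); linarith
  have h3 : 0 ≤ r⁻¹ := by positivity
  have h4 := Real.sqrt_nonneg r
  rw [abs_le]; constructor <;> linarith

lemma log_bd2 (x y : E2) : |Real.log ‖x - y‖| ≤ ‖x - y‖⁻¹ + 2 * √(1+‖x‖) * √(1+‖y‖) := by
  refine (log_bd (norm_nonneg _)).trans ?_
  have : √‖x - y‖ ≤ √(1+‖x‖) * √(1+‖y‖) := by
    rw [← Real.sqrt_mul (by positivity)]
    apply Real.sqrt_le_sqrt
    have := norm_sub_le x y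
    nlinarith [mul_nonneg (norm_nonneg x) (norm_nonneg y)]
  nlinarith

lemma sqrt_int {ε : E2 → ℝ} (h : M 2 ε) : Integrable (fun y => √(1+‖y‖) * |ε y|) := by
  have hi : Integrable (fun y : E2 => 4 * (1+‖y‖)^(-(3:ℝ))) :=
    (integrable_one_add_norm (E := E2) (μ := volume) (r := 3) (by simp; norm_num)).const_mul 4
  refine integrable_of_le (by have := h.1; fun_prop) (h.2.add hi) fun y => ?_
  simp only [Pi.add_apply]
  have hn := norm_nonneg y
  have hr := rho_pos y
  have hr2 : (1+‖y‖)^2 ≤ 2 * rho y := by rw [rho_eq]; nlinarith [sq_nonneg (‖y‖-1)]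
  have e1 : (1+‖y‖)^(-(3:ℝ)) = ((1+‖y‖)^3)⁻¹ := by
    rw [Real.rpow_neg (by positivity)]; norm_cast
  rw [e1]
  have e2 : rho y ^ (2:ℤ) = rho y ^ 2 := by norm_cast
  rw [e2]
  have hs : √(1+‖y‖)^2 = 1 + ‖y‖ := Real.sq_sqrt (by positivity)
  set s := √(1+‖y‖) with hs'
  have hs0 : 0 ≤ s := Real.sqrt_nonneg _
  refine abs_le_of_sq_le_sq ?_ (by positivity)
  have hA : 0 ≤ rho y ^2 * ε y^2 := by positivity
  have hB : 0 ≤ 4 * ((1+‖y‖)^3)⁻¹ := by positivity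
  have hAB : (s * |ε y|)^2 ≤ (rho y ^2 * ε y^2) * (4 * ((1+‖y‖)^3)⁻¹) := by
    rw [mul_pow, sq_abs, hs]
    have : (1 + ‖y‖) ≤ rho y^2 * (4 * ((1+‖y‖)^3)⁻¹) := by
      rw [← mul_assoc, ← div_eq_mul_inv, le_div_iff₀ (by positivity)]
      calc (1+‖y‖) * (1+‖y‖)^3 = ((1+‖y‖)^2)^2 := by ring
        _ ≤ (2 * rho y)^2 := by gcongr
        _ = _ := by ring
    calc _ ≤ (rho y^2 * (4 * ((1+‖y‖)^3)⁻¹)) * ε y^2 := by gcongr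
      _ = _ := by ring
  nlinarith

lemma log_int {ε : E2 → ℝ} (h : M 2 ε) (x : E2) : Integrable (fun y => Real.log ‖x - y‖ * ε y) := by
  refine ((cv_int Ker.inv h.CI.abs x).add ((sqrt_int h).const_mul (2 * √(1+‖x‖)))).mono' ?_ (Filter.Eventually.of_forall fun y => ?_)
  · have := h.1.measurable
    apply Measurable.aestronglyMeasurable
    fun_prop
  · rw [Real.norm_eq_abs, abs_mul]
    simp only [Pi.add_apply]
    calc _ ≤ (‖x - y‖⁻¹ + 2 * √(1+‖x‖) * √(1+‖y‖)) * |ε y| := mul_le_mul_of_nonneg_right (log_bd2 x y) (abs_nonneg _)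
      _ = _ := by ring

lemma Psi_bd {ε : E2 → ℝ} (h : M 2 ε) (x : E2) :
    |Psi ε x| ≤ (1/(2*Real.pi)) * (cv (fun u => ‖u‖⁻¹) (fun y => |ε y|) x + 2 * √(1+‖x‖) * ∫ y, √(1+‖y‖) * |ε y|) := by
  have hpi := Real.pi_pos
  unfold Psi
  rw [abs_mul, abs_neg, abs_of_pos (by positivity : 0 < 1/(2*Real.pi))]
  apply mul_le_mul_of_nonneg_left _ (by positivity)
  refine (abs_integral_le_integral_abs).trans ?_
  unfold cv
  rw [← integral_const_mul, ← integral_add (cv_int Ker.inv h.CI.abs x) ((sqrt_int h).const_mul (2 * √(1+‖x‖)))]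
  refine integral_mono (log_int h x).abs ((cv_int Ker.inv h.CI.abs x).add ((sqrt_int h).const_mul (2 * √(1+‖x‖)))) fun y => ?_
  simp only [abs_mul]
  calc _ ≤ (‖x - y‖⁻¹ + 2 * √(1+‖x‖) * √(1+‖y‖)) * |ε y| := mul_le_mul_of_nonneg_right (log_bd2 x y) (abs_nonneg _)
    _ = _ := by ring

lemma ae_ne (i : Fin 2) (a : ℝ) : ∀ᵐ y : E2, y i ≠ a := by
  have h := Measure.addHaar_affineSubspace (volume : Measure E2)
    (AffineSubspace.mk' (a • ee i) (LinearMap.ker (EuclideanSpace.proj i : E2 →L[ℝ] ℝ).toLinearMap)) ?_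
  · rw [ae_iff]
    refine measure_mono_null (fun y hy => ?_) h
    have hy' : y i = a := by simpa using hy
    rw [SetLike.mem_coe, AffineSubspace.mem_mk']
    simp [hy', ee]
  · intro htop
    have : ((a+1) • ee i : E2) ∈ (⊤ : AffineSubspace ℝ E2) := trivial
    rw [← htop, AffineSubspace.mem_mk'] at this
    simp [ee] at this

lemma log_deriv {j : Fin 2} (v : E2) (h : ∀ s : ℝ, 0 < rs (v + s • ee j)) (s : ℝ) :
    HasDerivAt (fun s : ℝ => Real.log ‖v + s • ee j‖) (KD 0 j (v + s • ee j)) s := by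
  have h1 := ((HD_rs j).hasDerivAt v s).log (h s).ne'
  have h2 := h1.const_mul (1/2:ℝ)
  have e : (fun s : ℝ => Real.log ‖v + s • ee j‖) = fun s : ℝ => (1/2) * Real.log (rs (v + s • ee j)) := by
    funext s; rw [rs_eq, Real.log_pow]; push_cast; ring
  rw [e]
  refine h2.congr_deriv ?_
  unfold KD; rw [add_zero]; ring

lemma Psi_HD {ε : E2 → ℝ} (h : M 2 ε) (j : Fin 2) :
    HD j (Psi ε) (fun x => -(1/(2*Real.pi)) * cv (KD 0 j) ε x) := by
  unfold Psi
  apply HD.cmul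
  refine HD_of_int (cv_cont (KD_ker le_rfl j) h.CI) fun x t => ?_
  unfold cv
  rw [swap_lemma (fun s y => KD 0 j (x + s • ee j - y) * ε y) t]
  · rw [← integral_sub (log_int h _) (log_int h _)]
    apply integral_congr_ae
    have hne : ∀ᵐ y : E2, ∀ s : ℝ, 0 < rs (x - y + s • ee j) := by
      fin_cases j
      · filter_upwards [ae_ne 1 (x 1)] with y hy s
        have : 0 < (x 1 - y 1)^2 := by have := sub_ne_zero.2 (Ne.symm hy); positivity
        simp only [rs, PiLp.add_apply, PiLp.sub_apply, PiLp.smul_apply, smul_eq_mul]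
        simp [ee]; positivity
      · filter_upwards [ae_ne 0 (x 0)] with y hy s
        have : 0 < (x 0 - y 0)^2 := by have := sub_ne_zero.2 (Ne.symm hy); positivity
        simp only [rs, PiLp.add_apply, PiLp.sub_apply, PiLp.smul_apply, smul_eq_mul]
        simp [ee]; positivity
    filter_upwards [hne] with y hy
    rw [intervalIntegral.integral_mul_const]
    have hcont : Continuous (fun s : ℝ => KD 0 j (x - y + s • ee j)) := by
      unfold KD
      refine Continuous.div ?_ ?_ fun s => ?_
      · exact (cont_coord j).comp (by fun_prop)
      · exact (cont_rs.comp (by fun_prop)).add continuous_const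
      · rw [add_zero]; exact (hy s).ne'
    have key := intervalIntegral.integral_eq_sub_of_hasDerivAt (a := 0) (b := t) (fun s _ => log_deriv (x - y) hy s)
      (hcont.intervalIntegrable _ _)
    have e2 : ∀ s : ℝ, x + s • ee j - y = x - y + s • ee j := fun s => by abel
    simp_rw [e2]
    rw [key]
    simp; ring
  · have := (KD_ker (le_refl 0) j).meas
    have := h.1.measurable
    have e3 : Function.uncurry (fun (s:ℝ) (y:E2) => KD 0 j (x + s • ee j - y) * ε y) = fun p => KD 0 j (x + p.1 • ee j - p.2) * ε p.2 := rfl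
    rw [e3]; fun_prop
  · intro s; exact cv_int (KD_ker le_rfl j) h.CI _
  · have : Continuous (fun s : ℝ => cv (fun u => |KD 0 j u|) (fun u => |ε u|) (x + s • ee j)) :=
      (cv_cont (KD_ker le_rfl j).abs h.CI.abs).comp (by fun_prop)
    refine this.congr fun s => ?_
    unfold cv; simp_rw [abs_mul]

/-- the first derivative fields -/
def PP (j : Fin 2) (h : E2 → ℝ) (x : E2) : ℝ := -(1/(2*Real.pi)) * cv (KD 0 j) h x

lemma PP_M {h : E2 → ℝ} (hh : M 2 h) (j : Fin 2) : M (-1) (PP j h) := (cv_M (KD_ker le_rfl j) hh).cmul _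
lemma PP_HD {h h' : E2 → ℝ} {i : Fin 2} (hh : M 2 h) (hh' : M 2 h') (hd : HD i h h') (j : Fin 2) : HD i (PP j h) (PP j h') :=
  (cv_HD (KD_ker le_rfl j) hh.CI hh'.CI hd).cmul _
lemma PP_DD {h h0 h1 : E2 → ℝ} (hh : DD 2 h h0 h1) (j : Fin 2) : DD (-1) (PP j h) (PP j h0) (PP j h1) :=
  ⟨PP_HD hh.m hh.m1 hh.d1 j, PP_HD hh.m hh.m2 hh.d2 j, PP_M hh.m j, PP_M hh.m1 j, PP_M hh.m2 j⟩
lemma PP_div {h h0 h1 : E2 → ℝ} (hh : DD 2 h h0 h1) (x : E2) : PP 0 h0 x + PP 1 h1 x = - h x := by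
  have := cv_div hh.m.CI hh.m1.CI hh.m2.CI hh.d1 hh.d2 x
  unfold PP
  have hpi := Real.pi_pos
  rw [← mul_add, this]; field_simp
lemma PP_curl {h h0 h1 : E2 → ℝ} (hh : DD 2 h h0 h1) (x : E2) : PP 0 h1 x = PP 1 h0 x := by
  unfold PP
  rw [cv_curl hh.m.CI hh.m1.CI hh.m2.CI hh.d1 hh.d2]

lemma Psi_DD {ε : E2 → ℝ} (h : M 2 ε) : DD (-3) (Psi ε) (PP 0 ε) (PP 1 ε) := by
  have hc : Continuous (Psi ε) := (HD_diff (Psi_HD h 0) (Psi_HD h 1) (PP_M h 0).1 (PP_M h 1).1).continuous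
  refine ⟨Psi_HD h 0, Psi_HD h 1, ?_, (PP_M h 0).mono (by norm_num), (PP_M h 1).mono (by norm_num)⟩
  have hA : M (-1) (cv (fun u => ‖u‖⁻¹) (fun y => |ε y|)) :=
    cv_M Ker.inv ⟨h.1.abs, by simpa using h.2⟩
  set I := ∫ y, √(1+‖y‖) * |ε y|
  set A := cv (fun u => ‖u‖⁻¹) (fun y => |ε y|)
  have hone := M_one.2
  refine ⟨hc, integrable_of_le ((cont_rho_zpow _).mul (hc.pow 2)) (((hA.mono (l := -3) (by norm_num)).2.const_mul (2 * (1/(2*Real.pi))^2)).add (hone.const_mul (16 * (1/(2*Real.pi))^2 * I^2))) fun x => ?_⟩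
  have hr := rho_pos x
  rw [abs_of_nonneg (mul_nonneg (zpow_nonneg hr.le _) (sq_nonneg _))]
  have hb := Psi_bd h x
  have e1 : Psi ε x ^2 ≤ ((1/(2*Real.pi)) * (A x + 2 * √(1+‖x‖) * I))^2 := by
    rw [← sq_abs]; gcongr
  have hs : √(1+‖x‖)^2 = 1 + ‖x‖ := Real.sq_sqrt (by positivity)
  have h2 : 1 + ‖x‖ ≤ 2 * rho x := by rw [rho_eq]; nlinarith [sq_nonneg (‖x‖-1), norm_nonneg x]
  have e2 : ((1/(2*Real.pi)) * (A x + 2 * √(1+‖x‖) * I))^2 ≤ (1/(2*Real.pi))^2 * (2 * A x^2 + 16 * rho x * I^2) := by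
    rw [mul_pow]
    apply mul_le_mul_of_nonneg_left _ (sq_nonneg _)
    have : (2 * √(1+‖x‖) * I)^2 ≤ 8 * rho x * I^2 := by
      rw [mul_pow, mul_pow, hs]; nlinarith [sq_nonneg I]
    nlinarith [sq_nonneg (A x - 2 * √(1+‖x‖) * I)]
  have e3 : rho x ^ (-2:ℤ) = rho x^(-3:ℤ) * rho x := by
    have := zpow_add_one₀ hr.ne' (-3); rw [← this]; norm_num
  simp only [Pi.add_apply]
  calc _ ≤ rho x^(-3:ℤ) * ((1/(2*Real.pi))^2 * (2 * A x^2 + 16 * rho x * I^2)) :=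
        mul_le_mul_of_nonneg_left (e1.trans e2) (zpow_nonneg hr.le _)
    _ = _ := by rw [e3]; ring

lemma lin3 {q f g h : E2 → ℝ} (z : ZI q) (a b c : ℝ) (hf : Integrable f) (hg : Integrable g) (hh : Integrable h)
    (e : ∀ y, q y = a * f y + b * g y + c * h y) : a * (∫ y, f y) + b * (∫ y, g y) + c * (∫ y, h y) = 0 := by
  rw [← z.2, ← integral_const_mul, ← integral_const_mul, ← integral_const_mul]
  have e1 := integral_add (hf.const_mul a) (hg.const_mul b)
  have e2 := integral_add ((hf.const_mul a).add (hg.const_mul b)) (hh.const_mul c)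
  rw [← e1]
  refine e2.symm.trans (integral_congr_ae (Filter.Eventually.of_forall fun y => ?_))
  simp only [Pi.add_apply]; exact (e y).symm

lemma le4 {f g1 g2 g3 g4 : E2 → ℝ} (a b c d : ℝ) (hf : Integrable f) (h1 : Integrable g1) (h2 : Integrable g2) (h3 : Integrable g3) (h4 : Integrable g4)
    (e : ∀ y, f y ≤ a * g1 y + b * g2 y + c * g3 y + d * g4 y) :
    ∫ y, f y ≤ a * (∫ y, g1 y) + b * (∫ y, g2 y) + c * (∫ y, g3 y) + d * (∫ y, g4 y) := by
  rw [← integral_const_mul, ← integral_const_mul, ← integral_const_mul, ← integral_const_mul]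
  have i1 := (h1.const_mul a).add (h2.const_mul b)
  have i2 := i1.add (h3.const_mul c)
  have e1 := integral_add (h1.const_mul a) (h2.const_mul b)
  have e2 := integral_add i1 (h3.const_mul c)
  have e3 := integral_add i2 (h4.const_mul d)
  rw [← e1]
  refine (integral_mono hf (i2.add (h4.const_mul d)) fun y => ?_).trans (le_of_eq (e3.trans ?_))
  · simp only [Pi.add_apply]; exact e y
  · exact congrArg (· + _) e2

lemma le2 {f g1 g2 : E2 → ℝ} (a b : ℝ) (hf : Integrable f) (h1 : Integrable g1) (h2 : Integrable g2)
    (e : ∀ y, f y ≤ a * g1 y + b * g2 y) :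
    ∫ y, f y ≤ a * (∫ y, g1 y) + b * (∫ y, g2 y) := by
  have := le4 a b 0 0 hf h1 h2 h2 h2 (fun y => by have := e y; linarith)
  linarith

lemma one_dim {f f' : ℝ → ℝ} (hf : ∀ x, HasDerivAt f (f' x) x) (hc : Continuous f') {a b : ℝ}
    (ha : a ∈ Set.Icc (-1:ℝ) 1) (hb : b ∈ Set.Icc (-1:ℝ) 1) :
    (f a - f b)^2 ≤ 2 * ∫ t in (-1:ℝ)..1, f' t^2 := by
  wlog hab : b ≤ a generalizing a b
  · have := this hb ha (le_of_not_ge hab)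
    calc _ = (f b - f a)^2 := by ring
      _ ≤ _ := this
  have e := intervalIntegral.integral_eq_sub_of_hasDerivAt (a := b) (b := a) (fun s _ => hf s) (hc.intervalIntegrable _ _)
  rw [← e, intervalIntegral.integral_of_le hab, intervalIntegral.integral_of_le (by norm_num)]
  have i2 : IntegrableOn (fun t => f' t^2) (Set.Ioc (-1) 1) := ((hc.pow 2).integrableOn_Icc).mono_set Set.Ioc_subset_Icc_self
  have hsub : Set.Ioc b a ⊆ Set.Ioc (-1) 1 := Set.Ioc_subset_Ioc hb.1 ha.2
  have i1 : IntegrableOn f' (Set.Ioc b a) := (hc.integrableOn_Icc).mono_set Set.Ioc_subset_Icc_self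
  have h := cs_ineq (μ := volume.restrict (Set.Ioc b a)) (m := f') (A := fun _ => 1) (B := fun t => f' t^2)
    i1 (integrableOn_const (by simp)) (i2.mono_set hsub) (by simp) (Filter.Eventually.of_forall fun t => sq_nonneg _) (by simp)
  refine h.trans ?_
  have h1 : ∫ t in Set.Ioc b a, (1:ℝ) = a - b := by simp [hab]
  rw [h1]
  have h2 : ∫ t in Set.Ioc b a, f' t^2 ≤ ∫ t in Set.Ioc (-1) 1, f' t^2 :=
    setIntegral_mono_set i2 (Filter.Eventually.of_forall fun t => sq_nonneg _) hsub.eventuallyLE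
  exact mul_le_mul (by linarith [ha.2, hb.1]) h2 (setIntegral_nonneg measurableSet_Ioc fun t _ => sq_nonneg _) (by norm_num)

def Qs : Set E2 := {y | y 0 ∈ Set.Ioc (-1:ℝ) 1 ∧ y 1 ∈ Set.Ioc (-1:ℝ) 1}
lemma Qs_meas : MeasurableSet Qs :=
  (measurableSet_Ioc.preimage (cont_coord 0).measurable).inter (measurableSet_Ioc.preimage (cont_coord 1).measurable)
lemma Qs_pre : mk2 ⁻¹' Qs = Set.Ioc (-1:ℝ) 1 ×ˢ Set.Ioc (-1:ℝ) 1 := by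
  ext p; simp [Qs, mk2_0, mk2_1]
lemma Qs_rho {y : E2} (h : y ∈ Qs) : rho y ≤ 3 := by
  obtain ⟨⟨a, b⟩, c, d⟩ := h; unfold rho; nlinarith
lemma Qs_rho' {y : E2} (h : y ∉ Qs) : 2 ≤ rho y := by
  unfold rho
  by_contra hc
  push Not at hc
  have h0 : (y 0)^2 < 1 := by nlinarith [sq_nonneg (y 1)]
  have h1 : (y 1)^2 < 1 := by nlinarith [sq_nonneg (y 0)]
  apply h
  rw [sq_lt_one_iff_abs_lt_one, abs_lt] at h0 h1
  exact ⟨⟨h0.1, h0.2.le⟩, ⟨h1.1, h1.2.le⟩⟩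

lemma Qs_intOn {h : E2 → ℝ} (hc : Continuous h) : IntegrableOn (fun p => h (mk2 p)) (Set.Ioc (-1:ℝ) 1 ×ˢ Set.Ioc (-1:ℝ) 1) := by
  have : IntegrableOn (fun p => h (mk2 p)) (Set.Icc (-1:ℝ) 1 ×ˢ Set.Icc (-1:ℝ) 1) :=
    (hc.comp cont_mk2).continuousOn.integrableOn_compact (isCompact_Icc.prod isCompact_Icc)
  exact this.mono_set (Set.prod_mono Set.Ioc_subset_Icc_self Set.Ioc_subset_Icc_self)
lemma Qs_int {h : E2 → ℝ} (hc : Continuous h) : IntegrableOn h Qs := by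
  have := (mk2_mp.integrableOn_comp_preimage mk2_emb (f := h) (s := Qs)).1
  apply this; rw [Qs_pre]; exact Qs_intOn hc
lemma Qs_eq {h : E2 → ℝ} (hc : Continuous h) : ∫ y in Qs, h y = ∫ s in (-1:ℝ)..1, ∫ t in (-1:ℝ)..1, h (mk2 (s,t)) := by
  rw [← mk2_mp.setIntegral_preimage_emb mk2_emb, Qs_pre, Measure.volume_eq_prod, setIntegral_prod _ (Qs_intOn hc)]
  simp_rw [intervalIntegral.integral_of_le (by norm_num : (-1:ℝ) ≤ 1)]
lemma Qs_eq' {h : E2 → ℝ} (hc : Continuous h) : ∫ y in Qs, h y = ∫ t in (-1:ℝ)..1, ∫ s in (-1:ℝ)..1, h (mk2 (s,t)) := by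
  rw [Qs_eq hc]
  simp_rw [intervalIntegral.integral_of_le (by norm_num : (-1:ℝ) ≤ 1)]
  refine integral_integral_swap (f := fun s t => h (mk2 (s,t))) ?_
  have := Qs_intOn hc
  unfold IntegrableOn at this
  rw [Measure.volume_eq_prod, ← Measure.prod_restrict] at this
  exact this

lemma loc_poincare {f f1 f2 : E2 → ℝ} (h1 : HD 0 f f1) (h2 : HD 1 f f2) (cf : Continuous f) (c1 : Continuous f1) (c2 : Continuous f2) :
    ∃ c, ∫ y in Qs, (f y - c)^2 ≤ 8 * ∫ y in Qs, (f1 y^2 + f2 y^2) := by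
  set V : ℝ → ℝ := fun s => ∫ t in (-1:ℝ)..1, f2 (mk2 (s,t))^2 with hV
  set H : ℝ → ℝ := fun t => ∫ s in (-1:ℝ)..1, f1 (mk2 (s,t))^2 with hH
  have cV : Continuous V := intervalIntegral.continuous_parametric_intervalIntegral_of_continuous' (f := fun s t => f2 (mk2 (s,t))^2) (by
    have : Continuous (fun p : ℝ × ℝ => f2 (mk2 p)^2) := (c2.comp cont_mk2).pow 2
    exact this) _ _
  have cH : Continuous H := intervalIntegral.continuous_parametric_intervalIntegral_of_continuous' (f := fun t s => f1 (mk2 (s,t))^2) (by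
    have : Continuous (fun p : ℝ × ℝ => f1 (mk2 (p.2,p.1))^2) := (c1.comp (cont_mk2.comp continuous_swap)).pow 2
    exact this) _ _
  obtain ⟨t', ht', hle⟩ := exists_le_setAverage (μ := volume) (s := Set.Ioc (-1:ℝ) 1) (f := H) (by simp) (by simp) ((cH.integrableOn_Icc).mono_set Set.Ioc_subset_Icc_self)
  rw [setAverage_eq, ← intervalIntegral.integral_of_le (by norm_num), ← Qs_eq' (h := fun y => f1 y^2) (c1.pow 2)] at hle
  have e2 : (volume.real (Set.Ioc (-1:ℝ) 1))⁻¹ = 1/2 := by simp [Measure.real]; norm_num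
  rw [e2, smul_eq_mul] at hle
  refine ⟨f (mk2 (0,t')), ?_⟩
  rw [Qs_eq (h := fun y => (f y - f (mk2 (0,t')))^2) (by fun_prop)]
  rw [integral_add (Qs_int (h := fun y => f1 y^2) (by fun_prop)) (Qs_int (h := fun y => f2 y^2) (by fun_prop)), Qs_eq (h := fun y => f2 y^2) (by fun_prop)]
  have hp : ∀ s ∈ Set.Icc (-1:ℝ) 1, ∀ t ∈ Set.Icc (-1:ℝ) 1, (f (mk2 (s,t)) - f (mk2 (0,t')))^2 ≤ 4 * V s + 4 * H t' := by
    intro s hs t ht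
    have a := one_dim (f := fun t => f (mk2 (s,t))) (fun t => h2.hasDerivAt_snd s t) (c2.comp (cont_mk2.comp (by fun_prop))) ht (Set.Ioc_subset_Icc_self ht')
    have b := one_dim (f := fun s => f (mk2 (s,t'))) (fun s => h1.hasDerivAt_fst s t') (c1.comp (cont_mk2.comp (by fun_prop))) hs (by norm_num : (0:ℝ) ∈ Set.Icc (-1:ℝ) 1)
    change (f (mk2 (s,t)) - f (mk2 (s,t')))^2 ≤ 2 * V s at a
    change (f (mk2 (s,t')) - f (mk2 (0,t')))^2 ≤ 2 * H t' at b
    nlinarith [sq_nonneg ((f (mk2 (s,t)) - f (mk2 (s,t'))) - (f (mk2 (s,t')) - f (mk2 (0,t'))))]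
  have hin : ∀ s ∈ Set.Icc (-1:ℝ) 1, ∫ t in (-1:ℝ)..1, (f (mk2 (s,t)) - f (mk2 (0,t')))^2 ≤ 2 * (4 * V s + 4 * H t') := by
    intro s hs
    have := intervalIntegral.integral_mono_on (μ := volume) (a := -1) (b := 1) (by norm_num) (Continuous.intervalIntegrable (by
      have := cf.comp (cont_mk2.comp (Continuous.prodMk_right s)); exact (this.sub continuous_const).pow 2) _ _) (continuous_const.intervalIntegrable _ _) (fun t ht => hp s hs t ht)
    refine this.trans (le_of_eq ?_)
    simp; ring
  have := intervalIntegral.integral_mono_on (μ := volume) (a := -1) (b := 1) (by norm_num) (Continuous.intervalIntegrable (by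
      exact intervalIntegral.continuous_parametric_intervalIntegral_of_continuous' (f := fun s t => (f (mk2 (s,t)) - f (mk2 (0,t')))^2) (by
    have : Continuous (fun p : ℝ × ℝ => (f (mk2 p) - f (mk2 (0,t')))^2) := ((cf.comp cont_mk2).sub continuous_const).pow 2
    exact this) _ _) _ _) (Continuous.intervalIntegrable (by fun_prop) _ _) hin
  refine this.trans ?_
  have e : ∫ s in (-1:ℝ)..1, 2 * (4 * V s + 4 * H t') = 8 * (∫ s in (-1:ℝ)..1, V s) + 16 * H t' := by
    rw [intervalIntegral.integral_const_mul, intervalIntegral.integral_add (show IntervalIntegrable (fun s => 4 * V s) volume (-1) 1 from (continuous_const.mul cV).intervalIntegrable _ _) (continuous_const.intervalIntegrable _ _), intervalIntegral.integral_const_mul]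
    simp; ring
  rw [e]
  linarith

lemma poincare {f f1 f2 : E2 → ℝ} (hf : DD (-3) f f1 f2) :
    ∃ c, ∫ y, kap y^4 * (f y - c)^2 ≤ 1729 * ∫ y, kap y^3 * (f1 y^2 + f2 y^2) := by
  obtain ⟨c, hc⟩ := loc_poincare hf.d1 hf.d2 hf.m.1 hf.m1.1 hf.m2.1
  refine ⟨c, ?_⟩
  have hg : DD (-3) (fun y => f y - c) f1 f2 := (hf.sub ((DD_const c).mono (by norm_num))).congr (fun y => rfl) (fun y => by simp) (fun y => by simp)
  set g : E2 → ℝ := fun y => f y - c with hgd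
  have k2 := Cd.kap.mul Cd.kap
  have k4 := k2.mul k2
  have z1 := (DD.coef (Cd.y0.mul k4) hg).Z1 hg (by norm_num)
  have z2 := (DD.coef (Cd.y1.mul k4) hg).Z2 hg (by norm_num)
  have kk4 := (Cf.kap.mul Cf.kap).mul (Cf.kap.mul Cf.kap)
  have iX : Integrable (fun y => kap y^4 * g y^2) :=
    ((hg.m.coef kk4).int hg.m (by norm_num)).congr (Filter.Eventually.of_forall fun y => by ring)
  have iX5 : Integrable (fun y => kap y^5 * g y^2) :=
    ((hg.m.coef (kk4.mul Cf.kap)).int hg.m (by norm_num)).congr (Filter.Eventually.of_forall fun y => by ring)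
  have iY : Integrable (fun y => kap y^3 * (f1 y^2 + f2 y^2)) := by
    have k3 := (Cf.kap.mul Cf.kap).mul Cf.kap
    refine (((hg.m1.coef k3).int hg.m1 (by norm_num)).add ((hg.m2.coef k3).int hg.m2 (by norm_num))).congr (Filter.Eventually.of_forall fun y => ?_)
    simp only [Pi.add_apply]; ring
  have iT : Integrable (fun y => 2 * kap y^4 * g y * (y 0 * f1 y + y 1 * f2 y)) := by
    refine ((((hg.m.coef ((Cf.coord 0).mul kk4)).int hg.m1 (by norm_num)).add ((hg.m.coef ((Cf.coord 1).mul kk4)).int hg.m2 (by norm_num))).const_mul 2).congr (Filter.Eventually.of_forall fun y => ?_)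
    simp only [Pi.add_apply]; ring
  have z := (z1.add z2).congr (g := fun y => 8 * (kap y^5 * g y^2) - 6 * (kap y^4 * g y^2) + 2 * kap y^4 * g y * (y 0 * f1 y + y 1 * f2 y)) (fun y => by
    have hk : kap y * (1 + (y 0)^2 + (y 1)^2) = 1 := inv_mul_cancel₀ (rho_pos y).ne'
    linear_combination (-8 * kap y^4 * g y^2) * hk)
  have e := lin3 z 8 (-6) 1 iX5 iX iT (fun y => by ring)
  have b1 : ∫ y, 2 * kap y^4 * g y * (y 0 * f1 y + y 1 * f2 y) ≤ (∫ y, kap y^4 * g y^2) + ∫ y, kap y^3 * (f1 y^2 + f2 y^2) := by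
    rw [← integral_add iX iY]
    refine integral_mono iT (iX.add iY) fun y => ?_
    have hk : kap y * (1 + (y 0)^2 + (y 1)^2) = 1 := inv_mul_cancel₀ (rho_pos y).ne'
    have hp := kap_pos y
    have h1 : 2 * g y * (y 0 * f1 y + y 1 * f2 y) ≤ g y^2 + rho y * (f1 y^2 + f2 y^2) := by
      unfold rho
      nlinarith [sq_nonneg (g y - (y 0 * f1 y + y 1 * f2 y)), sq_nonneg (y 0 * f2 y - y 1 * f1 y), sq_nonneg (f1 y), sq_nonneg (f2 y)]
    have h2 : kap y * rho y = 1 := hk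
    calc _ = kap y^4 * (2 * g y * (y 0 * f1 y + y 1 * f2 y)) := by ring
      _ ≤ kap y^4 * (g y^2 + rho y * (f1 y^2 + f2 y^2)) := by gcongr
      _ = _ := by linear_combination (kap y^3 * (f1 y^2 + f2 y^2)) * h2
  have iQ : IntegrableOn (fun y => g y^2) Qs := Qs_int (hg.m.1.pow 2)
  have b2 : 8 * ∫ y, kap y^5 * g y^2 ≤ 4 * (∫ y, kap y^4 * g y^2) + 8 * ∫ y in Qs, g y^2 := by
    rw [← integral_indicator Qs_meas, ← integral_const_mul, ← integral_const_mul, ← integral_const_mul, ← integral_add (iX.const_mul 4) ((iQ.integrable_indicator Qs_meas).const_mul 8)]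
    refine integral_mono (iX5.const_mul 8) ((iX.const_mul 4).add ((iQ.integrable_indicator Qs_meas).const_mul 8)) fun y => ?_
    have hp := kap_pos y
    by_cases hy : y ∈ Qs
    · simp only [Set.indicator_of_mem hy, Pi.add_apply]
      have : kap y^5 ≤ 1 := pow_le_one₀ hp.le (kap_le y)
      have : kap y^5 * g y^2 ≤ 1 * g y^2 := by gcongr
      have : 0 ≤ kap y^4 * g y^2 := by positivity
      linarith
    · simp only [Set.indicator_of_notMem hy, Pi.add_apply]
      have h2 : kap y ≤ 1/2 := by
        unfold kap; rw [one_div]; exact inv_anti₀ (by norm_num) (Qs_rho' hy)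
      have : kap y * (kap y^4 * g y^2) ≤ (1/2) * (kap y^4 * g y^2) := by gcongr
      nlinarith
  have b3 : ∫ y in Qs, (f1 y^2 + f2 y^2) ≤ 27 * ∫ y, kap y^3 * (f1 y^2 + f2 y^2) := by
    rw [← integral_const_mul, ← integral_indicator Qs_meas]
    refine integral_mono ((Qs_int (h := fun y => f1 y^2 + f2 y^2) ((hg.m1.1.pow 2).add (hg.m2.1.pow 2))).integrable_indicator Qs_meas) (iY.const_mul 27) fun y => ?_
    have hp := kap_pos y
    by_cases hy : y ∈ Qs
    · simp only [Set.indicator_of_mem hy]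
      have h2 : 1/3 ≤ kap y := by
        unfold kap; rw [one_div]; exact inv_anti₀ (rho_pos y) (Qs_rho hy)
      have h3 : (1/3:ℝ)^3 ≤ kap y^3 := by gcongr
      nlinarith [sq_nonneg (f1 y), sq_nonneg (f2 y)]
    · simp only [Set.indicator_of_notMem hy]; positivity
  change ∫ y in Qs, g y^2 ≤ _ at hc
  change ∫ y, kap y^4 * g y^2 ≤ _
  linarith

section jac
open Filter Topology

/-- difference quotient limit against a continuous function -/
lemma dq_lim {G G2 h : E2 → ℝ} (hG : HD 1 G G2) (c0 : Continuous G) (c2 : Continuous G2) (hc : Continuous h) (R : ℝ)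
    (hs : ∀ (y : E2) (t : ℝ), |t| ≤ 1 → R < ‖y‖ → (G (y + t • ee 1) - G y) * h y = 0) :
    Tendsto (fun n : ℕ => ∫ y, (n + 1 : ℝ) * (G (y + ((n + 1 : ℝ)⁻¹) • ee 1) - G y) * h y) atTop (𝓝 (∫ y, G2 y * h y)) := by
  obtain ⟨C, hC⟩ := (isCompact_closedBall (0:E2) (R+1)).exists_bound_of_continuousOn c2.continuousOn
  have hn : ‖ee 1‖ = 1 := by simp [ee]
  refine tendsto_integral_of_dominated_convergence (Set.indicator (Metric.closedBall 0 R) (fun y => C * |h y|)) ?_ ?_ ?_ ?_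
  · intro n; exact Continuous.aestronglyMeasurable (by fun_prop)
  · refine IntegrableOn.integrable_indicator ?_ Metric.isClosed_closedBall.measurableSet
    exact ContinuousOn.integrableOn_compact (isCompact_closedBall 0 R) (by fun_prop)
  · intro n
    refine Eventually.of_forall fun y => ?_
    have hpos : (0:ℝ) < (n:ℝ) + 1 := by positivity
    have h1 : ((n:ℝ)+1)⁻¹ ≤ 1 := inv_le_one_of_one_le₀ (by linarith [(Nat.cast_nonneg n : (0:ℝ) ≤ n)])
    have h0 : 0 < ((n:ℝ)+1)⁻¹ := inv_pos.2 hpos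
    by_cases hy : y ∈ Metric.closedBall (0:E2) R
    · rw [Set.indicator_of_mem hy, norm_mul, norm_mul]
      rw [mem_closedBall_zero_iff] at hy
      have hmv := (convex_Icc (0:ℝ) ((n:ℝ)+1)⁻¹).norm_image_sub_le_of_norm_hasDerivWithin_le (C := C)
        (f := fun s : ℝ => G (y + s • ee 1)) (f' := fun s => G2 (y + s • ee 1)) (x := 0) (y := ((n:ℝ)+1)⁻¹)
        (fun s _ => (hG.hasDerivAt y s).hasDerivWithinAt) (fun s hs' => by
          apply hC
          rw [mem_closedBall_zero_iff]
          refine (norm_add_le _ _).trans ?_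
          rw [norm_smul, hn, mul_one, Real.norm_eq_abs, abs_of_nonneg hs'.1]
          linarith [hs'.2]) ⟨le_rfl, h0.le⟩ ⟨h0.le, le_rfl⟩
      simp only [zero_smul, add_zero, sub_zero] at hmv
      rw [Real.norm_eq_abs ((n:ℝ)+1)⁻¹, abs_of_pos h0] at hmv
      rw [Real.norm_eq_abs ((n:ℝ)+1), abs_of_pos hpos, Real.norm_eq_abs (h y)]
      have : ((n:ℝ)+1) * ‖G (y + ((n:ℝ)+1)⁻¹ • ee 1) - G y‖ ≤ C := by
        calc _ ≤ ((n:ℝ)+1) * (C * ((n:ℝ)+1)⁻¹) := by gcongr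
          _ = C := by field_simp
      exact mul_le_mul_of_nonneg_right this (abs_nonneg _)
    · rw [Set.indicator_of_notMem hy, mul_assoc, hs y _ (by rw [abs_of_pos h0]; exact h1) (by simpa using hy)]
      simp
  · refine Eventually.of_forall fun y => ?_
    refine Tendsto.mul_const _ ?_
    have hd := hG y
    unfold HasLineDerivAt at hd
    have ht := hd.tendsto_slope_zero_right
    have : Tendsto (fun n : ℕ => ((n:ℝ)+1)⁻¹) atTop (𝓝[>] 0) := by
      refine tendsto_nhdsWithin_iff.2 ⟨?_, Eventually.of_forall fun n => ?_⟩
      · simpa using tendsto_one_div_add_atTop_nhds_zero_nat (𝕜 := ℝ)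
      · exact inv_pos.2 (by positivity : (0:ℝ) < (n:ℝ) + 1)
    have := ht.comp this
    refine this.congr fun n => ?_
    simp

lemma HD.shift {j : Fin 2} {f f' : E2 → ℝ} (h : HD j f f') (v : E2) : HD j (fun y => f (y + v)) (fun y => f' (y + v)) := by
  intro y
  have := h (y + v)
  unfold HasLineDerivAt at *
  refine this.congr_of_eventuallyEq (Eventually.of_forall fun t => ?_)
  simp only; congr 1; abel

lemma int_of_supp {f : E2 → ℝ} (hc : Continuous f) (R : ℝ) (h : ∀ y, R < ‖y‖ → f y = 0) : Integrable f := by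
  refine hc.integrable_of_hasCompactSupport (HasCompactSupport.intro (isCompact_closedBall 0 R) fun y hy => h y (by simpa using hy))

lemma jacobian {F F1 F2 G G1 G2 : E2 → ℝ} (f1 : HD 0 F F1) (f2 : HD 1 F F2) (g1 : HD 0 G G1) (g2 : HD 1 G G2)
    (c : Continuous F) (c1 : Continuous F1) (c2 : Continuous F2) (b : Continuous G) (b1 : Continuous G1) (b2 : Continuous G2)
    (R : ℝ) (s : ∀ y, R < ‖y‖ → F y = 0) (s1 : ∀ y, R < ‖y‖ → F1 y = 0) (s2 : ∀ y, R < ‖y‖ → F2 y = 0) :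
    ZI (fun y => F1 y * G2 y - F2 y * G1 y) := by
  have hn : ‖ee 1‖ = 1 := by simp [ee]
  have iA : Integrable (fun y => F1 y * G2 y) := int_of_supp (by fun_prop) R fun y hy => by rw [s1 y hy, zero_mul]
  have iB : Integrable (fun y => F2 y * G1 y) := int_of_supp (by fun_prop) R fun y hy => by rw [s2 y hy, zero_mul]
  refine ⟨iA.sub iB, ?_⟩
  rw [integral_sub iA iB, sub_eq_zero]
  have L1 := dq_lim g2 b b2 c1 R (fun y t _ hy => by rw [s1 y hy, mul_zero])
  -- the reflected one
  have f2' : HD 1 (fun y => F (-y)) (fun y => - F2 (-y)) := by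
    have := f2.refl 0
    simpa using this
  have L2 := dq_lim (h := fun y => G1 (-y)) f2' (by fun_prop) (by fun_prop) (by fun_prop) (R+1) (fun y t ht hy => by
    rw [s (-y) (by rw [norm_neg]; linarith), s (-(y + t • ee 1)) ?_]; · simp
    rw [norm_neg]
    have := norm_sub_norm_le y (-(t • ee 1))
    rw [norm_neg, norm_smul, hn, mul_one, sub_neg_eq_add, Real.norm_eq_abs] at this
    linarith)
  have e2 : ∫ y, -F2 (-y) * G1 (-y) = - ∫ y, F2 y * G1 y := by
    rw [integral_neg_eq_self (fun y => - F2 y * G1 y) volume, ← integral_neg]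
    simp
  rw [e2] at L2
  have key : ∀ n : ℕ, ∫ y, (n + 1 : ℝ) * (G (y + ((n + 1 : ℝ)⁻¹) • ee 1) - G y) * F1 y =
      - ∫ y, (n + 1 : ℝ) * (F (-(y + ((n + 1 : ℝ)⁻¹) • ee 1)) - F (-y)) * G1 (-y) := by
    intro n
    set t : ℝ := ((n:ℝ)+1)⁻¹
    have hz := ibp (f1.mul ((g1.shift (t • ee 1)).sub g1)) (int_of_supp (by fun_prop) R fun y hy => by rw [s y hy, zero_mul])
      (int_of_supp (by fun_prop) R fun y hy => by rw [s1 y hy, s y hy]; ring)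
    have j1 : Integrable (fun y => F1 y * (G (y + t • ee 1) - G y)) := int_of_supp (by fun_prop) R fun y hy => by rw [s1 y hy, zero_mul]
    have j2 : Integrable (fun y => F y * G1 (y + t • ee 1)) := int_of_supp (by fun_prop) R fun y hy => by rw [s y hy, zero_mul]
    have j3 : Integrable (fun y => F y * G1 y) := int_of_supp (by fun_prop) R fun y hy => by rw [s y hy, zero_mul]
    have e := lin3 hz 1 1 (-1) j1 j2 j3 (fun y => by ring)
    have e3 : ∫ y, F y * G1 (y + t • ee 1) = ∫ y, F (y - t • ee 1) * G1 y := by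
      rw [← integral_add_right_eq_self (fun y => F (y - t • ee 1) * G1 y) (t • ee 1)]
      simp
    have j4 : Integrable (fun y => F (y - t • ee 1) * G1 y) := by
      have := j2.comp_sub_right (t • ee 1)
      simpa using this
    have e4 : ∫ y, (n + 1 : ℝ) * (F (-(y + t • ee 1)) - F (-y)) * G1 (-y) = ∫ y, (n + 1 : ℝ) * (F (y - t • ee 1) - F y) * G1 y := by
      rw [← integral_neg_eq_self (fun y => (n + 1 : ℝ) * (F (y - t • ee 1) - F y) * G1 y) volume]
      refine integral_congr_ae (Eventually.of_forall fun y => ?_)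
      simp only; rw [neg_add, ← sub_eq_add_neg (-y)]
    have e5 : ∫ y, (n + 1 : ℝ) * (F (y - t • ee 1) - F y) * G1 y = (n+1:ℝ) * ((∫ y, F (y - t • ee 1) * G1 y) - ∫ y, F y * G1 y) := by
      rw [← integral_sub j4 j3, ← integral_const_mul]
      refine integral_congr_ae (Eventually.of_forall fun y => ?_)
      simp only; ring
    have e6 : ∫ y, (n + 1 : ℝ) * (G (y + t • ee 1) - G y) * F1 y = (n+1:ℝ) * ∫ y, F1 y * (G (y + t • ee 1) - G y) := by
      rw [← integral_const_mul]
      refine integral_congr_ae (Eventually.of_forall fun y => ?_)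
      simp only; ring
    rw [e4, e5, e6]
    linear_combination (n+1:ℝ) * e - (n+1:ℝ) * e3
  have L3 := L2.neg
  simp only [neg_neg] at L3
  have := tendsto_nhds_unique (L1.congr key) L3
  rw [← this]
  exact integral_congr_ae (Eventually.of_forall fun y => mul_comm _ _)
end jac

lemma kk (y : E2) : kap y * (1 + (y 0)^2 + (y 1)^2) = 1 := inv_mul_cancel₀ (rho_pos y).ne'

def sg (n : ℝ) (y : E2) : ℝ := (n + (y 0)^2 + (y 1)^2)⁻¹
lemma sg_k {n : ℝ} (hn : 1 ≤ n) (y : E2) : sg n y * (n + (y 0)^2 + (y 1)^2) = 1 := inv_mul_cancel₀ (by positivity)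
lemma sg_pos {n : ℝ} (hn : 1 ≤ n) (y : E2) : 0 < sg n y := by unfold sg; positivity
lemma sg_le {n : ℝ} (hn : 1 ≤ n) (y : E2) : sg n y ≤ kap y := by
  unfold sg kap rho; gcongr
lemma sg_le1 {n : ℝ} (hn : 1 ≤ n) (y : E2) : n * sg n y ≤ 1 := by
  have := sg_k hn y
  have := sg_pos hn y
  nlinarith [mul_nonneg this.le (sq_nonneg (y 0)), mul_nonneg this.le (sq_nonneg (y 1))]
lemma sg_y {n : ℝ} (hn : 1 ≤ n) (y : E2) : sg n y * ((y 0)^2 + (y 1)^2) ≤ 1 := by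
  have := sg_k hn y
  have := sg_pos hn y
  nlinarith
lemma cont_sg {n : ℝ} (hn : 1 ≤ n) : Continuous (sg n) := by
  unfold sg; exact Continuous.inv₀ (by fun_prop) (fun y => by positivity)
lemma HD_sg {n : ℝ} (hn : 1 ≤ n) (i : Fin 2) : HD i (sg n) (fun y => -2 * y i * sg n y ^ 2) := by
  have h : HD i (fun y => (n - 1) + rho y) (fun y => 0 + 2 * y i) := (HD.const (n-1)).add (HD_rho i)
  have h2 := h.inv (fun y => by have := rho_pos y; have : 0 < n - 1 + rho y := by linarith
                                exact this.ne')
  have e : (fun y : E2 => (n - 1 + rho y)⁻¹) = sg n := by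
    funext y; unfold sg rho; congr 1; ring
  rw [e] at h2
  refine h2.congr' fun y => ?_
  have : n - 1 + rho y = (sg n y)⁻¹ := by unfold sg rho; rw [inv_inv]; ring
  rw [this]; field_simp; ring

lemma Cd_sg {n : ℝ} (hn : 1 ≤ n) : Cd (-2) (sg n) (fun y => -2 * y 0 * sg n y ^ 2) (fun y => -2 * y 1 * sg n y ^ 2) := by
  have hk : ∀ y, rho y ^ (-2:ℤ) = kap y^2 := fun y => by unfold kap; rw [zpow_neg, inv_pow]; norm_cast
  have hc := cont_sg hn
  have h2 : ∀ y, sg n y^2 ≤ kap y^2 := fun y => by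
    have := sg_pos hn y
    have := sg_le hn y
    gcongr
  refine ⟨HD_sg hn 0, HD_sg hn 1, ⟨hc, 1, fun y => ?_⟩, ⟨by fun_prop, 4, fun y => ?_⟩, ⟨by fun_prop, 4, fun y => ?_⟩⟩
  · rw [hk, one_mul]; exact h2 y
  all_goals
    rw [hk]
    have a := sg_y hn y
    have p := sg_pos hn y
    have l1 : sg n y ≤ 1 := by nlinarith [sg_le1 hn y]
    have b0 : sg n y * (y 0)^2 ≤ 1 := by nlinarith [mul_nonneg p.le (sq_nonneg (y 1))]
    have b1 : sg n y * (y 1)^2 ≤ 1 := by nlinarith [mul_nonneg p.le (sq_nonneg (y 0))]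
  · calc _ = 4 * (sg n y^2 * (sg n y * (sg n y * (y 0)^2))) := by ring
      _ ≤ 4 * (kap y^2 * (1 * 1)) := by have := h2 y; gcongr
      _ = _ := by ring
  · calc _ = 4 * (sg n y^2 * (sg n y * (sg n y * (y 1)^2))) := by ring
      _ ≤ 4 * (kap y^2 * (1 * 1)) := by have := h2 y; gcongr
      _ = _ := by ring

lemma hess_L2 {P1 Q11 Q12 Q22 q q' q'' ε : E2 → ℝ} (hP : DD (-1) P1 Q11 Q12) (h22 : DD (-1) Q22 q q') (h12 : DD (-1) Q12 q'' q)
    (he : M 0 ε) (htr : ∀ y, Q11 y + Q22 y = - ε y) : Integrable (fun y => Q11 y^2 + 2 * Q12 y^2 + Q22 y^2) := by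
  have iE := he.int_sq le_rfl
  have c11 := hP.m1.1
  have c12 := hP.m2.1
  have c22 := h22.m.1
  have iP : Integrable (fun y => kap y * P1 y^2) :=
    ((hP.m.coef Cf.kap).int hP.m (by norm_num)).congr (Filter.Eventually.of_forall fun y => by ring)
  have main : ∀ n : ℝ, 1 ≤ n → Integrable (fun y => n * sg n y * (Q11 y^2 + 2 * Q12 y^2 + Q22 y^2)) ∧
      ∫ y, n * sg n y * (Q11 y^2 + 2 * Q12 y^2 + Q22 y^2) ≤ 2 * (∫ y, ε y^2) + 16 * ∫ y, kap y * P1 y^2 := by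
    intro n hn
    have cs := Cd_sg hn
    have i1 : Integrable (fun y => n * sg n y * (Q11 y^2 + 2 * Q12 y^2 + Q22 y^2)) := by
      have a := (hP.m1.coef cs.m).int hP.m1 (by norm_num)
      have b := (hP.m2.coef cs.m).int hP.m2 (by norm_num)
      have c := (h22.m.coef cs.m).int h22.m (by norm_num)
      refine (((a.add (b.const_mul 2)).add c).const_mul n).congr (Filter.Eventually.of_forall fun y => ?_)
      simp only [Pi.add_apply]; ring
    refine ⟨i1, ?_⟩
    have z1 := (DD.coef cs hP).Z1 h22 (by norm_num)
    have z2 := (DD.coef cs hP).Z2 h12 (by norm_num)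
    have z := z1.sub z2
    have := le4 2 (-4*n) 16 0 i1 iE z.1 iP iP (fun y => by
      have p := sg_pos hn y
      have tr := htr y
      have e : ε y = -(Q11 y + Q22 y) := by linarith
      have l1 := sg_le1 hn y
      have y1 := sg_y hn y
      have hk := sg_le hn y
      have hkp := (kap_pos y).le
      simp only [e]
      set s := sg n y
      have hs : 0 ≤ n * s := by positivity
      -- Young
      have t1 : 0 ≤ n * s * ((1/2) * (Q22 y - 4 * (-2 * y 0 * s * P1 y)/2)^2 + (1/2) * (Q12 y + 4 * (-2 * y 1 * s * P1 y)/2)^2) := by positivity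
      have t2 : n * s * (8 * (s * (s * ((y 0)^2 + (y 1)^2))) * P1 y^2) ≤ 1 * (8 * (kap y * 1) * P1 y^2) := by gcongr
      have t3 : n * s * (Q11 y + Q22 y)^2 ≤ 1 * (Q11 y + Q22 y)^2 := by gcongr
      have t4 : 0 ≤ n * s * (Q11 y^2 + Q12 y^2) := by positivity
      nlinarith)
    rw [z.2] at this
    linarith
  refine (aecover_closedBall (μ := (volume : Measure E2)) (x := 0) (r := fun m : ℕ => (m:ℝ)) tendsto_natCast_atTop_atTop).integrable_of_integral_bounded_of_nonneg_ae
    (2 * (2 * (∫ y, ε y^2) + 16 * ∫ y, kap y * P1 y^2)) (fun m => ?_) (Filter.Eventually.of_forall fun y => by positivity) (Filter.Eventually.of_forall fun m => ?_)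
  · exact ContinuousOn.integrableOn_compact (isCompact_closedBall _ _) (by fun_prop)
  · obtain ⟨i, hi⟩ := main ((m:ℝ)^2+1) (by nlinarith [sq_nonneg (m:ℝ)])
    have h1 : (1:ℝ) ≤ (m:ℝ)^2+1 := by nlinarith [sq_nonneg (m:ℝ)]
    refine le_trans ?_ (mul_le_mul_of_nonneg_left hi (by norm_num))
    rw [← integral_const_mul]
    refine le_trans (setIntegral_mono_on (ContinuousOn.integrableOn_compact (isCompact_closedBall _ _) (by fun_prop)) (i.const_mul 2).integrableOn measurableSet_closedBall (fun y hy => ?_)) (setIntegral_le_integral (i.const_mul 2) (Filter.Eventually.of_forall fun y => ?_))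
    · rw [mem_closedBall_zero_iff] at hy
      have : (y 0)^2 + (y 1)^2 ≤ (m:ℝ)^2 := by
        have h3 := rho_eq y
        have : ‖y‖^2 ≤ (m:ℝ)^2 := by gcongr
        unfold rho at h3; linarith
      have hs := sg_k h1 y
      have hp := sg_pos h1 y
      have : 1 ≤ 2 * (((m:ℝ)^2+1) * sg ((m:ℝ)^2+1) y) := by nlinarith
      have q : 0 ≤ Q11 y^2 + 2 * Q12 y^2 + Q22 y^2 := by positivity
      nlinarith
    · have hp := sg_pos h1 y
      simp only [Pi.zero_apply]
      positivity

lemma M_supp {f : E2 → ℝ} (hc : Continuous f) (R : ℝ) (h : ∀ y, R < ‖y‖ → f y = 0) (k : ℤ) : M k f :=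
  ⟨hc, int_of_supp ((cont_rho_zpow k).mul (hc.pow 2)) R fun y hy => by rw [h y hy]; simp⟩

lemma horm_c {s s1 s2 t t1 t2 : E2 → ℝ} (d1 : HD 0 s s1) (d2 : HD 1 s s2) (e1 : HD 0 t t1) (e2 : HD 1 t t2)
    (c : Continuous s) (c1 : Continuous s1) (c2 : Continuous s2) (b : Continuous t) (b1 : Continuous t1) (b2 : Continuous t2)
    (R : ℝ) (hs : ∀ y, R < ‖y‖ → s y = 0) (hs1 : ∀ y, R < ‖y‖ → s1 y = 0) (hs2 : ∀ y, R < ‖y‖ → s2 y = 0)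
    (ht : ∀ y, R < ‖y‖ → t y = 0) (ht1 : ∀ y, R < ‖y‖ → t1 y = 0) (ht2 : ∀ y, R < ‖y‖ → t2 y = 0) :
    4 * ∫ y, kap y * (s y^2 + t y^2) ≤ ∫ y, rho y * ((s1 y + t2 y)^2 + (s2 y - t1 y)^2) := by
  have ds : DD 4 s s1 s2 := ⟨d1, d2, M_supp c R hs 4, M_supp c1 R hs1 4, M_supp c2 R hs2 4⟩
  have dt : DD 4 t t1 t2 := ⟨e1, e2, M_supp b R ht 4, M_supp b1 R ht1 4, M_supp b2 R ht2 4⟩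
  have j := jacobian (R := R) ((HD_rho 0).mul d1) ((HD_rho 1).mul d2) e1 e2 (by fun_prop) (by fun_prop) (by fun_prop) b b1 b2
    (fun y hy => by rw [hs y hy]; ring) (fun y hy => by rw [hs y hy, hs1 y hy]; ring) (fun y hy => by rw [hs y hy, hs2 y hy]; ring)
  have z1 := ((DD.coef Cd.y0 ds).Z1 ds (by norm_num)).add ((DD.coef Cd.y0 dt).Z1 dt (by norm_num))
  have z2 := ((DD.coef Cd.y1 ds).Z2 ds (by norm_num)).add ((DD.coef Cd.y1 dt).Z2 dt (by norm_num))
  have z3 := ((DD.coef Cd.y1 ds).Z1 dt (by norm_num)).sub ((DD.coef Cd.y0 ds).Z2 dt (by norm_num))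
  have z := ((j.cmul 4).sub ((z1.add z2).cmul 2)).add (z3.cmul 4)
  have i1 : Integrable (fun y => kap y * (s y^2 + t y^2)) := int_of_supp (by fun_prop) R fun y hy => by rw [hs y hy, ht y hy]; simp
  have i2 : Integrable (fun y => rho y * ((s1 y + t2 y)^2 + (s2 y - t1 y)^2)) := int_of_supp (by fun_prop) R fun y hy => by rw [hs1 y hy, ht2 y hy, hs2 y hy, ht1 y hy]; simp
  have := le2 (1/4) (-1/4) i1 i2 z.1 (fun y => by
    have hk := kk y
    have hp := rho_pos y
    have sq : 0 ≤ rho y * ((s1 y - t2 y + 2 * kap y * (y 0 * s y - y 1 * t y))^2 + (t1 y + s2 y + 2 * kap y * (y 0 * t y + y 1 * s y))^2) := by positivity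
    unfold rho at *
    set k := kap y
    have key : (1 + y 0^2+y 1^2) * ((s1 y - t2 y + 2 * k * (y 0 * s y - y 1 * t y))^2 + (t1 y + s2 y + 2 * k * (y 0 * t y + y 1 * s y))^2)
      = (1 + y 0^2+y 1^2) * ((s1 y + t2 y)^2 + (s2 y - t1 y)^2) - 4 * k * (s y^2 + t y^2) -
       (4 * ((2 * y 0 * s y + (1 + y 0^2+y 1^2) * s1 y) * t2 y - (2 * y 1 * s y + (1 + y 0^2+y 1^2) * s2 y) * t1 y)
        - 2 * (((1 * s y + y 0 * s1 y) * s y + y 0 * s y * s1 y + ((1 * t y + y 0 * t1 y) * t y + y 0 * t y * t1 y)) +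
          ((1 * s y + y 1 * s2 y) * s y + y 1 * s y * s2 y + ((1 * t y + y 1 * t2 y) * t y + y 1 * t y * t2 y)))
        + 4 * (((0 * s y + y 1 * s1 y) * t y + y 1 * s y * t1 y) - ((0 * s y + y 0 * s2 y) * t y + y 0 * s y * t2 y))) := by
      linear_combination (4 * ((y 0 * s y - y 1 * t y) * (s1 y - t2 y) + (y 0 * t y + y 1 * s y) * (t1 y + s2 y)) + 4 * k * (y 0^2+y 1^2)*(s y^2+t y^2) + 4 * (s y^2 + t y^2)) * hk
    rw [key] at sq
    linarith)
  rw [z.2] at this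
  linarith

section cut
open Filter Topology
def mx (x : ℝ) : ℝ := max 0 x
lemma mx_nonneg (x : ℝ) : 0 ≤ mx x := le_max_left _ _
@[fun_prop] lemma cont_mx : Continuous mx := by unfold mx; fun_prop
lemma mx_deriv (x : ℝ) : HasDerivAt (fun x => mx x ^ 2) (2 * mx x) x := by
  rcases lt_trichotomy x 0 with h | h | h
  · have : mx x = 0 := max_eq_left h.le
    rw [this, mul_zero]
    refine (hasDerivAt_const x (0:ℝ)).congr_of_eventuallyEq ?_
    filter_upwards [Iio_mem_nhds h] with z hz
    have : mx z = 0 := max_eq_left (le_of_lt hz)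
    rw [this]; simp
  · subst h
    have e : mx 0 = 0 := by simp [mx]
    rw [e, mul_zero, hasDerivAt_iff_isLittleO]
    simp only [e, sub_zero, smul_zero]
    have : (fun x : ℝ => x^2) =o[𝓝 0] fun x => x := by
      simpa using Asymptotics.isLittleO_pow_pow (𝕜 := ℝ) (m := 1) (n := 2) (by norm_num)
    refine Asymptotics.IsBigO.trans_isLittleO ?_ this
    refine Asymptotics.IsBigO.of_bound 1 (Eventually.of_forall fun z => ?_)
    have : mx z^2 ≤ z^2 := by
      unfold mx; rcases le_total 0 z with h | h
      · rw [max_eq_right h]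
      · rw [max_eq_left h]; nlinarith
    simp only [zero_pow (two_ne_zero), sub_zero, one_mul, norm_pow, Real.norm_eq_abs, sq_abs]; exact this
  · have : mx x = x := max_eq_right h.le
    rw [this]
    have h2 : HasDerivAt (fun x : ℝ => x^2) (2 * x) x := by simpa using hasDerivAt_pow 2 x
    refine h2.congr_of_eventuallyEq ?_
    filter_upwards [Ioi_mem_nhds h] with z hz
    have : mx z = z := max_eq_right (le_of_lt hz)
    rw [this]

def ct (n : ℝ) (y : E2) : ℝ := mx (1 - n⁻¹ * ((y 0)^2 + (y 1)^2))
@[fun_prop] lemma cont_ct (n : ℝ) : Continuous (ct n) := by unfold ct; fun_prop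
lemma HD_ct (n : ℝ) (i : Fin 2) : HD i (fun y => ct n y ^ 2) (fun y => -4 * n⁻¹ * y i * ct n y) := by
  have h : HD i (fun y => 1 - n⁻¹ * ((y 0)^2 + (y 1)^2)) (fun y => - (n⁻¹ * (2 * y i))) := by
    have := ((HD.const (1 + n⁻¹)).sub ((HD_rho i).cmul n⁻¹))
    have e : (fun y : E2 => 1 + n⁻¹ - n⁻¹ * rho y) = fun y => 1 - n⁻¹ * ((y 0)^2 + (y 1)^2) := by
      funext y; unfold rho; ring
    rw [e] at this
    exact this.congr' fun y => by ring
  intro y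
  have a := h y
  unfold HasLineDerivAt at *
  have b := HasDerivAt.comp (h₂ := fun x => mx x^2) (h := fun t : ℝ => 1 - n⁻¹ * (((y + t • ee i) 0)^2 + ((y + t • ee i) 1)^2)) 0 (mx_deriv _) a
  simp only [zero_smul, add_zero] at b
  have e : -4 * n⁻¹ * y i * ct n y = 2 * mx (1 - n⁻¹ * (y 0 ^ 2 + y 1 ^ 2)) * -(n⁻¹ * (2 * y i)) := by unfold ct; ring
  beta_reduce; rw [e]; exact b
lemma ct_nonneg (n : ℝ) (y : E2) : 0 ≤ ct n y := mx_nonneg _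
lemma ct_le {n : ℝ} (hn : 0 < n) (y : E2) : ct n y ≤ 1 := by
  unfold ct mx; refine max_le (by norm_num) ?_
  have : 0 ≤ n⁻¹ * (y 0 ^ 2 + y 1 ^ 2) := by positivity
  linarith
lemma ct_zero {n : ℝ} (hn : 0 < n) (y : E2) (h : n ≤ (y 0)^2 + (y 1)^2) : ct n y = 0 := by
  unfold ct mx; refine max_eq_left ?_
  have : n⁻¹ * n ≤ n⁻¹ * (y 0 ^ 2 + y 1 ^ 2) := by gcongr
  rw [inv_mul_cancel₀ hn.ne'] at this; linarith
lemma ct_grad {n : ℝ} (hn : 1 ≤ n) (y : E2) : rho y * ((-4 * n⁻¹ * y 0 * ct n y)^2 + (-4 * n⁻¹ * y 1 * ct n y)^2) ≤ 32 := by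
  rcases le_total n ((y 0)^2 + (y 1)^2) with h | h
  · rw [ct_zero (by linarith) y h]; simp
  · have h0 := ct_nonneg n y
    have h1 := ct_le (by linarith : 0 < n) y
    have hi : 0 < n⁻¹ := by positivity
    have a : n⁻¹ * ((y 0)^2 + (y 1)^2) ≤ 1 := by
      have : n⁻¹ * ((y 0)^2 + (y 1)^2) ≤ n⁻¹ * n := by gcongr
      rwa [inv_mul_cancel₀ (by linarith)] at this
    have b : n⁻¹ * rho y ≤ 2 := by
      have : n⁻¹ ≤ 1 := inv_le_one_of_one_le₀ hn
      unfold rho; linarith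
    have hr := rho_pos y
    calc _ = 16 * (n⁻¹ * rho y) * (n⁻¹ * ((y 0)^2 + (y 1)^2)) * (ct n y^2) := by ring
      _ ≤ 16 * 2 * 1 * 1^2 := by gcongr
      _ = 32 := by norm_num

lemma ct_lim (y : E2) : Tendsto (fun n : ℕ => ct ((n:ℝ)+1) y) atTop (𝓝 1) := by
  have h : Tendsto (fun n : ℕ => ((n:ℝ)+1)⁻¹) atTop (𝓝 0) := by simpa using tendsto_one_div_add_atTop_nhds_zero_nat (𝕜 := ℝ)
  have h2 : Tendsto (fun n : ℕ => mx (1 - ((n:ℝ)+1)⁻¹ * ((y 0)^2 + (y 1)^2))) atTop (𝓝 (mx (1 - 0 * ((y 0)^2 + (y 1)^2)))) :=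
    (cont_mx.tendsto _).comp ((h.mul_const _).const_sub 1)
  have e : mx (1 - 0 * ((y 0)^2 + (y 1)^2)) = 1 := by simp [mx]
  rw [e] at h2; exact h2

lemma horm {S S1 S2 T T1 T2 : E2 → ℝ} (d1 : HD 0 S S1) (d2 : HD 1 S S2) (e1 : HD 0 T T1) (e2 : HD 1 T T2)
    (c1 : Continuous S1) (c2 : Continuous S2) (b1 : Continuous T1) (b2 : Continuous T2)
    (mS : M 0 S) (mT : M 0 T) (iPQ : Integrable (fun y => rho y * ((S1 y + T2 y)^2 + (S2 y - T1 y)^2))) :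
    2 * ∫ y, kap y * (S y^2 + T y^2) ≤ ∫ y, rho y * ((S1 y + T2 y)^2 + (S2 y - T1 y)^2) := by
  have c := mS.1
  have b := mT.1
  have iST : Integrable (fun y => S y^2 + T y^2) := (mS.int_sq le_rfl).add (mT.int_sq le_rfl)
  have nST : ∀ y, 0 ≤ S y^2 + T y^2 := fun y => by positivity
  have step : ∀ n : ℕ, 4 * ∫ y, kap y * (ct ((n:ℝ)+1) y^4 * (S y^2 + T y^2)) ≤ 2 * (∫ y, rho y * ((S1 y + T2 y)^2 + (S2 y - T1 y)^2))
      + 2 * ∫ y, rho y * ((-4 * ((n:ℝ)+1)⁻¹ * y 0 * ct ((n:ℝ)+1) y)^2 + (-4 * ((n:ℝ)+1)⁻¹ * y 1 * ct ((n:ℝ)+1) y)^2) * (S y^2 + T y^2) := by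
    intro n
    have hn : (1:ℝ) ≤ (n:ℝ)+1 := by linarith [(Nat.cast_nonneg n : (0:ℝ) ≤ n)]
    set N : ℝ := (n:ℝ)+1
    have h0 : ∀ y : E2, N < ‖y‖ → ct N y = 0 := fun y hy => ct_zero (by linarith) y (by
      have := rho_eq y; unfold rho at this
      nlinarith)
    have key := horm_c ((HD_ct N 0).mul d1) ((HD_ct N 1).mul d2) ((HD_ct N 0).mul e1) ((HD_ct N 1).mul e2)
      (by fun_prop) (by fun_prop) (by fun_prop) (by fun_prop) (by fun_prop) (by fun_prop) N
      (fun y hy => by rw [h0 y hy]; ring) (fun y hy => by rw [h0 y hy]; ring) (fun y hy => by rw [h0 y hy]; ring)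
      (fun y hy => by rw [h0 y hy]; ring) (fun y hy => by rw [h0 y hy]; ring) (fun y hy => by rw [h0 y hy]; ring)
    have ee1 : ∫ y, kap y * (ct N y^4 * (S y^2 + T y^2)) = ∫ y, kap y * ((ct N y ^ 2 * S y)^2 + (ct N y ^ 2 * T y)^2) :=
      integral_congr_ae (Eventually.of_forall fun y => by simp only; ring)
    rw [ee1]
    refine key.trans ?_
    refine le2 2 2 ?_ iPQ ?_ ?_
    · exact int_of_supp (by fun_prop) N (fun y hy => by rw [h0 y hy]; ring)
    · exact int_of_supp (by fun_prop) N (fun y hy => by rw [h0 y hy]; ring)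
    · intro y
      have hr := (rho_pos y).le
      have g0 := ct_nonneg N y
      have g1 := ct_le (by linarith : 0 < N) y
      simp only
      set u := -4 * N⁻¹ * y 0 * ct N y
      set v := -4 * N⁻¹ * y 1 * ct N y
      set x := ct N y
      have hx : x^4 ≤ 1 := pow_le_one₀ g0 g1
      have q1 : (u * S y + x^2 * S1 y + (v * T y + x^2 * T2 y))^2 + (v * S y + x^2 * S2 y - (u * T y + x^2 * T1 y))^2
        ≤ 2 * ((S1 y + T2 y)^2 + (S2 y - T1 y)^2) + 2 * ((u^2 + v^2) * (S y^2 + T y^2)) := by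
        have t : x^4 * ((S1 y + T2 y)^2 + (S2 y - T1 y)^2) ≤ 1 * ((S1 y + T2 y)^2 + (S2 y - T1 y)^2) := by gcongr
        nlinarith [sq_nonneg (u * S y + v * T y - x^2 * (S1 y + T2 y)), sq_nonneg (v * S y - u * T y - x^2 * (S2 y - T1 y))]
      nlinarith [mul_le_mul_of_nonneg_left q1 hr]
  have L1 : Tendsto (fun n : ℕ => ∫ y, kap y * (ct ((n:ℝ)+1) y^4 * (S y^2 + T y^2))) atTop (𝓝 (∫ y, kap y * (1^4 * (S y^2 + T y^2)))) := by
    refine tendsto_integral_of_dominated_convergence (fun y => S y^2 + T y^2) (fun n => Continuous.aestronglyMeasurable (by fun_prop)) iST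
      (fun n => Eventually.of_forall fun y => ?_) (Eventually.of_forall fun y => ?_)
    · have g0 := ct_nonneg ((n:ℝ)+1) y
      have g1 := ct_le (by positivity : 0 < (n:ℝ)+1) y
      have := kap_pos y
      have hk := kap_le y
      have := nST y
      rw [Real.norm_eq_abs, abs_of_nonneg (by positivity)]
      calc _ ≤ 1 * (1^4 * (S y^2 + T y^2)) := by gcongr
        _ = _ := by ring
    · exact ((((ct_lim y).pow 4).mul_const _).const_mul _)
  have L2 : Tendsto (fun n : ℕ => ∫ y, rho y * ((-4 * ((n:ℝ)+1)⁻¹ * y 0 * ct ((n:ℝ)+1) y)^2 + (-4 * ((n:ℝ)+1)⁻¹ * y 1 * ct ((n:ℝ)+1) y)^2) * (S y^2 + T y^2)) atTop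
     (𝓝 (∫ y : E2, rho y * ((-4 * 0 * y 0 * 1)^2 + (-4 * 0 * y 1 * 1)^2) * (S y^2 + T y^2))) := by
    refine tendsto_integral_of_dominated_convergence (fun y => 32 * (S y^2 + T y^2)) (fun n => Continuous.aestronglyMeasurable (by fun_prop)) (iST.const_mul 32)
      (fun n => Eventually.of_forall fun y => ?_) (Eventually.of_forall fun y => ?_)
    · have := ct_grad (by linarith [(Nat.cast_nonneg n : (0:ℝ) ≤ n)] : 1 ≤ (n:ℝ)+1) y
      have hr := rho_pos y
      have h2 := nST y
      rw [Real.norm_eq_abs, abs_of_nonneg (by positivity)]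
      gcongr
    · have h : Tendsto (fun n : ℕ => ((n:ℝ)+1)⁻¹) atTop (𝓝 0) := by simpa using tendsto_one_div_add_atTop_nhds_zero_nat (𝕜 := ℝ)
      have h2 := ct_lim y
      exact (((((h.const_mul (-4)).mul_const _).mul h2).pow 2).add ((((h.const_mul (-4)).mul_const _).mul h2).pow 2)).const_mul _ |>.mul_const _
  have := le_of_tendsto_of_tendsto' (L1.const_mul 4) ((L2.const_mul 2).const_add (2 * (∫ y, rho y * ((S1 y + T2 y)^2 + (S2 y - T1 y)^2)))) step
  simp only [one_pow, one_mul, mul_zero, zero_mul, zero_pow two_ne_zero, add_zero, integral_zero] at this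
  linarith
end cut

lemma Cdk3 : Cd (-6) (fun y => kap y * kap y * kap y) (fun y => -6 * y 0 * kap y^4) (fun y => -6 * y 1 * kap y^4) :=
  (((Cd.kap.mul Cd.kap).mul Cd.kap).mono (by norm_num)).congr' (fun y => by ring) (fun y => by ring)

lemma Cf.kpow (n : ℕ) : Cf (-2 * n) (fun y => _root_.kap y ^ n) := by
  induction n with
  | zero => simpa using Cf.const 1
  | succ n ih => exact ((ih.mul Cf.kap).mono (by push_cast; linarith)).congr fun y => by ring

lemma M.int_k {k : ℤ} {f g : E2 → ℝ} (hf : M k f) (hg : M k g) (n : ℕ) (h : 0 ≤ k + n) : Integrable (fun y => kap y ^ n * (f y * g y)) :=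
  ((hf.coef (Cf.kpow n)).int hg (by linarith)).congr (Filter.Eventually.of_forall fun y => by ring)

lemma energy {w w1 w2 w11 w12 w22 : E2 → ℝ} (hw : DD (-3) w w1 w2) (h1 : DD (-2) w1 w11 w12) (h2 : DD (-2) w2 w12 w22) :
    ∃ c, (∫ y, kap y^3 * (w1 y^2 + w2 y^2)) ≤ 17290 * (∫ y, kap y^2 * (w11 y + w22 y - 4 * kap y * (y 0 * w1 y + y 1 * w2 y))^2) ∧
      ∫ y, kap y^4 * (w y - c)^2 ≤ 1729 * ∫ y, kap y^3 * (w1 y^2 + w2 y^2) := by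
  obtain ⟨c, hc⟩ := poincare hw
  refine ⟨c, ?_, hc⟩
  set G : E2 → ℝ := fun y => w11 y + w22 y - 4 * kap y * (y 0 * w1 y + y 1 * w2 y) with hG
  have mR : M (-3) (fun y => y 0 * w1 y + y 1 * w2 y) := (h1.m.coef (Cf.coord 0)).add (h2.m.coef (Cf.coord 1))
  have mT : M (-3) (fun y => y 0 * w2 y - y 1 * w1 y) := (h2.m.coef (Cf.coord 0)).sub (h1.m.coef (Cf.coord 1))
  have mG : M (-2) G := (((h1.m1.add h2.m2).sub ((((mR.coef Cf.kap).cmul 4).mono (by norm_num))))).congr fun y => by simp only [hG]; ring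
  have hg : DD (-3) (fun y => w y - c) w1 w2 := (hw.sub ((DD_const c).mono (by norm_num))).congr (fun y => rfl) (fun y => by simp) (fun y => by simp)
  have iG : Integrable (fun y => kap y^2 * G y^2) := (mG.int_k mG 2 (by norm_num)).congr (Filter.Eventually.of_forall fun y => by ring)
  have iR : Integrable (fun y => kap y^4 * ((y 0 * w1 y + y 1 * w2 y)^2 + (y 0 * w2 y - y 1 * w1 y)^2)) := by
    refine ((mR.int_k mR 4 (by norm_num)).add (mT.int_k mT 4 (by norm_num))).congr (Filter.Eventually.of_forall fun y => ?_)
    simp only [Pi.add_apply]; ring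
  have iW : Integrable (fun y => kap y^3 * (w1 y^2 + w2 y^2)) := by
    refine ((h1.m.int_k h1.m 3 (by norm_num)).add (h2.m.int_k h2.m 3 (by norm_num))).congr (Filter.Eventually.of_forall fun y => ?_)
    simp only [Pi.add_apply]; ring
  have it : Integrable (fun y => kap y^4 * (w y - c)^2) := (hg.m.int_k hg.m 4 (by norm_num)).congr (Filter.Eventually.of_forall fun y => by ring)
  -- Pohozaev
  have k30 := Cdk3.mul Cd.y0
  have k31 := Cdk3.mul Cd.y1
  have p1 := ((DD.coef k30 h1).Z1 h1 (by norm_num)).cmul (1/2)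
  have p2 := (DD.coef k31 h2).Z1 h1 (by norm_num)
  have p3 := ((DD.coef k30 h2).Z1 h2 (by norm_num)).cmul (1/2)
  have p4 := (DD.coef k30 h1).Z2 h2 (by norm_num)
  have p5 := ((DD.coef k31 h2).Z2 h2 (by norm_num)).cmul (1/2)
  have p6 := ((DD.coef k31 h1).Z2 h1 (by norm_num)).cmul (1/2)
  have p := ((p1.add p2).sub p3).add ((p4.add p5).sub p6)
  have p' := p.congr (g := fun y => kap y^3 * (y 0 * w1 y + y 1 * w2 y) * G y + kap y^4 * ((y 0 * w1 y + y 1 * w2 y)^2 + 3 * (y 0 * w2 y - y 1 * w1 y)^2)) (fun y => by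
    simp only [hG]; ring)
  have K1 := le2 2 1 iR p'.1 iG (fun y => by
    nlinarith [sq_nonneg (kap y * G y + kap y^2 * (y 0 * w1 y + y 1 * w2 y)), sq_nonneg (kap y^2 * (y 0 * w2 y - y 1 * w1 y))])
  rw [p'.2] at K1
  -- testing
  have q1 := (DD.coef Cdk3 hg).Z1 h1 (by norm_num)
  have q2 := (DD.coef Cdk3 hg).Z2 h2 (by norm_num)
  have q := (q1.add q2).congr (g := fun y => kap y^3 * (w1 y^2 + w2 y^2) + kap y^3 * (w y - c) * G y - 2 * kap y^4 * (y 0 * w1 y + y 1 * w2 y) * (w y - c)) (fun y => by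
    simp only [hG]; ring)
  have K2 := le4 1 (2/6916) (6916/4) 6916 iW q.1 it iG iR (fun y => by
    nlinarith [sq_nonneg (kap y^2 * (w y - c) + 6916/2 * (kap y * G y)), sq_nonneg (kap y^2 * (w y - c) - 6916 * (kap y^2 * (y 0 * w1 y + y 1 * w2 y))), sq_nonneg (kap y^2 * (y 0 * w2 y - y 1 * w1 y))])
  rw [q.2] at K2
  linarith

lemma STineq {P1 P2 Q11 Q12 Q22 q111 q112 q122 q222 ε ε1 ε2 w1 w2 : E2 → ℝ}
    (hP1 : DD (-1) P1 Q11 Q12) (hP2 : DD (-1) P2 Q12 Q22) (h11 : DD (-1) Q11 q111 q112) (h12 : DD (-1) Q12 q112 q122) (h22 : DD (-1) Q22 q122 q222)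
    (he : M 0 ε) (tr : ∀ y, Q11 y + Q22 y = - ε y) (tr1 : ∀ y, q111 y + q122 y = - ε1 y) (tr2 : ∀ y, q112 y + q222 y = - ε2 y)
    (e1 : ∀ y, 8 * kap y^2 * w1 y = ε1 y + 4 * kap y * y 0 * ε y - 8 * kap y^2 * P1 y)
    (e2 : ∀ y, 8 * kap y^2 * w2 y = ε2 y + 4 * kap y * y 1 * ε y - 8 * kap y^2 * P2 y)
    (mw1 : M (-2) w1) (mw2 : M (-2) w2) :
    M 0 (fun y => Q11 y - Q22 y + 4 * (kap y * (y 0 * P1 y - y 1 * P2 y))) ∧ M 0 (fun y => 2 * Q12 y + 4 * (kap y * (y 0 * P2 y + y 1 * P1 y))) ∧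
    ∫ y, kap y * ((Q11 y - Q22 y + 4 * (kap y * (y 0 * P1 y - y 1 * P2 y)))^2 + (2 * Q12 y + 4 * (kap y * (y 0 * P2 y + y 1 * P1 y)))^2) ≤ 32 * ∫ y, kap y^3 * (w1 y^2 + w2 y^2) := by
  have H := hess_L2 hP1 h22 h12 he tr
  have m11 : M 0 Q11 := ⟨h11.m.1, integrable_of_le (by have := h11.m.1; simp only [zpow_zero, one_mul]; fun_prop) H fun y => by
    rw [zpow_zero, one_mul, abs_of_nonneg (sq_nonneg _)]; nlinarith [sq_nonneg (Q12 y), sq_nonneg (Q22 y)]⟩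
  have m12 : M 0 Q12 := ⟨h12.m.1, integrable_of_le (by have := h12.m.1; simp only [zpow_zero, one_mul]; fun_prop) H fun y => by
    rw [zpow_zero, one_mul, abs_of_nonneg (sq_nonneg _)]; nlinarith [sq_nonneg (Q12 y), sq_nonneg (Q22 y), sq_nonneg (Q11 y)]⟩
  have m22 : M 0 Q22 := ⟨h22.m.1, integrable_of_le (by have := h22.m.1; simp only [zpow_zero, one_mul]; fun_prop) H fun y => by
    rw [zpow_zero, one_mul, abs_of_nonneg (sq_nonneg _)]; nlinarith [sq_nonneg (Q12 y), sq_nonneg (Q11 y)]⟩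
  have mS : M 0 (fun y => Q11 y - Q22 y + 4 * (kap y * (y 0 * P1 y - y 1 * P2 y))) :=
    (m11.sub m22).add ((((hP1.m.coef (Cf.coord 0)).sub (hP2.m.coef (Cf.coord 1))).coef Cf.kap).cmul 4)
  have mT : M 0 (fun y => 2 * Q12 y + 4 * (kap y * (y 0 * P2 y + y 1 * P1 y))) :=
    (m12.cmul 2).add ((((hP2.m.coef (Cf.coord 0)).add (hP1.m.coef (Cf.coord 1))).coef Cf.kap).cmul 4)
  have dS := (h11.sub h22).add ((DD.coef Cd.kap ((DD.coef Cd.y0 hP1).sub (DD.coef Cd.y1 hP2))).cmul 4 |>.mono (by norm_num))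
  have dT := (h12.cmul 2).add ((DD.coef Cd.kap ((DD.coef Cd.y0 hP2).add (DD.coef Cd.y1 hP1))).cmul 4 |>.mono (by norm_num))
  refine ⟨mS, mT, ?_⟩
  have iW : Integrable (fun y => kap y^3 * (w1 y^2 + w2 y^2)) := by
    refine ((mw1.int_k mw1 3 (by norm_num)).add (mw2.int_k mw2 3 (by norm_num))).congr (Filter.Eventually.of_forall fun y => ?_)
    simp only [Pi.add_apply]; ring
  have hh := horm dS.d1 dS.d2 dT.d1 dT.d2 dS.m1.1 dS.m2.1 dT.m1.1 dT.m2.1 mS mT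
  have id1 : ∀ y, q111 y - q122 y + 4 * (-2 * y 0 * kap y ^ 2 * (y 0 * P1 y - y 1 * P2 y) + kap y * (1 * P1 y + y 0 * Q11 y - (0 * P2 y + y 1 * Q12 y)))
     + (2 * q122 y + 4 * (-2 * y 1 * kap y ^ 2 * (y 0 * P2 y + y 1 * P1 y) + kap y * (0 * P2 y + y 0 * Q22 y + (1 * P1 y + y 1 * Q12 y)))) = - (8 * kap y^2 * w1 y) := fun y => by
    rw [e1]
    linear_combination tr1 y + 4 * kap y * y 0 * tr y - 8 * kap y * P1 y * kk y
  have id2 : ∀ y, q112 y - q222 y + 4 * (-2 * y 1 * kap y ^ 2 * (y 0 * P1 y - y 1 * P2 y) + kap y * (0 * P1 y + y 0 * Q12 y - (1 * P2 y + y 1 * Q22 y)))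
     - (2 * q112 y + 4 * (-2 * y 0 * kap y ^ 2 * (y 0 * P2 y + y 1 * P1 y) + kap y * (1 * P2 y + y 0 * Q12 y + (0 * P1 y + y 1 * Q11 y)))) = 8 * kap y^2 * w2 y := fun y => by
    rw [e2]
    linear_combination -tr2 y - 4 * kap y * y 1 * tr y + 8 * kap y * P2 y * kk y
  simp only [id1, id2] at hh
  have ee : (fun y => rho y * ((-(8 * kap y^2 * w1 y))^2 + (8 * kap y^2 * w2 y)^2)) = fun y => 64 * (kap y^3 * (w1 y^2 + w2 y^2)) := by
    funext y
    have : kap y * rho y = 1 := kk y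
    linear_combination 64 * kap y^3 * (w1 y^2 + w2 y^2) * this
  rw [ee, integral_const_mul] at hh
  have := hh (iW.const_mul 64)
  linarith

lemma confpt (k a b s t f p q : ℝ) (hk : 0 ≤ k) (hab : (k*a)^2 + (k*b)^2 ≤ 1)
    (h : p^2 + q^2 = 1/4 * ((a*(s-f) - b*t)^2 + (a*t+b*(s+f))^2)) : k^3 * (p^2+q^2) ≤ k * (s^2+t^2) + k * f^2 := by
  have h1 : k^2 * (p^2+q^2) ≤ 1/2 * ((k*a)^2+(k*b)^2) * (s^2+t^2+f^2) := by
    rw [h]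
    nlinarith [sq_nonneg (k*(a*(s+f) - b*t)), sq_nonneg (k*(a*t+b*(s-f)))]
  have h2 : k^2 * (p^2+q^2) ≤ s^2+t^2+f^2 := by nlinarith [sq_nonneg s, sq_nonneg t, sq_nonneg f]
  nlinarith [mul_le_mul_of_nonneg_left h2 hk]

lemma confX {X X1 X2 a b S T τ : E2 → ℝ} (hX : DD (-3) X X1 X2) (mS : M 0 S) (mT : M 0 T) (mτ : M (-3) τ)
    (hab : ∀ y, (kap y * a y)^2 + (kap y * b y)^2 ≤ 1)
    (h : ∀ y, X1 y^2 + X2 y^2 = 1/4 * ((a y*(S y-8*kap y^2*τ y) - b y*T y)^2 + (a y*T y+b y*(S y+8*kap y^2*τ y))^2)) :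
    ∃ c, ∫ y, kap y^4 * (X y - c)^2 ≤ 1729 * ((∫ y, kap y * (S y^2+T y^2)) + 64 * ∫ y, kap y^4 * τ y^2) := by
  obtain ⟨c, hc⟩ := poincare hX
  refine ⟨c, hc.trans ?_⟩
  have i1 : Integrable (fun y => kap y * (S y^2+T y^2)) := by
    refine ((mS.int_k mS 1 (by norm_num)).add (mT.int_k mT 1 (by norm_num))).congr (Filter.Eventually.of_forall fun y => ?_)
    simp only [Pi.add_apply]; ring
  have i2 : Integrable (fun y => kap y^4 * τ y^2) := (mτ.int_k mτ 4 (by norm_num)).congr (Filter.Eventually.of_forall fun y => by ring)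
  have i3 : Integrable (fun y => kap y^3 * (X1 y^2+X2 y^2)) := by
    refine ((hX.m1.int_k hX.m1 3 (by norm_num)).add (hX.m2.int_k hX.m2 3 (by norm_num))).congr (Filter.Eventually.of_forall fun y => ?_)
    simp only [Pi.add_apply]; ring
  have := le2 1 64 i3 i1 i2 (fun y => by
    have h1 := confpt (kap y) (a y) (b y) _ _ _ _ _ (kap_pos y).le (hab y) (h y)
    have h2 : kap y * (8*kap y^2*τ y)^2 ≤ 64 * (kap y^4*τ y^2) := by
      have : 0 ≤ kap y^4*τ y^2 := by positivity
      nlinarith [kap_le y]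
    linarith)
  linarith

lemma kap_c0 (y : E2) : (kap y * y 0)^2 + (kap y * y 1)^2 ≤ 1 := by
  have h := kk y; have h1 := kap_le y; have h2 := kap_pos y
  have : (kap y * y 0)^2 + (kap y * y 1)^2 = kap y * (1 - kap y) := by linear_combination kap y * h
  nlinarith

lemma kap_ca (y : E2) (u v : ℝ) (hk : kap y * (1 + u^2+v^2) = 1) : (kap y * ((1+u^2+v^2)/2 - u^2))^2 + (kap y * (u*v))^2 ≤ 1 := by
  have : (kap y * ((1+u^2+v^2)/2 - u^2))^2 + (kap y * (u*v))^2 = 1/4 - (kap y * u)^2 := by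
    linear_combination (1/4 * (kap y * (1 + u^2+v^2) + 1)) * hk 
  nlinarith [sq_nonneg (kap y * u)]

lemma confAll {φ τ P1 P2 Q11 Q12 Q22 : E2 → ℝ} (hφ : DD (-3) φ P1 P2) (hP1 : DD (-1) P1 Q11 Q12) (hP2 : DD (-1) P2 Q12 Q22)
    (mτ : M (-3) τ) (tr : ∀ y, Q11 y + Q22 y = -(8 * kap y^2 * (φ y + τ y)))
    (mS : M 0 (fun y => Q11 y - Q22 y + 4 * (kap y * (y 0 * P1 y - y 1 * P2 y)))) (mT : M 0 (fun y => 2 * Q12 y + 4 * (kap y * (y 0 * P2 y + y 1 * P1 y)))) :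
    ∃ X1 X2 X3 : E2 → ℝ, M (-3) X1 ∧ M (-3) X2 ∧ M (-3) X3 ∧ 
     (∀ y, φ y = 2 * y 0 * kap y * X1 y + 2 * y 1 * kap y * X2 y + (2 * kap y - 1) * X3 y) ∧
     (∀ y, kap y^4 * (X1 y^2 + X2 y^2 + X3 y^2) = kap y^4 * φ y^2 + kap y^2 * (P1 y^2+P2 y^2)/4) ∧
     (∀ X ∈ ({X1, X2, X3} : Set (E2 → ℝ)), ∃ c, ∫ y, kap y^4 * (X y - c)^2 ≤ 1729 * ((∫ y, kap y * ((Q11 y - Q22 y + 4 * (kap y * (y 0 * P1 y - y 1 * P2 y)))^2 + (2 * Q12 y + 4 * (kap y * (y 0 * P2 y + y 1 * P1 y)))^2)) + 64 * ∫ y, kap y^4 * τ y^2)) := by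
  have d0 := DD.coef Cd.y0 hP1
  have d1 := DD.coef Cd.y1 hP2
  have dR := d0.add d1
  have d2 := (DD.coef (Cd.kap.mono (by norm_num : (-2:ℤ) ≤ 0)) hφ)
  have D3 := ((d2.cmul 2).sub hφ).sub (dR.mono (by norm_num))
  have D1 := ((((DD.coef Cd.rho hP1).cmul (1/2)).mono (by norm_num : (-3:ℤ) ≤ _)).sub ((DD.coef Cd.y0 dR).mono (by norm_num : (-3:ℤ) ≤ _))).add (((DD.coef ((Cd.y0.mul Cd.kap).mono (by norm_num : _ ≤ (0:ℤ))) hφ).cmul 2).mono (by norm_num : (-3:ℤ) ≤ _))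
  have D2 := ((((DD.coef Cd.rho hP2).cmul (1/2)).mono (by norm_num : (-3:ℤ) ≤ _)).sub ((DD.coef Cd.y1 dR).mono (by norm_num : (-3:ℤ) ≤ _))).add (((DD.coef ((Cd.y1.mul Cd.kap).mono (by norm_num : _ ≤ (0:ℤ))) hφ).cmul 2).mono (by norm_num : (-3:ℤ) ≤ _))
  refine ⟨_, _, _, D1.m, D2.m, D3.m, fun y => ?_, fun y => ?_, ?_⟩
  · simp only [rho]
    linear_combination (y 0 * P1 y + y 1 * P2 y - 4 * kap y * φ y) * kk y
  · simp only [rho]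
    linear_combination (4 * kap y^5 * φ y^2 - 2 * kap y^4 * φ y * (y 0 * P1 y + y 1 * P2 y) + kap y^2 * (P1 y^2+P2 y^2)/4 * (kap y * (1 + y 0^2+y 1^2) + 1)) * kk y
  · rintro X (h | h | h)
    · subst h
      refine confX (D1.mono (by norm_num)) mS mT mτ (a := fun y => rho y/2 - y 0^2) (b := fun y => y 0 * y 1) (fun y => ?_) (fun y => ?_)
      · exact kap_ca y (y 0) (y 1) (kk y)
      · have e1 : ∀ p q r s t : ℝ, p = 1/2 * r → q = 1/2 * s → p^2 + q^2 = 1/4 * (r^2+s^2) := by rintro _ _ r s t rfl rfl; ring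
        apply e1 _ _ _ _ 0
        · simp only [rho]
          linear_combination (1/2 * ((1 + y 0^2+y 1^2)/2 - y 0^2)) * tr y + (-2 * kap y * φ y + y 0 * P1 y + y 1 * P2 y) * kk y
        · simp only [rho]
          linear_combination (-1/2 * (y 0 * y 1)) * tr y + (- y 1 * P1 y + y 0 * P2 y) * kk y
    · subst h
      have := confX (D2.mono (by norm_num)) (mS.neg) mT mτ (a := fun y => rho y/2 - y 1^2) (b := fun y => y 0 * y 1) (fun y => ?_) (fun y => ?_)
      · simpa only [neg_sq] using this
      · have := kap_ca y (y 1) (y 0) (by linear_combination kk y)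
        simp only [rho]
        calc _ = _ := by ring
          _ ≤ 1 := this
      · have e1 : ∀ p q r s t : ℝ, q = 1/2 * r → p = 1/2 * s → p^2 + q^2 = 1/4 * (r^2+s^2) := by rintro _ _ r s t rfl rfl; ring
        apply e1 _ _ _ _ 0
        · simp only [rho]
          linear_combination (1/2 * ((1 + y 0^2+y 1^2)/2 - y 1^2)) * tr y + (-2 * kap y * φ y + y 0 * P1 y + y 1 * P2 y) * kk y
        · simp only [rho]
          linear_combination (-1/2 * (y 0 * y 1)) * tr y + (y 1 * P1 y - y 0 * P2 y) * kk y
    · have h : X = _ := h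
      subst h
      refine confX (D3.mono (by norm_num)) mS mT mτ (a := fun y => y 0) (b := fun y => - y 1) (fun y => ?_) (fun y => ?_)
      · have := kap_c0 y
        nlinarith
      · have e1 : ∀ p q r s t : ℝ, p = -1/2 * r → q = -1/2 * s → p^2 + q^2 = 1/4 * (r^2+s^2) := by rintro _ _ r s t rfl rfl; ring
        apply e1 _ _ _ _ 0
        · linear_combination (-1/2 * y 0) * tr y + 2 * P1 y * kk y
        · linear_combination (-1/2 * y 1) * tr y + 2 * P2 y * kk y

def nn1 (y : E2) : ℝ := 2 * y 0 * kap y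
def nn2 (y : E2) : ℝ := 2 * y 1 * kap y
def nn3 (y : E2) : ℝ := 2 * kap y - 1
lemma Cf_nn1 : Cf 0 nn1 := (((Cf.coord 0).mul Cf.kap).cmul 2 |>.mono (by norm_num)).congr fun y => by simp only [nn1]; ring
lemma Cf_nn2 : Cf 0 nn2 := (((Cf.coord 1).mul Cf.kap).cmul 2 |>.mono (by norm_num)).congr fun y => by simp only [nn2]; ring
lemma Cf_nn3 : Cf 0 nn3 := (((Cf.kap.cmul 2).mono (by norm_num)).add (Cf.const (-1))).congr fun y => by simp only [nn3]; ring
lemma nn_sq (y : E2) : nn1 y^2 + nn2 y^2 + nn3 y^2 = 1 := by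
  simp only [nn1, nn2, nn3]; linear_combination 4 * kap y * kk y

lemma Mo3 (c : ℝ) : M (-3) (fun _ => c) := ((M_one.cmul c).mono (by norm_num)).congr (by simp)
lemma M.nn {k : ℤ} {f c : E2 → ℝ} (hf : M k f) (hc : Cf 0 c) : M k (fun y => c y * f y) := (hf.coef hc).mono (by norm_num)

lemma Cdk2 : Cd (-4) (fun y => kap y * kap y) (fun y => -4 * y 0 * kap y^3) (fun y => -4 * y 1 * kap y^3) :=
  ((Cd.kap.mul Cd.kap).mono (by norm_num)).congr' (fun y => by ring) (fun y => by ring)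

lemma z12 : ZI (fun y => kap y^4 * (nn1 y * nn2 y)) :=
  (((DD.coef (Cd.y1.mul Cdk2) (DD_const 1)).Z1 (DD.coef Cdk3 (DD_const 1)) (by norm_num)).cmul (-2/5)).congr fun y => by
    simp only [nn1, nn2]; ring
lemma z13 : ZI (fun y => kap y^4 * (nn1 y * nn3 y)) :=
  ((((DD.coef Cdk2 (DD_const 1)).Z1 (DD.coef Cdk3 (DD_const 1)) (by norm_num)).cmul (-2/5)).add
    (((DD.coef Cdk2 (DD_const 1)).Z1 (DD.coef Cdk2 (DD_const 1)) (by norm_num)).cmul (1/4))).congr fun y => by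
    simp only [nn1, nn3]; ring
lemma z23 : ZI (fun y => kap y^4 * (nn2 y * nn3 y)) :=
  ((((DD.coef Cdk2 (DD_const 1)).Z2 (DD.coef Cdk3 (DD_const 1)) (by norm_num)).cmul (-2/5)).add
    (((DD.coef Cdk2 (DD_const 1)).Z2 (DD.coef Cdk2 (DD_const 1)) (by norm_num)).cmul (1/4))).congr fun y => by
    simp only [nn2, nn3]; ring

lemma nn_int {n : E2 → ℝ} (h : Cf 0 n) : Integrable (fun y => kap y^4 * n y^2) :=
  (((Mo3 1).nn h).int_k ((Mo3 1).nn h) 4 (by norm_num)).congr (Filter.Eventually.of_forall fun y => by ring)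

lemma nn_pos {n : E2 → ℝ} (h : Cf 0 n) (hc : Continuous n) (y : E2) (hy : n y ≠ 0) : 0 < ∫ y, kap y^4 * n y^2 := by
  refine integral_pos_of_integrable_nonneg_nonzero (x := y) (by have := cont_kap; fun_prop) (nn_int h) (fun y => by positivity) ?_
  have := kap_pos y
  positivity

lemma npt (a b c x y z t : ℝ) (h : a^2+b^2+c^2 = 1) (p q r : ℝ) :
    0 ≤ 2 * ((x-p)^2+(y-q)^2+(z-r)^2) + 2 * t^2 + 2 * (a*x+b*y+c*z+t) * (a*p+b*q+c*r) - (a*p+b*q+c*r)^2 := by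
  have h1 : (a*(x-p)+b*(y-q)+c*(z-r))^2 ≤ (x-p)^2+(y-q)^2+(z-r)^2 := by
    have : (x-p)^2+(y-q)^2+(z-r)^2 = (a^2+b^2+c^2) * ((x-p)^2+(y-q)^2+(z-r)^2) := by rw [h]; ring
    rw [this]
    nlinarith [sq_nonneg (a*(y-q) - b*(x-p)), sq_nonneg (a*(z-r)-c*(x-p)), sq_nonneg (b*(z-r)-c*(y-q))]
  nlinarith [sq_nonneg (a*(x-p)+b*(y-q)+c*(z-r) - t), sq_nonneg (a*x+b*y+c*z+t)]

lemma cauto {m1 m2 m3 A c1 c2 c3 K : ℝ} (h1 : 0 < m1) (h2 : 0 < m2) (h3 : 0 < m3) (hA : 0 ≤ A)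
    (h : c1^2*m1+c2^2*m2+c3^2*m3 ≤ K) : A * (c1^2+c2^2+c3^2) ≤ A * (1/m1+1/m2+1/m3) * K := by
  have e1 : c1^2 ≤ 1/m1*K := by rw [one_div_mul_eq_div, le_div_iff₀ h1]; nlinarith [mul_nonneg (sq_nonneg c2) h2.le, mul_nonneg (sq_nonneg c3) h3.le]
  have e2 : c2^2 ≤ 1/m2*K := by rw [one_div_mul_eq_div, le_div_iff₀ h2]; nlinarith [mul_nonneg (sq_nonneg c1) h1.le, mul_nonneg (sq_nonneg c3) h3.le]
  have e3 : c3^2 ≤ 1/m3*K := by rw [one_div_mul_eq_div, le_div_iff₀ h3]; nlinarith [mul_nonneg (sq_nonneg c1) h1.le, mul_nonneg (sq_nonneg c2) h2.le]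
  rw [mul_assoc]
  exact mul_le_mul_of_nonneg_left (by linarith) hA

lemma conf : ∃ C : ℝ, 0 < C ∧ ∀ (φ τ P1 P2 Q11 Q12 Q22 : E2 → ℝ) (W : ℝ), DD (-3) φ P1 P2 → DD (-1) P1 Q11 Q12 → DD (-1) P2 Q12 Q22 →
    M (-3) τ → (∀ y, Q11 y + Q22 y = -(8 * kap y^2 * (φ y + τ y))) →
    M 0 (fun y => Q11 y - Q22 y + 4 * (kap y * (y 0 * P1 y - y 1 * P2 y))) → M 0 (fun y => 2 * Q12 y + 4 * (kap y * (y 0 * P2 y + y 1 * P1 y))) →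
    (∫ y, kap y * ((Q11 y - Q22 y + 4 * (kap y * (y 0 * P1 y - y 1 * P2 y)))^2 + (2 * Q12 y + 4 * (kap y * (y 0 * P2 y + y 1 * P1 y)))^2)) ≤ 32 * W →
    (∫ y, kap y^4 * τ y^2) ≤ 1729 * W → 
    (∫ y, kap y^4 * ((φ y + τ y) * nn1 y)) = 0 → (∫ y, kap y^4 * ((φ y + τ y) * nn2 y)) = 0 → (∫ y, kap y^4 * ((φ y + τ y) * nn3 y)) = 0 →
    (∫ y, kap y^4 * φ y^2) ≤ C * W ∧ (∫ y, kap y^2 * (P1 y^2 + P2 y^2)) ≤ C * W := by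
  have m1 : 0 < ∫ y, kap y^4 * nn1 y^2 := nn_pos Cf_nn1 Cf_nn1.1 (ee 0) (by simp [nn1, ee]; exact (kap_pos _).ne')
  have m2 : 0 < ∫ y, kap y^4 * nn2 y^2 := nn_pos Cf_nn2 Cf_nn2.1 (ee 1) (by simp [nn2, ee]; exact (kap_pos _).ne')
  have m3 : 0 < ∫ y, kap y^4 * nn3 y^2 := nn_pos Cf_nn3 Cf_nn3.1 0 (by simp [nn3, kap, rho]; norm_num)
  have iA : Integrable (fun y => kap y^4) := ((Mo3 1).int_k (Mo3 1) 4 (by norm_num)).congr (Filter.Eventually.of_forall fun y => by ring)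
  have hA : 0 ≤ ∫ y, kap y^4 := integral_nonneg fun y => by positivity
  set A := ∫ y, kap y^4
  set n1 := ∫ y, kap y^4 * nn1 y^2
  set n2 := ∫ y, kap y^4 * nn2 y^2
  set n3 := ∫ y, kap y^4 * nn3 y^2
  set H := A * (1/n1+1/n2+1/n3)
  have hH : 0 ≤ H := by positivity
  set K0 : ℝ := 3 * (1729 * (32 + 64 * 1729)) with hK0
  refine ⟨4 * (2 * K0 + 2 * H * (2 * K0 + 2 * 1729)), by positivity, ?_⟩
  intro φ τ P1 P2 Q11 Q12 Q22 W hφ hP1 hP2 mτ tr mS mT b1 b2 o1 o2 o3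
  obtain ⟨X1, X2, X3, M1, M2, M3, hn, hs, hX⟩ := confAll hφ hP1 hP2 mτ tr mS mT
  obtain ⟨c1, h1⟩ := hX X1 (by simp)
  obtain ⟨c2, h2⟩ := hX X2 (by simp)
  obtain ⟨c3, h3⟩ := hX X3 (by simp)
  have N1 := M1.sub (Mo3 c1)
  have N2 := M2.sub (Mo3 c2)
  have N3 := M3.sub (Mo3 c3)
  have iK : ∀ {f : E2 → ℝ}, M (-3) f → Integrable (fun y => kap y^4 * f y^2) := fun mf =>
    (mf.int_k mf 4 (by norm_num)).congr (Filter.Eventually.of_forall fun y => by ring)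
  have iK1 := iK N1
  have iK2 := iK N2
  have iK3 := iK N3
  have iτ := iK mτ
  have za : ∀ {n : E2 → ℝ}, Cf 0 n → (∫ y, kap y^4 * ((φ y + τ y) * n y)) = 0 → ZI (fun y => kap y^4 * ((φ y + τ y) * n y)) := fun hn h =>
    ⟨((hφ.m.add mτ).int_k ((Mo3 1).nn hn) 4 (by norm_num)).congr (Filter.Eventually.of_forall fun y => by ring), h⟩
  have y1 := za Cf_nn1 o1
  have y2 := za Cf_nn2 o2
  have y3 := za Cf_nn3 o3
  have zq := (((y1.cmul (2*c1)).add (y2.cmul (2*c2))).add (y3.cmul (2*c3))).sub (((z12.cmul (2*c1*c2)).add (z13.cmul (2*c1*c3))).add (z23.cmul (2*c2*c3)))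
  obtain ⟨q, hq, zq⟩ : ∃ q, q = _ ∧ ZI q := ⟨_, rfl, zq⟩
  have iG : Integrable (fun y => 2 * (kap y^4 * (X1 y - c1)^2) + 2 * (kap y^4 * (X2 y - c2)^2) + 2 * (kap y^4 * (X3 y - c3)^2) + (2 * (kap y^4 * τ y^2) + q y)) :=
    (((iK1.const_mul 2).add (iK2.const_mul 2)).add (iK3.const_mul 2)).add ((iτ.const_mul 2).add zq.1)
  have iτq : Integrable (fun y => 2 * (kap y^4 * τ y^2) + q y) := (iτ.const_mul 2).add zq.1
  have g1 := le4 2 2 2 1 iG iK1 iK2 iK3 iτq (fun y => by linarith)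
  have g2 := le2 2 1 iτq iτ zq.1 (fun y => by linarith)
  rw [zq.2] at g2
  have g3 := le4 (f := fun _ => (0:ℝ)) (-c1^2) (-c2^2) (-c3^2) 1 (integrable_zero E2 ℝ volume) (nn_int Cf_nn1) (nn_int Cf_nn2) (nn_int Cf_nn3) iG (fun y => by
    have := mul_nonneg (pow_nonneg (kap_pos y).le 4) (npt (nn1 y) (nn2 y) (nn3 y) (X1 y) (X2 y) (X3 y) (τ y) (nn_sq y) c1 c2 c3)
    have hn : φ y = nn1 y * X1 y + nn2 y * X2 y + nn3 y * X3 y := hn y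
    rw [← hn] at this
    rw [hq]
    refine this.trans (le_of_eq ?_)
    ring)
  rw [integral_zero] at g3
  change 0 ≤ -c1^2 * n1 + -c2^2 * n2 + -c3^2 * n3 + _ at g3
  have hc := cauto m1 m2 m3 hA (c1 := c1) (c2 := c2) (c3 := c3) (K := (2 * K0 + 2 * 1729) * W) (by
    rw [hK0]; linarith)
  have iφ := iK hφ.m
  have iP : Integrable (fun y => kap y^2 * (P1 y^2 + P2 y^2)) := by
    refine ((hP1.m.int_k hP1.m 2 (by norm_num)).add (hP2.m.int_k hP2.m 2 (by norm_num))).congr (Filter.Eventually.of_forall fun y => ?_)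
    simp only [Pi.add_apply]; ring
  have pt : ∀ y, kap y^4 * φ y^2 + kap y^2 * (P1 y^2+P2 y^2)/4 ≤ 2 * (kap y^4 * (X1 y - c1)^2) + 2 * (kap y^4 * (X2 y - c2)^2) + 2 * (kap y^4 * (X3 y - c3)^2) + (2 * (c1^2+c2^2+c3^2)) * kap y^4 := fun y => by
    rw [← hs y]
    have : 0 ≤ kap y^4 := by positivity
    nlinarith [mul_nonneg this (sq_nonneg (X1 y - 2 * c1)), mul_nonneg this (sq_nonneg (X2 y - 2 * c2)), mul_nonneg this (sq_nonneg (X3 y - 2 * c3))]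
  have r1 := le4 2 2 2 (2 * (c1^2+c2^2+c3^2)) iφ iK1 iK2 iK3 iA (fun y => by
    have := pt y
    have : 0 ≤ kap y^2 * (P1 y^2+P2 y^2) := by positivity
    linarith)
  have r2 := le4 8 8 8 (8 * (c1^2+c2^2+c3^2)) iP iK1 iK2 iK3 iA (fun y => by
    have := pt y
    have : 0 ≤ kap y^4 * φ y^2 := by positivity
    linarith)
  have hc' : 2 * (c1^2+c2^2+c3^2) * A ≤ 2 * H * (2 * K0 + 2 * 1729) * W := by linarith
  have hK : 2 * (∫ y, kap y^4 * (X1 y - c1)^2) + 2 * (∫ y, kap y^4 * (X2 y - c2)^2) + 2 * (∫ y, kap y^4 * (X3 y - c3)^2) ≤ 2 * K0 * W := by rw [hK0]; linarith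
  have hp : 0 ≤ ∫ y, kap y^4 * φ y^2 := integral_nonneg fun y => by positivity
  constructor
  · change _ ≤ _ + (2 * (c1^2+c2^2+c3^2)) * A at r1
    linarith
  · change _ ≤ _ + (8 * (c1^2+c2^2+c3^2)) * A at r2
    linarith

lemma step7pt (k r a b e p q x y G D : ℝ) (hk : k * (1 + x^2+y^2) = 1) (hk0 : 0 < k)
    (hD : D = 8*k^2*G - 4*k*(x*a+y*b) - 16*k^2*e - 32*k^3*(x*p+y*q)) :
    (1+x^2+y^2)^2 * D^2 ≤ 256 * (k^2*G^2) + 64 * ((1+x^2+y^2)*(a^2+b^2)) + 1024 * e^2 + 4096 * (k^2*(p^2+q^2)) := by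
  have hr : ∀ a b : ℝ, (x*a+y*b)^2 ≤ (1+x^2+y^2) * (a^2+b^2) := fun a b => by
    nlinarith [sq_nonneg (x*b-y*a), sq_nonneg a, sq_nonneg b]
  have e1 : (1+x^2+y^2) * D = 8*k*G - 4*(x*a+y*b) - 16*k*e - 32*k^2*(x*p+y*q) := by
    rw [hD]; linear_combination (8*k*G - 4*(x*a+y*b) - 16*k*e - 32*k^2*(x*p+y*q)) * hk
  have k1 : k ≤ 1 := by nlinarith [sq_nonneg x, sq_nonneg y]
  have h1 : k^2 * e^2 ≤ e^2 := by
    have : k^2 ≤ 1 := by nlinarith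
    nlinarith [sq_nonneg e]
  have h2 : k^4 * (x*p+y*q)^2 ≤ k^2 * (p^2+q^2) := by
    have t1 : k^4 * (x*p+y*q)^2 ≤ k^4 * ((1+x^2+y^2) * (p^2+q^2)) := mul_le_mul_of_nonneg_left (hr p q) (by positivity)
    have t2 : k^4 * ((1+x^2+y^2) * (p^2+q^2)) = k * (k^2 * (p^2+q^2)) := by linear_combination (k^3 * (p^2+q^2)) * hk
    have : 0 ≤ k^2 * (p^2+q^2) := by positivity
    nlinarith
  have h3 := hr a b
  have h4 : ((1+x^2+y^2) * D)^2 ≤ 4 * ((8*k*G)^2 + (4*(x*a+y*b))^2 + (16*k*e)^2 + (32*k^2*(x*p+y*q))^2) := by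
    rw [e1]
    have : ∀ a b c d : ℝ, (a-b-c-d)^2 ≤ 4*(a^2+b^2+c^2+d^2) := fun a b c d => by
      nlinarith [sq_nonneg (a+b), sq_nonneg (a+c), sq_nonneg (a+d), sq_nonneg (b-c), sq_nonneg (b-d), sq_nonneg (c-d)]
    exact this _ _ _ _
  nlinarith

lemma step7 {ε ε1 ε2 ε11 ε12 ε22 P1 P2 G : E2 → ℝ} (hε : DD 2 ε ε1 ε2) (h1 : DD 2 ε1 ε11 ε12) (h2 : DD 2 ε2 ε12 ε22)
    (m1 : M (-1) P1) (m2 : M (-1) P2) (mG : M (-2) G)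
    (UG : ∀ y, ε11 y + ε22 y = 8*kap y^2*G y - 4*kap y*(y 0*ε1 y+y 1*ε2 y) - 16*kap y^2*ε y - 32*kap y^3*(y 0*P1 y+y 1*P2 y)) :
    Integrable (fun y => rho y^2 * (ε11 y + ε22 y)^2) ∧ Integrable (fun y => rho y * (ε1 y^2 + ε2 y^2)) ∧ Integrable (fun y => ε y^2) ∧ Integrable (fun y => kap y^2 * (P1 y^2+P2 y^2)) ∧
    (∫ y, rho y^2 * (ε11 y + ε22 y)^2) ≤ 512 * (∫ y, kap y^2 * G y^2) + 6400 * (∫ y, ε y^2) + 8192 * (∫ y, kap y^2 * (P1 y^2+P2 y^2)) ∧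
    (∫ y, rho y * (ε1 y^2 + ε2 y^2)) ≤ 1/128 * (∫ y, rho y^2 * (ε11 y + ε22 y)^2) + 34 * (∫ y, ε y^2) := by
  have iA : Integrable (fun y => rho y^2 * (ε11 y + ε22 y)^2) := by
    refine (h1.m1.add h2.m2).2.congr (Filter.Eventually.of_forall fun y => ?_)
    simp only; norm_cast
  have iB : Integrable (fun y => rho y * (ε1 y^2 + ε2 y^2)) := by
    refine (((h1.m.coef Cf.rho).int h1.m (by norm_num)).add ((h2.m.coef Cf.rho).int h2.m (by norm_num))).congr (Filter.Eventually.of_forall fun y => ?_)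
    simp only [Pi.add_apply]; ring
  have iE : Integrable (fun y => ε y^2) := (hε.m.int hε.m (by norm_num)).congr (Filter.Eventually.of_forall fun y => by ring)
  have iP : Integrable (fun y => kap y^2 * (P1 y^2 + P2 y^2)) := by
    refine ((m1.int_k m1 2 (by norm_num)).add (m2.int_k m2 2 (by norm_num))).congr (Filter.Eventually.of_forall fun y => ?_)
    simp only [Pi.add_apply]; ring
  have iG : Integrable (fun y => kap y^2 * G y^2) := (mG.int_k mG 2 (by norm_num)).congr (Filter.Eventually.of_forall fun y => by ring)
  have z1 := (DD.coef Cd.rho hε).Z1 h1 (by norm_num)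
  have z2 := (DD.coef Cd.rho hε).Z2 h2 (by norm_num)
  have z3 := (DD.coef Cd.y0 hε).Z1 hε (by norm_num)
  have z4 := (DD.coef Cd.y1 hε).Z2 hε (by norm_num)
  have z := ((z1.add z2).sub (z3.add z4)).congr (g := fun y => rho y * (ε1 y^2+ε2 y^2) + rho y * ε y * (ε11 y + ε22 y) - 2 * ε y^2) (fun y => by ring)
  have hB := le4 1 (1/128) 34 0 iB z.1 iA iE iE (fun y => by
    nlinarith [sq_nonneg (rho y * (ε11 y + ε22 y) + 64 * ε y)])
  rw [z.2] at hB
  have hA := le4 256 64 1024 4096 iA iG iB iE iP (fun y => step7pt (kap y) 0 _ _ _ _ _ _ _ (G y) _ (kk y) (kap_pos y) (UG y))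
  refine ⟨iA, iB, iE, iP, ?_, ?_⟩ <;> linarith

lemma core : ∃ δ : ℝ, 0 < δ ∧ ∀ ε ε1 ε2 ε11 ε12 ε22 w w1 w2 w11 w12 w22 : E2 → ℝ, DD 2 ε ε1 ε2 → DD 2 ε1 ε11 ε12 → DD 2 ε2 ε12 ε22 →
    DD (-3) w w1 w2 → DD (-2) w1 w11 w12 → DD (-2) w2 w12 w22 →
    (∀ y, 8 * kap y^2 * w y = ε y - 8 * kap y^2 * Psi ε y) →
    (∀ y, 8 * kap y^2 * w1 y = ε1 y + 4 * kap y * y 0 * ε y - 8 * kap y^2 * PP 0 ε y) →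
    (∀ y, 8 * kap y^2 * w2 y = ε2 y + 4 * kap y * y 1 * ε y - 8 * kap y^2 * PP 1 ε y) →
    (∀ y, ε11 y + ε22 y = 8*kap y^2*(w11 y + w22 y - 4 * kap y * (y 0 * w1 y + y 1 * w2 y)) - 4*kap y*(y 0*ε1 y+y 1*ε2 y) - 16*kap y^2*ε y - 32*kap y^3*(y 0*PP 0 ε y+y 1*PP 1 ε y)) →
    (∫ y, kap y^2 * (ε y * nn1 y)) = 0 → (∫ y, kap y^2 * (ε y * nn2 y)) = 0 → (∫ y, kap y^2 * (ε y * nn3 y)) = 0 →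
    Integrable (fun y => rho y^2 * (ε11 y + ε22 y)^2) ∧ Integrable (fun y => rho y * (ε1 y^2 + ε2 y^2)) ∧ Integrable (fun y => kap y^2 * (PP 0 ε y^2+PP 1 ε y^2)) ∧
    δ * (4 * (∫ y, rho y^2 * (ε11 y + ε22 y)^2) + 2 * (∫ y, rho y * (ε1 y^2 + ε2 y^2)) + (∫ y, ε y^2) + ∫ y, kap y^2 * (PP 0 ε y^2+PP 1 ε y^2)) ≤ 
      8 * ∫ y, kap y^2 * (w11 y + w22 y - 4 * kap y * (y 0 * w1 y + y 1 * w2 y))^2 := by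
  obtain ⟨C, hC, conf⟩ := conf
  set K : ℝ := 10 * 512 + (10 * 6400 + 69) * (128 * (C + 1729) * 17290) + (10 * 8192 + 1) * (C * 17290) with hK
  have hK0 : 0 < K := by positivity
  refine ⟨8 / K, by positivity, ?_⟩
  intro ε ε1 ε2 ε11 ε12 ε22 w w1 w2 w11 w12 w22 hε h1 h2 hw hw1 hw2 e e1 e2 UG o1 o2 o3
  have hPsi := Psi_DD hε.m
  have hP1 := PP_DD hε 0
  have cu : PP 1 ε1 = PP 0 ε2 := funext fun x => (PP_curl hε x).symm
  have cu2 : PP 0 ε22 = PP 1 ε12 := funext fun x => PP_curl h2 x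
  have hP2 := PP_DD hε 1
  rw [cu] at hP2
  have h11 := PP_DD h1 0
  have h12 := PP_DD h2 0
  rw [cu2] at h12
  have h22 := PP_DD h2 1
  obtain ⟨mS, mT, hST⟩ := STineq hP1 hP2 h11 h12 h22 (hε.m.mono (by norm_num)) (PP_div hε) (PP_div h1) (PP_div h2) e1 e2 hw1.m hw2.m
  obtain ⟨c, hW, hτ⟩ := energy hw hw1 hw2
  have dφ : DD (-3) (fun y => Psi ε y + c) (PP 0 ε) (PP 1 ε) := (hPsi.add ((DD_const c).mono (by norm_num))).congr (fun y => rfl) (fun y => by simp) (fun y => by simp)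
  have mτ : M (-3) (fun y => w y - c) := hw.m.sub (Mo3 c)
  have eq8 : ∀ y, 8 * kap y^2 * ((Psi ε y + c) + (w y - c)) = ε y := fun y => by linear_combination e y
  have oo : ∀ n : E2 → ℝ, (∫ y, kap y^2 * (ε y * n y)) = 0 → ∫ y, kap y^4 * (((Psi ε y + c) + (w y - c)) * n y) = 0 := fun n hn => by
    have : (fun y => kap y^4 * (((Psi ε y + c) + (w y - c)) * n y)) = fun y => 1/8 * (kap y^2 * (ε y * n y)) := by
      funext y; linear_combination (1/8 * kap y^2 * n y) * eq8 y
    rw [this, integral_const_mul, hn, mul_zero]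
  obtain ⟨c1, c2⟩ := conf _ _ _ _ _ _ _ _ dφ hP1 hP2 mτ (fun y => by rw [eq8]; exact PP_div hε y) mS mT hST hτ (oo _ o1) (oo _ o2) (oo _ o3)
  have mG : M (-2) (fun y => w11 y + w22 y - 4 * kap y * (y 0 * w1 y + y 1 * w2 y)) :=
    ((hw1.m1.add hw2.m2).sub (((((hw1.m.coef (Cf.coord 0)).add (hw2.m.coef (Cf.coord 1))).coef Cf.kap).cmul 4).mono (by norm_num))).congr fun y => by ring
  obtain ⟨iA, iB, iE, iP, bA, bB⟩ := step7 hε h1 h2 hP1.m hP2.m mG UG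
  refine ⟨iA, iB, iP, ?_⟩
  have iK : ∀ {f : E2 → ℝ}, M (-3) f → Integrable (fun y => kap y^4 * f y^2) := fun mf =>
    (mf.int_k mf 4 (by norm_num)).congr (Filter.Eventually.of_forall fun y => by ring)
  have bE := le2 128 128 iE (iK dφ.m) (iK mτ) (fun y => by
    rw [← eq8 y]
    nlinarith [sq_nonneg (kap y^2 * ((Psi ε y + c) - (w y - c)))])
  set A := ∫ y, rho y^2 * (ε11 y + ε22 y)^2
  set B := ∫ y, rho y * (ε1 y^2 + ε2 y^2)
  set E := ∫ y, ε y^2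
  set P := ∫ y, kap y^2 * (PP 0 ε y^2+PP 1 ε y^2)
  set D := ∫ y, kap y^2 * (w11 y + w22 y - 4 * kap y * (y 0 * w1 y + y 1 * w2 y))^2
  set W := ∫ y, kap y^3 * (w1 y^2+w2 y^2)
  have A0 : 0 ≤ A := integral_nonneg fun y => by positivity
  have bE' : E ≤ 128 * (C+1729) * W := by linarith
  have bE2 : E ≤ 128 * (C+1729) * 17290 * D := by
    calc E ≤ 128 * (C+1729) * W := bE'
      _ ≤ 128 * (C+1729) * (17290 * D) := mul_le_mul_of_nonneg_left hW (by positivity)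
      _ = _ := by ring
  have bP2 : P ≤ C * 17290 * D := by
    calc P ≤ C * W := c2
      _ ≤ C * (17290 * D) := mul_le_mul_of_nonneg_left hW (by positivity)
      _ = _ := by ring
  have : 4 * A + 2 * B + E + P ≤ K * D := by
    rw [hK]; linarith
  rw [div_mul_eq_mul_div, div_le_iff₀ hK0]
  linarith

lemma U2_eq (y : E2) : U2 y = 8 * kap y^2 := by
  unfold U2 kap; rw [rho_eq, inv_pow, div_eq_mul_inv]

lemma pdCD {ε : E2 → ℝ} {n : ℕ} (h : ContDiff ℝ (n+1) ε) (i : Fin 2) : ContDiff ℝ n (pd i ε) := by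
  unfold pd
  exact (h.fderiv_right (m := n) le_rfl).clm_apply contDiff_const

lemma pd_symm {ε : E2 → ℝ} (h : ContDiff ℝ 2 ε) : pd 0 (pd 1 ε) = pd 1 (pd 0 ε) := by
  funext y
  have hd : Differentiable ℝ (fderiv ℝ ε) := (h.fderiv_right (m := 1) (by norm_num)).differentiable (by norm_num)
  have key : ∀ i j : Fin 2, pd i (pd j ε) y = fderiv ℝ (fderiv ℝ ε) y (EuclideanSpace.single i 1) (EuclideanSpace.single j 1) := fun i j => by
    have : HasFDerivAt (pd j ε) ((fderiv ℝ (fderiv ℝ ε) y).flip (EuclideanSpace.single j 1)) y := by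
      have := (hd y).hasFDerivAt.clm_apply (hasFDerivAt_const (EuclideanSpace.single j (1:ℝ)) y)
      refine this.congr_fderiv ?_
      ext v; simp
    change fderiv ℝ (pd j ε) y _ = _
    rw [this.fderiv]; rfl
  rw [key, key]
  exact (h.contDiffAt.isSymmSndFDerivAt (by simp)) _ _

lemma HD_U2 (i : Fin 2) : HD i U2 (fun y => -32 * kap y^3 * y i) := by
  have := (((HD_kap i).mul (HD_kap i)).cmul 8)
  have e : U2 = fun y => 8 * (kap y * kap y) := by funext y; rw [U2_eq]; ring
  rw [e]
  exact this.congr' fun y => by ring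

lemma pd_U2 (i : Fin 2) : pd i U2 = fun y => -32 * kap y^3 * y i :=
  pd_eq (HD_diff (HD_U2 0) (HD_U2 1) (by have := cont_kap; fun_prop) (by have := cont_kap; fun_prop)) (HD_U2 i)

lemma Lam_U2 (y : E2) : Lam U2 y = 16 * (kap y^2 * nn3 y) := by
  unfold Lam
  rw [inner_grad, pd_U2, pd_U2, U2_eq]; simp only [nn3]
  linear_combination -32 * kap y^2 * kk y

lemma M2_of {ε f : E2 → ℝ} (hc : Continuous f) {g : E2 → ℝ} (hg : Integrable (fun y => g y / U2 y)) (h : ∀ y, f y^2 ≤ g y) : M 2 f := by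
  have hr := cont_rho
  refine ⟨hc, integrable_of_le (by simp only [zpow_ofNat]; fun_prop) (hg.const_mul 8) fun y => ?_⟩
  have h1 : kap y * rho y = 1 := kk y
  have h2 : 8 * (g y / U2 y) = rho y^2 * g y := by
    rw [U2_eq]
    have := (kap_pos y).ne'
    field_simp
    linear_combination (-(kap y * rho y + 1) * g y) * h1
  rw [h2, zpow_ofNat, abs_of_nonneg (by positivity)]
  exact mul_le_mul_of_nonneg_left (h y) (by positivity)

lemma setup {ε : E2 → ℝ} (h : ContDiff ℝ 2 ε) (hi : Integrable (fun y : E2 =>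
          ((ε y) ^ 2 + ‖gradient ε y‖ ^ 2
            + ∑ i : Fin 2, ∑ j : Fin 2, (pd i (pd j ε) y) ^ 2) / U2 y)) :
    DD 2 ε (pd 0 ε) (pd 1 ε) ∧ DD 2 (pd 0 ε) (pd 0 (pd 0 ε)) (pd 1 (pd 0 ε)) ∧ DD 2 (pd 1 ε) (pd 1 (pd 0 ε)) (pd 1 (pd 1 ε)) := by
  have c1 : ∀ i, ContDiff ℝ 1 (pd i ε) := fun i => pdCD (n := 1) (by exact_mod_cast h) i
  have c2 : ∀ i j, ContDiff ℝ 0 (pd i (pd j ε)) := fun i j => pdCD (n := 0) (by exact_mod_cast c1 j) i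
  simp only [grad_norm, Fin.sum_univ_two] at hi
  have m0 : M 2 ε := M2_of (ε := ε) h.continuous hi fun y => by 
    have := sq_nonneg (pd 0 ε y)
    nlinarith [sq_nonneg (pd 1 ε y), sq_nonneg (pd 0 (pd 0 ε) y), sq_nonneg (pd 0 (pd 1 ε) y), sq_nonneg (pd 1 (pd 0 ε) y), sq_nonneg (pd 1 (pd 1 ε) y)]
  have m1 : ∀ i, M 2 (pd i ε) := fun i => M2_of (ε := ε) (c1 i).continuous hi fun y => by
    fin_cases i <;> simp only [Fin.zero_eta, Fin.mk_one, Fin.isValue] <;>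
    nlinarith [sq_nonneg (ε y), sq_nonneg (pd 0 ε y), sq_nonneg (pd 1 ε y), sq_nonneg (pd 0 (pd 0 ε) y), sq_nonneg (pd 0 (pd 1 ε) y), sq_nonneg (pd 1 (pd 0 ε) y), sq_nonneg (pd 1 (pd 1 ε) y)]
  have m2 : ∀ i j, M 2 (pd i (pd j ε)) := fun i j => M2_of (ε := ε) (c2 i j).continuous hi fun y => by
    fin_cases i <;> fin_cases j <;> simp only [Fin.zero_eta, Fin.mk_one, Fin.isValue] <;>
    nlinarith [sq_nonneg (ε y), sq_nonneg (pd 0 ε y), sq_nonneg (pd 1 ε y), sq_nonneg (pd 0 (pd 0 ε) y), sq_nonneg (pd 0 (pd 1 ε) y), sq_nonneg (pd 1 (pd 0 ε) y), sq_nonneg (pd 1 (pd 1 ε) y)]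
  have d0 := h.differentiable (by norm_num)
  have d1 : ∀ i, Differentiable ℝ (pd i ε) := fun i => (c1 i).differentiable (by norm_num)
  refine ⟨⟨.of_contDiff d0, .of_contDiff d0, m0, m1 0, m1 1⟩, ⟨.of_contDiff (d1 0), .of_contDiff (d1 0), m1 0, m2 0 0, m2 1 0⟩, ?_⟩
  rw [← pd_symm h]
  exact ⟨.of_contDiff (d1 1), .of_contDiff (d1 1), m1 1, m2 0 1, m2 1 1⟩

lemma DD.pd_eq {k : ℤ} {f f1 f2 : E2 → ℝ} (h : DD k f f1 f2) : pd 0 f = f1 ∧ pd 1 f = f2 :=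
  have hd := HD_diff h.d1 h.d2 h.m1.1 h.m2.1
  ⟨_root_.pd_eq hd h.d1, _root_.pd_eq hd h.d2⟩

lemma L0_eq {ε w w1 w2 w11 w12 w21 w22 : E2 → ℝ} (hw : DD (-3) w w1 w2) (h1 : DD (-2) w1 w11 w12) (h2 : DD (-2) w2 w21 w22)
    (e : ∀ y, w y = ε y / U2 y - Psi ε y) (y : E2) :
    L0 ε y = 8 * kap y^2 * (w11 y + w22 y - 4 * kap y * (y 0 * w1 y + y 1 * w2 y)) := by
  have ew : (fun w => ε w / U2 w - Psi ε w) = w := funext fun y => (e y).symm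
  have a1 := ((DD.coef Cdk2 h1).cmul 8)
  have a2 := ((DD.coef Cdk2 h2).cmul 8)
  unfold L0 div2
  rw [ew, Fin.sum_univ_two]
  have f1 : (fun z => (U2 z • gradient w z) 0) = fun y => 8 * (kap y * kap y * w1 y) := by
    funext z; rw [PiLp.smul_apply, grad_coord, hw.pd_eq.1, U2_eq, smul_eq_mul]; ring
  have f2 : (fun z => (U2 z • gradient w z) 1) = fun y => 8 * (kap y * kap y * w2 y) := by
    funext z; rw [PiLp.smul_apply, grad_coord, hw.pd_eq.2, U2_eq, smul_eq_mul]; ring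
  rw [f1, f2]
  have g1 := congrFun a1.pd_eq.1 y
  have g2 := congrFun a2.pd_eq.2 y
  unfold pd at g1 g2
  rw [g1, g2]
  ring

lemma L0_int {ε w w1 w2 w11 w12 w21 w22 : E2 → ℝ} (hw : DD (-3) w w1 w2) (h1 : DD (-2) w1 w11 w12) (h2 : DD (-2) w2 w21 w22)
    (e : ∀ y, w y = ε y / U2 y - Psi ε y) :
    (∫ y : E2, (L0 ε y) ^ 2 / U2 y) = 8 * ∫ y, kap y^2 * (w11 y + w22 y - 4 * kap y * (y 0 * w1 y + y 1 * w2 y))^2 := by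
  rw [← integral_const_mul]
  refine integral_congr_ae (Filter.Eventually.of_forall fun y => ?_)
  simp only
  rw [L0_eq hw h1 h2 e, U2_eq]
  have := (kap_pos y).ne'
  field_simp

/-- higher order coercivity of the linearized operator `L₀`. -/
theorem stmt10 :
    ∃ δ : ℝ, 0 < δ ∧
      ∀ ε : E2 → ℝ, ContDiff ℝ 2 ε →
        Integrable (fun y : E2 =>
          ((ε y) ^ 2 + ‖gradient ε y‖ ^ 2
            + ∑ i : Fin 2, ∑ j : Fin 2, (pd i (pd j ε) y) ^ 2) / U2 y) →
        (∫ y : E2, ε y * Lam U2 y) = 0 →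
        (∫ y : E2, ε y * pd 0 U2 y) = 0 →
        (∫ y : E2, ε y * pd 1 U2 y) = 0 →
        (∫ y : E2, (L0 ε y) ^ 2 / U2 y)
          ≥ δ * ((∫ y : E2, (1 + ‖y‖) ^ 4 * (lap2 ε y) ^ 2)
              + (∫ y : E2, (1 + ‖y‖) ^ 2 * ‖gradient ε y‖ ^ 2)
              + (∫ y : E2, (ε y) ^ 2)
              + (∫ y : E2, ‖gradient (Psi ε) y‖ ^ 2 / (1 + ‖y‖) ^ 4)) := by
  obtain ⟨δ, hδ, core⟩ := core
  refine ⟨δ, hδ, ?_⟩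
  intro ε hc hi oL o0 o1
  obtain ⟨hε, h1, h2⟩ := setup hc hi
  have hPsi := Psi_DD hε.m
  have hP1 := PP_DD hε 0
  have hP2 := PP_DD hε 1
  have crr : Cd 4 (fun y => rho y * rho y) (fun y => 4 * rho y * y 0) (fun y => 4 * rho y * y 1) :=
    ((Cd.rho.mul Cd.rho).mono (by norm_num)).congr' (fun y => by ring) (fun y => by ring)
  have hkr : ∀ y, kap y * rho y = 1 := fun y => kk y
  have hw : DD (-3) (fun y => 1/8 * (rho y * rho y * ε y) - Psi ε y) (fun y => 1/8 * (rho y * rho y * pd 0 ε y) + 1/2 * (rho y * y 0 * ε y) - PP 0 ε y)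
      (fun y => 1/8 * (rho y * rho y * pd 1 ε y) + 1/2 * (rho y * y 1 * ε y) - PP 1 ε y) :=
    ((((DD.coef crr hε).cmul (1/8)).mono (by norm_num)).sub hPsi).congr (fun y => rfl) (fun y => by ring) (fun y => by ring)
  have hw1 := (((DD.coef crr h1).cmul (1/8)).add (((DD.coef (Cd.rho.mul Cd.y0) hε).cmul (1/2)).mono (by norm_num))).sub (hP1.mono (by norm_num))
  have hw2 := (((DD.coef crr h2).cmul (1/8)).add (((DD.coef (Cd.rho.mul Cd.y1) hε).cmul (1/2)).mono (by norm_num))).sub (hP2.mono (by norm_num))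
  have hw2' := hw2.congr (g1 := fun y => 1 / 8 * (4 * rho y * y 1 * pd 0 ε y + rho y * rho y * pd 1 (pd 0 ε) y) +
        1 / 2 * ((2 * y 1 * y 0 + rho y * 0) * ε y + rho y * y 0 * pd 1 ε y) - PP 0 (pd 1 ε) y) (fun y => rfl) (fun y => by have := PP_curl hε y; simp only; linear_combination this) (fun y => rfl)
  have o1' : (∫ y, kap y^2 * (ε y * nn1 y)) = 0 := by
    have : (fun y => kap y^2 * (ε y * nn1 y)) = fun y => -1/16 * (ε y * pd 0 U2 y) := by
      funext y; rw [pd_U2]; simp only [nn1]; ring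
    rw [this, integral_const_mul, o0, mul_zero]
  have o2' : (∫ y, kap y^2 * (ε y * nn2 y)) = 0 := by
    have : (fun y => kap y^2 * (ε y * nn2 y)) = fun y => -1/16 * (ε y * pd 1 U2 y) := by
      funext y; rw [pd_U2]; simp only [nn2]; ring
    rw [this, integral_const_mul, o1, mul_zero]
  have o3' : (∫ y, kap y^2 * (ε y * nn3 y)) = 0 := by
    have : (fun y => kap y^2 * (ε y * nn3 y)) = fun y => 1/16 * (ε y * Lam U2 y) := by
      funext y; rw [Lam_U2]; ring
    rw [this, integral_const_mul, oL, mul_zero]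
  obtain ⟨iA, iB, iP, key⟩ := core ε _ _ _ _ _ _ _ _ _ _ _ hε h1 h2 hw hw1 hw2'
    (fun y => by linear_combination ((kap y * rho y + 1) * ε y) * hkr y)
    (fun y => by linear_combination ((kap y * rho y + 1) * pd 0 ε y + 4 * kap y * y 0 * ε y) * hkr y)
    (fun y => by linear_combination ((kap y * rho y + 1) * pd 1 ε y + 4 * kap y * y 1 * ε y) * hkr y)
    (fun y => by
      have dv := PP_div hε y
      have hk := hkr y
      have hk2 := kk y
      linear_combination (-(kap y * rho y + 1) * (pd 0 (pd 0 ε) y + pd 1 (pd 1 ε) y) + 4 * kap y * (kap y * rho y - 1) * (y 0 * pd 0 ε y + y 1 * pd 1 ε y) + ε y * (16 * kap y^2 * (y 0^2 + y 1^2) - 8 * kap y)) * hk + 8 * kap y * ε y * hk2 + 8 * kap y^2 * dv) o1' o2' o3'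
  have hL := L0_int hw hw1 hw2' (ε := ε) (fun y => by
    rw [U2_eq]
    have := (kap_pos y).ne'
    field_simp
    linear_combination ((kap y * rho y + 1) * ε y) * hkr y)
  rw [hL]
  refine ge_iff_le.2 (le_trans (mul_le_mul_of_nonneg_left ?_ hδ.le) key)
  have t1 : ∫ y : E2, (1 + ‖y‖) ^ 4 * (lap2 ε y) ^ 2 ≤ 4 * ∫ y, rho y^2 * (pd 0 (pd 0 ε) y + pd 1 (pd 1 ε) y)^2 := by
    rw [← integral_const_mul]
    refine integral_mono_of_nonneg (Filter.Eventually.of_forall fun y => by positivity) (iA.const_mul 4) (Filter.Eventually.of_forall fun y => ?_)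
    simp only [lap2, Fin.sum_univ_two]
    rw [← mul_assoc]
    refine mul_le_mul_of_nonneg_right ?_ (sq_nonneg _)
    have : (1+‖y‖)^2 ≤ 2 * rho y := by rw [rho_eq]; nlinarith [sq_nonneg (1-‖y‖)]
    calc (1+‖y‖)^4 = ((1+‖y‖)^2)^2 := by ring
      _ ≤ (2 * rho y)^2 := pow_le_pow_left₀ (by positivity) this 2
      _ = _ := by ring
  have t2 : ∫ y : E2, (1 + ‖y‖) ^ 2 * ‖gradient ε y‖ ^ 2 ≤ 2 * ∫ y, rho y * (pd 0 ε y^2 + pd 1 ε y^2) := by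
    rw [← integral_const_mul]
    refine integral_mono_of_nonneg (Filter.Eventually.of_forall fun y => by positivity) (iB.const_mul 2) (Filter.Eventually.of_forall fun y => ?_)
    simp only [grad_norm]
    rw [← mul_assoc]
    refine mul_le_mul_of_nonneg_right ?_ (by positivity)
    rw [rho_eq]; nlinarith [sq_nonneg (1-‖y‖)]
  have t4 : ∫ y : E2, ‖gradient (Psi ε) y‖ ^ 2 / (1 + ‖y‖) ^ 4 ≤ ∫ y, kap y^2 * (PP 0 ε y^2+PP 1 ε y^2) := by
    refine integral_mono_of_nonneg (Filter.Eventually.of_forall fun y => by positivity) iP (Filter.Eventually.of_forall fun y => ?_)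
    simp only [grad_norm]
    rw [hPsi.pd_eq.1, hPsi.pd_eq.2, div_eq_inv_mul]
    refine mul_le_mul_of_nonneg_right ?_ (by positivity)
    unfold kap
    rw [← inv_pow]
    have : rho y ≤ (1+‖y‖)^2 := by rw [rho_eq]; nlinarith [norm_nonneg y]
    calc ((1+‖y‖)⁻¹)^4 = (((1+‖y‖)^2)⁻¹)^2 := by rw [← inv_pow]; ring
      _ ≤ _ := pow_le_pow_left₀ (by positivity) (inv_anti₀ (rho_pos y) this) 2
  linarith
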